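/- There exist ε > 0 and C > 0, depending only on Ω, such that for every λ > 0 and every Neumann eigenfunction φ of Ω with eigenvalue λ² there is a function F : ℂ → ℂ, holomorphic on the strip S_ε = {t ∈ ℂ : |Im t| < ε}, with F(t + ℓ) = F(t) for all t ∈ S_ε and F(s) = φ(q(s)) for all real s, and the set of complex boundary nodal points {t ∈ ℂ : 0 ≤ Re t < ℓ, |Im t| ≤ ε/2, F(t) = 0} is finite and has cardinality at most C·λ. -/

import Mathlib

open MeasureTheory Real
open scoped RealInnerProductSpace

noncomputable section

abbrev E2 : Type := EuclideanSpace ℝ (Fin 2)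

/-- The Euclidean Laplacian `∂²/∂x₁² + ∂²/∂x₂²` on `ℝ²`. -/
def lap (φ : E2 → ℝ) (x : E2) : ℝ :=
  ∑ i : Fin 2,
    fderiv ℝ (fun y => fderiv ℝ φ y (EuclideanSpace.single i 1)) x (EuclideanSpace.single i 1)

/-- A bounded open connected planar domain. -/
structure IsPlaneDomain (Ω : Set E2) : Prop where
  isOpen : IsOpen Ω
  isBounded : Bornology.IsBounded Ω
  isConnected : IsConnected Ω

/-- An arc-length parametrization `q` of the boundary of `Ω` (periodic with period `len`,
injective on `[0, len)`, unit speed, image equal to the frontier of `Ω`), together with the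
unit normal `ν` along the boundary, pointing into `Ω`. -/
structure BoundaryParam (Ω : Set E2) where
  len : ℝ
  len_pos : 0 < len
  q : ℝ → E2
  qd : ℝ → E2
  hasDerivAt : ∀ s, HasDerivAt q (qd s) s
  periodic : Function.Periodic q len
  injOn : Set.InjOn q (Set.Ico 0 len)
  unitSpeed : ∀ s, ‖qd s‖ = 1
  range_eq : Set.range q = frontier Ω
  ν : ℝ → E2
  ν_unit : ∀ s, ‖ν s‖ = 1
  ν_orth : ∀ s, ⟪ν s, qd s⟫ = 0
  ν_inward : ∀ s, ∃ δ > 0, ∀ t ∈ Set.Ioo (0 : ℝ) δ, q s + t • ν s ∈ Ω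

/-- The boundary parametrization is real-analytic. -/
def BoundaryParam.IsAnalytic {Ω : Set E2} (B : BoundaryParam Ω) : Prop :=
  AnalyticOnNhd ℝ B.q Set.univ

/-- `φ` is a Neumann eigenfunction of `Ω` with eigenvalue `lam²`: it is real-analytic on an
open neighborhood of the closure of `Ω`, not identically zero on `Ω`, satisfies
`Δφ = -lam² φ` on `Ω` and has vanishing normal derivative along the boundary. -/
structure IsNeumannEigenfunction {Ω : Set E2} (B : BoundaryParam Ω) (lam : ℝ)
    (φ : E2 → ℝ) : Prop where
  analytic : ∃ U : Set E2, IsOpen U ∧ closure Ω ⊆ U ∧ AnalyticOnNhd ℝ φ U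
  nontrivial : ∃ x ∈ Ω, φ x ≠ 0
  eigen : ∀ x ∈ Ω, lap φ x = -lam ^ 2 * φ x
  neumann : ∀ s : ℝ, ⟪gradient φ (B.q s), B.ν s⟫ = 0

namespace Nodal
open Set Filter Topology Metric

/-- Continuity of a parametric interval integral, relative to a set of parameters. -/
lemma continuousOn_integral_param {T : Type*} [TopologicalSpace T] {S : Set T} {a b : ℝ}
    (hab : a ≤ b) {g : T → ℝ → ℂ} (hc : ContinuousOn (fun z : T × ℝ => g z.1 z.2) (S ×ˢ Icc a b)) :
    ContinuousOn (fun p => ∫ x in a..b, g p x) S := by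
  rw [continuousOn_iff_continuous_domRestrict]
  have h1 : Continuous (fun z : S × ℝ => g z.1 (projIcc a b hab z.2)) := by
    have : Continuous (fun z : S × ℝ => ((z.1 : T), ((projIcc a b hab z.2 : Icc a b) : ℝ))) := by
      fun_prop
    exact hc.comp_continuous this (fun z => ⟨z.1.2, (projIcc a b hab z.2).2⟩)
  have h2 := intervalIntegral.continuous_parametric_intervalIntegral_of_continuous' (μ := volume)
    (f := fun (p : S) x => g p (projIcc a b hab x)) h1 a b
  convert h2 using 2 with p
  apply intervalIntegral.integral_congr
  intro x hx
  rw [uIcc_of_le hab] at hx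
  simp [projIcc_of_mem hab hx]

/-- An integral of holomorphic functions depending continuously on a parameter is holomorphic. -/
lemma differentiableOn_integral_param {a b : ℝ} (hab : a ≤ b) {U : Set ℂ} (hU : IsOpen U)
    {g : ℂ → ℝ → ℂ} (hc : ContinuousOn (fun z : ℂ × ℝ => g z.1 z.2) (U ×ˢ Icc a b))
    (hd : ∀ x ∈ Icc a b, DifferentiableOn ℂ (fun t => g t x) U) :
    DifferentiableOn ℂ (fun t => ∫ x in a..b, g t x) U := by
  intro t₀ ht₀
  obtain ⟨r, hr, hball⟩ : ∃ r > 0, closedBall t₀ (2 * r) ⊆ U := by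
    obtain ⟨r, hr, h⟩ := Metric.nhds_basis_closedBall.mem_iff.1 (hU.mem_nhds ht₀)
    exact ⟨r / 2, by positivity, by convert h using 2; ring⟩
  have hcont : ∀ t ∈ U, ContinuousOn (g t) (Icc a b) := fun t ht =>
    hc.comp (by fun_prop : Continuous fun x : ℝ => (t, x)).continuousOn (fun x hx => ⟨ht, hx⟩)
  have hmeas : ∀ t ∈ U, AEStronglyMeasurable (g t) (volume.restrict (uIoc a b)) := by
    intro t ht
    rw [uIoc_of_le hab]
    exact ((hcont t ht).mono Ioc_subset_Icc_self).aestronglyMeasurable measurableSet_Ioc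
  obtain ⟨C, hC⟩ := ((isCompact_closedBall t₀ (2 * r)).prod (isCompact_Icc (a := a) (b := b))).exists_bound_of_continuousOn
    (hc.mono (prod_mono hball le_rfl))
  have hU' : ∀ t ∈ ball t₀ r, closedBall t r ⊆ closedBall t₀ (2 * r) := by
    intro t ht
    apply closedBall_subset_closedBall'
    have := mem_ball.1 ht
    linarith
  have hball' : ball t₀ r ⊆ U := fun t ht =>
    hball (hU' t ht (mem_closedBall_self hr.le))
  have hder : ∀ x ∈ Icc a b, ∀ t ∈ ball t₀ r, HasDerivAt (fun t => g t x) (deriv (fun t => g t x) t) t :=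
    fun x hx t ht => ((hd x hx).differentiableAt (hU.mem_nhds (hball' ht))).hasDerivAt
  have key := intervalIntegral.hasDerivAt_integral_of_dominated_loc_of_deriv_le (μ := volume)
    (a := a) (b := b) (F := g) (F' := fun t x => deriv (fun t => g t x) t) (x₀ := t₀)
    (s := ball t₀ r) (bound := fun _ => C / r) (ball_mem_nhds t₀ hr)
    (by filter_upwards [hU.mem_nhds ht₀] with t ht using hmeas t ht)
    ((hcont t₀ ht₀).intervalIntegrable_of_Icc hab) ?_ ?_ (by simp) ?_
  · exact key.2.differentiableAt.differentiableWithinAt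
  · have hlim : ∀ᵐ x ∂(volume.restrict (uIoc a b)), Tendsto
        (fun n : ℕ => ((r / (n + 2) : ℝ) : ℂ)⁻¹ * (g (t₀ + ((r / (n + 2) : ℝ) : ℂ)) x - g t₀ x)) atTop
        (𝓝 (deriv (fun t => g t x) t₀)) := by
      rw [uIoc_of_le hab]
      filter_upwards [ae_restrict_mem measurableSet_Ioc] with x hx
      have h := (hder x (Ioc_subset_Icc_self hx) t₀ (mem_ball_self hr)).tendsto_slope_zero
      have h2 : Tendsto (fun n : ℕ => ((r / (n + 2) : ℝ) : ℂ)) atTop (𝓝[≠] 0) := by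
        rw [tendsto_nhdsWithin_iff]
        constructor
        · have h3 : Tendsto (fun n : ℕ => (r / (n + 2) : ℝ)) atTop (𝓝 0) := by
            apply Tendsto.div_atTop tendsto_const_nhds
            exact tendsto_atTop_add_const_right _ _ tendsto_natCast_atTop_atTop
          have := (Complex.continuous_ofReal.tendsto 0).comp h3
          simpa [Function.comp_def] using this
        · refine Eventually.of_forall fun n => ?_
          have : r / (n + 2 : ℝ) ≠ 0 := by positivity
          exact Complex.ofReal_ne_zero.2 this
      simpa [Function.comp_def, smul_eq_mul] using h.comp h2
    refine aestronglyMeasurable_of_tendsto_ae atTop (fun n => ?_) hlim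
    have hn : t₀ + ((r / (n + 2) : ℝ) : ℂ) ∈ U := by
      apply hball'
      rw [mem_ball, dist_eq_norm, add_sub_cancel_left, Complex.norm_real, Real.norm_of_nonneg (by positivity)]
      apply div_lt_self hr
      have : (0 : ℝ) ≤ n := by positivity
      linarith
    exact ((hmeas _ hn).sub (hmeas _ ht₀)).const_mul _
  · refine Eventually.of_forall fun x hx t ht => ?_
    rw [uIoc_of_le hab] at hx
    have hx' := Ioc_subset_Icc_self hx
    refine Complex.norm_deriv_le_of_forall_mem_sphere_norm_le hr ?_ ?_
    · apply DifferentiableOn.diffContOnCl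
      rw [closure_ball t hr.ne']
      exact (hd x hx').mono ((hU' t ht).trans hball)
    · intro z hz
      exact hC (z, x) ⟨hU' t ht (sphere_subset_closedBall hz), hx'⟩
  · refine Eventually.of_forall fun x hx t ht => ?_
    rw [uIoc_of_le hab] at hx
    exact hder x (Ioc_subset_Icc_self hx) t ht

/-- A continuous, separately holomorphic function of two variables is holomorphic along
holomorphic curves. -/
lemma differentiableOn_diag {D : Set (ℂ × ℂ)} (hD : IsOpen D) {F : ℂ → ℂ → ℂ}
    (hc : ContinuousOn (fun z : ℂ × ℂ => F z.1 z.2) D)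
    (h₁ : ∀ t τ, (t, τ) ∈ D → DifferentiableAt ℂ (fun t => F t τ) t)
    (h₂ : ∀ t τ, (t, τ) ∈ D → DifferentiableAt ℂ (fun τ => F t τ) τ)
    {U : Set ℂ} (hU : IsOpen U) {l m : ℂ → ℂ} (hl : DifferentiableOn ℂ l U)
    (hm : DifferentiableOn ℂ m U) (hlm : ∀ s ∈ U, (l s, m s) ∈ D) :
    DifferentiableOn ℂ (fun s => F (l s) (m s)) U := by
  intro s₀ hs₀
  obtain ⟨r, hr, hball⟩ : ∃ r > 0, closedBall (l s₀) r ×ˢ closedBall (m s₀) r ⊆ D := by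
    obtain ⟨r, hr, h⟩ := Metric.nhds_basis_closedBall.mem_iff.1 (hD.mem_nhds (hlm s₀ hs₀))
    exact ⟨r, hr, by rwa [closedBall_prod_same]⟩
  have hlc := (hl.differentiableAt (hU.mem_nhds hs₀)).continuousAt
  have hmc := (hm.differentiableAt (hU.mem_nhds hs₀)).continuousAt
  obtain ⟨V, hVn, hVo, hVs⟩ : ∃ V : Set ℂ, V ⊆ U ∩ {s | l s ∈ ball (l s₀) r ∧ m s ∈ ball (m s₀) r} ∧ IsOpen V ∧ s₀ ∈ V := by
    apply _root_.mem_nhds_iff.1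
    filter_upwards [hU.mem_nhds hs₀, hlc (ball_mem_nhds _ hr), hmc (ball_mem_nhds _ hr)] with s h1 h2 h3
    exact ⟨h1, h2, h3⟩
  have hsub : ∀ s ∈ V, F (l s) (m s) = ∫ θ in (0:ℝ)..(2*π),
      (2 * π * Complex.I)⁻¹ * (deriv (circleMap (l s₀) r) θ * ((circleMap (l s₀) r θ - l s)⁻¹ * F (circleMap (l s₀) r θ) (m s))) := by
    intro s hs
    have h1 := hVn hs
    have : DifferentiableOn ℂ (fun t => F t (m s)) (closedBall (l s₀) r) := fun t ht =>
      (h₁ t (m s) (hball ⟨ht, ball_subset_closedBall h1.2.2⟩)).differentiableWithinAt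
    have h2 := this.circleIntegral_sub_inv_smul (w := l s) h1.2.1
    rw [circleIntegral] at h2
    rw [intervalIntegral.integral_const_mul]
    simp only [smul_eq_mul] at h2
    rw [h2]
    field_simp
  refine DifferentiableAt.differentiableWithinAt ?_
  have hdiff : DifferentiableOn ℂ (fun s => ∫ θ in (0:ℝ)..(2*π),
      (2 * π * Complex.I)⁻¹ * (deriv (circleMap (l s₀) r) θ * ((circleMap (l s₀) r θ - l s)⁻¹ * F (circleMap (l s₀) r θ) (m s)))) V := by
    have hne : ∀ s ∈ V, ∀ θ, circleMap (l s₀) r θ - l s ≠ 0 := by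
      intro s hs θ h
      have h1 := (hVn hs).2.1
      rw [← sub_eq_zero.1 h, mem_ball] at h1
      have := circleMap_mem_sphere (l s₀) hr.le θ
      rw [mem_sphere] at this
      linarith
    have hmem : ∀ s ∈ V, ∀ θ, (circleMap (l s₀) r θ, m s) ∈ D := fun s hs θ =>
      hball ⟨circleMap_mem_closedBall _ hr.le _, ball_subset_closedBall (hVn hs).2.2⟩
    apply differentiableOn_integral_param (by positivity) hVo
    · have hlV : ContinuousOn (fun z : ℂ × ℝ => l z.1) (V ×ˢ Icc 0 (2 * π)) :=
        (hl.continuousOn).comp continuousOn_fst (fun z hz => (hVn hz.1).1)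
      have hmV : ContinuousOn (fun z : ℂ × ℝ => m z.1) (V ×ˢ Icc 0 (2 * π)) :=
        (hm.continuousOn).comp continuousOn_fst (fun z hz => (hVn hz.1).1)
      have hcm : Continuous (fun z : ℂ × ℝ => circleMap (l s₀) r z.2) := by fun_prop
      refine continuousOn_const.mul (ContinuousOn.mul ?_ (ContinuousOn.mul ?_ ?_))
      · simp only [deriv_circleMap]
        fun_prop
      · exact ContinuousOn.inv₀ (hcm.continuousOn.sub hlV) (fun z hz => hne _ hz.1 _)
      · exact hc.comp (hcm.continuousOn.prodMk hmV) (fun z hz => hmem _ hz.1 _)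
    · intro θ _ s hs
      refine DifferentiableAt.differentiableWithinAt ?_
      have hl' := hl.differentiableAt (hU.mem_nhds (hVn hs).1)
      have hm' := hm.differentiableAt (hU.mem_nhds (hVn hs).1)
      have := (h₂ _ _ (hmem s hs θ)).comp s hm'
      refine (DifferentiableAt.mul ?_ this).const_mul _ |>.const_mul _
      exact ((differentiableAt_const _).sub hl').inv (hne s hs θ)
  refine ((hdiff.differentiableAt (hVo.mem_nhds hVs))).congr_of_eventuallyEq ?_
  filter_upwards [hVo.mem_nhds hVs] with s hs using hsub s hs

/-- Differentiability of a function of two variables from a continuous partial derivative in the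
first variable and a partial derivative in the second one. -/
lemma hasFDerivAt_of_partial {f : ℂ → ℂ → ℂ} {f₁ : ℂ → ℂ → ℂ →L[ℝ] ℂ} {u : ℂ × ℂ} {f₂ : ℂ →L[ℝ] ℂ}
    (df₁ : ∀ᶠ v in 𝓝 u, HasFDerivAt (fun t => f t v.2) (f₁ v.1 v.2) v.1)
    (cf₁ : ContinuousAt (fun v : ℂ × ℂ => f₁ v.1 v.2) u)
    (df₂ : HasFDerivAt (fun z => f u.1 z) f₂ u.2) :
    HasFDerivAt (fun v : ℂ × ℂ => f v.1 v.2) ((f₁ u.1 u.2).coprod f₂) u := by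
  rw [hasFDerivAt_iff_isLittleO]
  have e : (fun v : ℂ × ℂ => f v.1 v.2 - f u.1 u.2 - ((f₁ u.1 u.2).coprod f₂) (v - u)) =
      fun v => (f v.1 v.2 - f u.1 v.2 - f₁ u.1 u.2 (v.1 - u.1)) +
        (f u.1 v.2 - f u.1 u.2 - f₂ (v.2 - u.2)) := by
    ext v
    simp only [ContinuousLinearMap.coprod_apply, Prod.fst_sub, Prod.snd_sub]
    abel
  rw [e]
  refine Asymptotics.IsLittleO.add ?_ ?_
  · have h1 : (fun v : ℂ × ℂ => v.1 - u.1) =O[𝓝 u] (fun v => v - u) :=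
      Asymptotics.isBigO_of_le _ fun v => norm_fst_le (v - u)
    refine Asymptotics.IsLittleO.trans_isBigO ?_ h1
    rw [Asymptotics.isLittleO_iff]
    intro ε hε
    have hev : ∀ᶠ v in 𝓝 u, HasFDerivAt (fun t => f t v.2) (f₁ v.1 v.2) v.1 ∧
        ‖f₁ v.1 v.2 - f₁ u.1 u.2‖ ≤ ε := by
      filter_upwards [df₁, cf₁ (closedBall_mem_nhds _ hε)] with v h1 h2
      exact ⟨h1, by simpa [dist_eq_norm] using! h2⟩
    obtain ⟨r, hr, hb⟩ := Metric.eventually_nhds_iff_ball.1 hev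
    filter_upwards [ball_mem_nhds u hr] with v hv
    rw [← ball_prod_same] at hv
    refine (convex_ball u.1 r).norm_image_sub_le_of_norm_hasFDerivWithin_le'
      (f := fun t => f t v.2) (f' := fun t => f₁ t v.2) ?_ ?_ (mem_ball_self hr) hv.1
    · intro t ht
      exact (hb (t, v.2) (by rw [← ball_prod_same]; exact ⟨ht, hv.2⟩)).1.hasFDerivWithinAt
    · intro t ht
      exact (hb (t, v.2) (by rw [← ball_prod_same]; exact ⟨ht, hv.2⟩)).2
  · have h1 : (fun v : ℂ × ℂ => v.2 - u.2) =O[𝓝 u] (fun v => v - u) :=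
      Asymptotics.isBigO_of_le _ fun v => norm_snd_le (v - u)
    have h2 := (hasFDerivAt_iff_isLittleO.1 df₂).comp_tendsto (continuousAt_snd (p := u))
    exact h2.trans_isBigO h1

end Nodal

namespace Nodal
open Set Filter Topology Metric

/-- The entire function `∑ (-X)ᵏ / (k! (k+m)!)`, a rescaled Bessel function of order `m`. -/
def bess (m : ℕ) (X : ℂ) : ℂ := ∑' k : ℕ, (-X) ^ k / (k.factorial * (k + m).factorial : ℝ)

lemma sq_div_factorial_sq_le (y : ℝ) (k : ℕ) :
    y ^ (2 * k) / ((k.factorial : ℝ) * k.factorial) ≤ (2 * y) ^ (2 * k) / (2 * k).factorial := by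
  have h : (2 * k).factorial ≤ 4 ^ k * (k.factorial * k.factorial) := by
    have h1 := Nat.choose_mul_factorial_mul_factorial (show k ≤ 2 * k by lia)
    rw [show 2 * k - k = k by lia] at h1
    rw [← h1, mul_assoc]
    apply Nat.mul_le_mul_right
    have := Nat.choose_le_two_pow (2 * k) k
    rwa [pow_mul] at this
  have h' : ((2 * k).factorial : ℝ) ≤ 4 ^ k * (k.factorial * k.factorial) := by exact_mod_cast h
  have hk : (0 : ℝ) < k.factorial := by exact_mod_cast k.factorial_pos
  have h2k : (0 : ℝ) < (2 * k).factorial := by exact_mod_cast (2 * k).factorial_pos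
  rw [div_le_div_iff₀ (by positivity) h2k]
  have : (2 * y) ^ (2 * k) = y ^ (2 * k) * 4 ^ k := by
    rw [mul_pow, pow_mul 2]; norm_num; ring
  rw [this]
  have hy : 0 ≤ y ^ (2 * k) := by rw [pow_mul]; positivity
  nlinarith [mul_le_mul_of_nonneg_left h' hy]

lemma summable_sq_div (y : ℝ) :
    Summable (fun k : ℕ => y ^ (2 * k) / ((k.factorial : ℝ) * k.factorial)) ∧
    ∑' k : ℕ, y ^ (2 * k) / ((k.factorial : ℝ) * k.factorial) ≤ Real.exp (2 * |y|) := by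
  have h := Real.hasSum_cosh (2 * |y|)
  have hle : ∀ k : ℕ, y ^ (2 * k) / ((k.factorial : ℝ) * k.factorial) ≤ (2 * |y|) ^ (2 * k) / (2 * k).factorial := by
    intro k
    have := sq_div_factorial_sq_le |y| k
    rwa [pow_mul |y|, sq_abs, ← pow_mul] at this
  have hs : Summable (fun k : ℕ => y ^ (2 * k) / ((k.factorial : ℝ) * k.factorial)) :=
    Summable.of_nonneg_of_le (fun k => by rw [pow_mul]; positivity) hle h.summable
  refine ⟨hs, (hs.tsum_le_tsum hle h.summable).trans ?_⟩
  rw [h.tsum_eq, Real.cosh_eq]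
  have : Real.exp (-(2 * |y|)) ≤ Real.exp (2 * |y|) :=
    Real.exp_le_exp.2 (by have := abs_nonneg y; linarith)
  linarith

/-- `∑ Yᵏ/(k!)²` converges, with sum at most `exp (2√Y)`. -/
lemma summable_pow_div (Y : ℝ) (hY : 0 ≤ Y) :
    Summable (fun k : ℕ => Y ^ k / ((k.factorial : ℝ) * k.factorial)) ∧
    ∑' k : ℕ, Y ^ k / ((k.factorial : ℝ) * k.factorial) ≤ Real.exp (2 * √Y) := by
  have := summable_sq_div √Y
  simpa only [pow_mul, Real.sq_sqrt hY, abs_of_nonneg (Real.sqrt_nonneg Y)] using this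

lemma norm_bess_term_le (m k : ℕ) (X : ℂ) :
    ‖(-X) ^ k / ((k.factorial * (k + m).factorial : ℝ) : ℂ)‖ ≤ ‖X‖ ^ k / ((k.factorial : ℝ) * k.factorial) := by
  have hk : (0 : ℝ) < k.factorial := by exact_mod_cast k.factorial_pos
  have hkm : (k.factorial : ℝ) ≤ (k + m).factorial := by
    exact_mod_cast Nat.factorial_le (Nat.le_add_right k m)
  rw [norm_div, norm_pow, norm_neg, Complex.norm_real, Real.norm_of_nonneg (by positivity)]
  gcongr

lemma summable_bess (m : ℕ) (X : ℂ) :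
    Summable (fun k : ℕ => (-X) ^ k / ((k.factorial * (k + m).factorial : ℝ) : ℂ)) :=
  Summable.of_norm_bounded (summable_pow_div ‖X‖ (norm_nonneg X)).1 (norm_bess_term_le m · X)

lemma norm_bess_le (m : ℕ) (X : ℂ) : ‖bess m X‖ ≤ Real.exp (2 * √‖X‖) :=
  (tsum_of_norm_bounded (summable_pow_div ‖X‖ (norm_nonneg X)).1.hasSum (norm_bess_term_le m · X)).trans
    (summable_pow_div ‖X‖ (norm_nonneg X)).2

lemma hasDerivAt_bess (m : ℕ) (X : ℂ) : HasDerivAt (bess m) (-bess (m + 1) X) X := by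
  have hfac : ∀ k : ℕ, ((k + 1 : ℕ) : ℝ) / (((k + 1).factorial : ℝ) * (k + 1 + m).factorial) =
      1 / ((k.factorial : ℝ) * (k + (m + 1)).factorial) := by
    intro k
    rw [Nat.factorial_succ k, show k + 1 + m = k + (m + 1) by ring]
    have : (k.factorial : ℝ) ≠ 0 := by exact_mod_cast k.factorial_ne_zero
    have : ((k + (m + 1)).factorial : ℝ) ≠ 0 := by exact_mod_cast (k + (m + 1)).factorial_ne_zero
    push_cast
    field_simp
  have hterm : ∀ (k : ℕ) (y : ℂ), ((k + 1 : ℕ) : ℂ) * (-y) ^ k * (-1) / (((k + 1).factorial * (k + 1 + m).factorial : ℝ) : ℂ) =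
      -((-y) ^ k / ((k.factorial * (k + (m + 1)).factorial : ℝ) : ℂ)) := by
    intro k y
    have := congrArg (fun x : ℝ => (x : ℂ)) (hfac k)
    push_cast at this ⊢
    linear_combination (-1) * (-y) ^ k * this
  set R := ‖X‖ + 1
  have hu : Summable (fun k : ℕ => if k = 0 then 0 else R ^ (k - 1) / (((k-1).factorial : ℝ) * (k-1).factorial)) := by
    rw [← summable_nat_add_iff 1]
    simpa using (summable_pow_div R (by positivity)).1
  have key := hasDerivAt_tsum_of_isPreconnected (y := X)
    (g := fun (k : ℕ) (X : ℂ) => (-X) ^ k / ((k.factorial * (k + m).factorial : ℝ) : ℂ))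
    (g' := fun k X => (k : ℂ) * (-X) ^ (k - 1) * (-1) / ((k.factorial * (k + m).factorial : ℝ) : ℂ))
    hu (isOpen_ball (x := (0 : ℂ)) (ε := R)) (convex_ball _ _).isPreconnected ?_ ?_
    (mem_ball_self (by positivity)) (summable_bess m 0) (by simp [R])
  · rw [show -bess (m + 1) X = ∑' n : ℕ, (n : ℂ) * (-X) ^ (n - 1) * (-1) / ((n.factorial * (n + m).factorial : ℝ) : ℂ) from ?_]
    · exact key
    symm
    rw [Summable.tsum_eq_zero_add]
    · simp only [Nat.cast_zero, zero_mul, zero_div, zero_add, Nat.add_sub_cancel, hterm]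
      rw [tsum_neg]; rfl
    · rw [← summable_nat_add_iff 1]
      simp only [Nat.add_sub_cancel, hterm]
      exact (summable_bess (m + 1) X).neg
  · intro k y _
    simpa using! ((hasDerivAt_neg y).pow k).div_const _
  · intro k y hy
    rcases k with _ | k
    · simp
    · simp only [Nat.add_sub_cancel, hterm, norm_neg, Nat.succ_ne_zero, if_false]
      refine (norm_bess_term_le (m + 1) k y).trans ?_
      have : ‖y‖ ≤ R := by simpa using (mem_ball.1 hy).le
      gcongr

lemma bess_zero_zero : bess 0 0 = 1 := by
  rw [bess, tsum_eq_single 0]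
  · simp
  · intro k hk
    simp [hk]

/-- Bessel's equation. -/
lemma bess_ode (X : ℂ) : X * bess 2 X - bess 1 X + bess 0 X = 0 := by
  have h0 : bess 0 X = 1 + ∑' k : ℕ, (-X) ^ (k + 1) / (((k + 1).factorial * (k + 1 + 0).factorial : ℝ) : ℂ) := by
    rw [bess, (summable_bess 0 X).tsum_eq_zero_add]; simp
  have h1 : bess 1 X = 1 + ∑' k : ℕ, (-X) ^ (k + 1) / (((k + 1).factorial * (k + 1 + 1).factorial : ℝ) : ℂ) := by
    rw [bess, (summable_bess 1 X).tsum_eq_zero_add]; simp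
  have h2 : X * bess 2 X = ∑' k : ℕ, X * ((-X) ^ k / ((k.factorial * (k + 2).factorial : ℝ) : ℂ)) := by
    rw [bess, tsum_mul_left]
  have s0 := (summable_nat_add_iff 1).2 (summable_bess 0 X)
  have s1 := (summable_nat_add_iff 1).2 (summable_bess 1 X)
  have s2 := (summable_bess 2 X).mul_left X
  have hterm : ∀ k : ℕ, X * ((-X) ^ k / ((k.factorial * (k + 2).factorial : ℝ) : ℂ)) =
      (-X) ^ (k + 1) / (((k + 1).factorial * (k + 1 + 1).factorial : ℝ) : ℂ) -
      (-X) ^ (k + 1) / (((k + 1).factorial * (k + 1 + 0).factorial : ℝ) : ℂ) := by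
    intro k
    have : (k.factorial : ℂ) ≠ 0 := by exact_mod_cast k.factorial_ne_zero
    have h1 : (k : ℂ) + 1 ≠ 0 := by exact_mod_cast k.succ_ne_zero
    have h2 : (k : ℂ) + 1 + 1 ≠ 0 := by exact_mod_cast (k + 1).succ_ne_zero
    simp only [show k + 2 = k + 1 + 1 by ring, add_zero, Nat.factorial_succ (k + 1), Nat.factorial_succ k]
    push_cast
    field_simp
    ring
  rw [h0, h1, h2, tsum_congr hterm, s1.tsum_sub s0]
  ring

lemma differentiable_bess (m : ℕ) : Differentiable ℂ (bess m) := fun X =>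
  (hasDerivAt_bess m X).differentiableAt

lemma continuous_bess (m : ℕ) : Continuous (bess m) := (differentiable_bess m).continuous

end Nodal

namespace Nodal
open Set Filter Topology Metric ComplexConjugate

/-- The map `a ↦ a dz`. -/
def wdHol : ℂ →L[ℝ] ℂ →L[ℝ] ℂ := ContinuousLinearMap.mul ℝ ℂ

/-- The map `b ↦ b dz̄`. -/
def wdAnti : ℂ →L[ℝ] ℂ →L[ℝ] ℂ :=
  ((ContinuousLinearMap.compL ℝ ℂ ℂ ℂ).flip (Complex.conjCLE : ℂ →L[ℝ] ℂ)).comp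
    (ContinuousLinearMap.mul ℝ ℂ)

@[simp] lemma wdHol_apply (a h : ℂ) : wdHol a h = a * h := by simp [wdHol]

@[simp] lemma wdAnti_apply (a h : ℂ) : wdAnti a h = a * conj h := by simp [wdAnti]

/-- The real-linear form `a dz + b dz̄`. -/
def wd (a b : ℂ) : ℂ →L[ℝ] ℂ := wdHol a + wdAnti b

@[simp] lemma wd_apply (a b h : ℂ) : wd a b h = a * h + b * conj h := by
  simp [wd]

/-- `f` is real-differentiable at `z` with Wirtinger derivatives `a = ∂f`, `b = ∂̄f`. -/
def HasWD (f : ℂ → ℂ) (a b z : ℂ) : Prop := HasFDerivAt f (wd a b) z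

lemma HasWD.congr_deriv {f : ℂ → ℂ} {a b a' b' z : ℂ} (h : HasWD f a b z) (ha : a = a') (hb : b = b') :
    HasWD f a' b' z := by subst ha hb; exact h

lemma HasWD.continuousAt {f : ℂ → ℂ} {a b z : ℂ} (h : HasWD f a b z) : ContinuousAt f z :=
  HasFDerivAt.continuousAt h

lemma hasWD_const (c z : ℂ) : HasWD (fun _ => c) 0 0 z := by
  have : wd 0 0 = 0 := by ext; simp
  rw [HasWD, this]; exact hasFDerivAt_const c z

lemma HasDerivAt.hasWD {f : ℂ → ℂ} {f' z : ℂ} (h : HasDerivAt f f' z) : HasWD f f' 0 z := by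
  have h1 := h.hasFDerivAt.restrictScalars ℝ
  refine h1.congr_fderiv ?_
  ext
  simp [mul_comm]

lemma HasWD.conj {f : ℂ → ℂ} {a b z : ℂ} (h : HasWD f a b z) :
    HasWD (fun z => conj (f z)) (conj b) (conj a) z := by
  have h1 := (Complex.conjCLE : ℂ →L[ℝ] ℂ).hasFDerivAt.comp z h
  refine h1.congr_fderiv ?_
  ext
  simp [add_comm]

lemma HasWD.sub {f g : ℂ → ℂ} {a b c d z : ℂ} (h : HasWD f a b z) (h' : HasWD g c d z) :
    HasWD (fun z => f z - g z) (a - c) (b - d) z := by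
  refine (HasFDerivAt.sub h h').congr_fderiv ?_
  ext
  simp
  ring

lemma HasWD.neg {f : ℂ → ℂ} {a b z : ℂ} (h : HasWD f a b z) :
    HasWD (fun z => -f z) (-a) (-b) z := by
  refine (HasFDerivAt.neg h).congr_fderiv ?_
  ext
  simp
  ring

lemma HasWD.mul {f g : ℂ → ℂ} {a b c d z : ℂ} (h : HasWD f a b z) (h' : HasWD g c d z) :
    HasWD (fun z => f z * g z) (a * g z + f z * c) (b * g z + f z * d) z := by
  refine (HasFDerivAt.mul h h').congr_fderiv ?_
  ext
  simp
  ring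

lemma HasWD.comp_holo {f g : ℂ → ℂ} {a b g' z : ℂ} (hg : HasDerivAt g g' (f z)) (h : HasWD f a b z) :
    HasWD (fun z => g (f z)) (g' * a) (g' * b) z := by
  have h1 := (hg.hasFDerivAt.restrictScalars ℝ).comp z h
  refine h1.congr_fderiv ?_
  ext
  simp
  ring

lemma HasWD.hasDerivAt {f : ℂ → ℂ} {a z : ℂ} (h : HasWD f a 0 z) : HasDerivAt f a z := by
  have : HasFDerivAt f (ContinuousLinearMap.toSpanSingleton ℂ a) z := by
    apply hasFDerivAt_of_restrictScalars ℝ h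
    ext
    simp [mul_comm]
  simpa using this.hasDerivAt

lemma HasWD.comp_curve {f : ℂ → ℂ} {a b : ℂ} {g : ℝ → ℂ} {g' : ℂ} {s : ℝ} (h : HasWD f a b (g s))
    (hg : HasDerivAt g g' s) : HasDerivAt (fun s => f (g s)) (a * g' + b * conj g') s := by
  have := HasFDerivAt.comp_hasDerivAt s h hg
  simpa [Function.comp_def] using this

/-- Wirtinger chain rule with a holomorphic inner function. -/
lemma HasWD.comp_inner {f g : ℂ → ℂ} {a b g' z : ℂ} (h : HasWD f a b (g z)) (hg : HasDerivAt g g' z) :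
    HasWD (fun z => f (g z)) (a * g') (b * conj g') z := by
  have h1 := HasFDerivAt.comp z h (hg.hasFDerivAt.restrictScalars ℝ)
  refine h1.congr_fderiv ?_
  ext
  simp
  ring

lemma hasFDerivAt_wd {P R : ℂ → ℂ} {a b c d z : ℂ} (h : HasWD P a b z) (h' : HasWD R c d z) :
    HasFDerivAt (fun z => wd (P z) (R z)) (wdHol.comp (wd a b) + wdAnti.comp (wd c d)) z :=
  (wdHol.hasFDerivAt.comp z h).add (wdAnti.hasFDerivAt.comp z h')

lemma wd_symm {a b d : ℂ} (x y : ℂ) :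
    ((wdHol.comp (wd a b) + wdAnti.comp (wd b d)) x) y =
    ((wdHol.comp (wd a b) + wdAnti.comp (wd b d)) y) x := by
  simp
  ring

end Nodal

namespace Nodal
open Set Filter Topology Metric ComplexConjugate

/-- A solution `V` of `∂∂̄V = -μ |Q'|² V` on an open convex set `K`, the pull-back of a solution of
the Helmholtz equation by the holomorphic map `Q`; `p = ∂V`, and `V` is real valued. -/
structure PolData (K : Set ℂ) (Q V p : ℂ → ℂ) (μ : ℝ) : Prop where
  isOpen : IsOpen K
  convex : Convex ℝ K
  mu_nonneg : 0 ≤ μ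
  holo : DifferentiableOn ℂ Q K
  hasWD_V : ∀ ζ ∈ K, HasWD V (p ζ) (conj (p ζ)) ζ
  hasWD_p : ∀ ζ ∈ K, ∃ m, HasWD p m (-(μ : ℂ) * deriv Q ζ * conj (deriv Q ζ) * V ζ) ζ

/-- The argument of the Riemann function. -/
def rArg (Q : ℂ → ℂ) (μ : ℝ) (z w ζ : ℂ) : ℂ := μ * (Q ζ - z) * (conj (Q ζ) - w)

/-- The `dζ̄` component of the closed form used for polarization. -/
def rBar (Q V : ℂ → ℂ) (μ : ℝ) (z w ζ : ℂ) : ℂ :=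
  -(bess 1 (rArg Q μ z w ζ) * (μ * (Q ζ - z) * conj (deriv Q ζ))) * V ζ

/-- The `dζ` component of the closed form used for polarization. -/
def rHol (Q p : ℂ → ℂ) (μ : ℝ) (z w ζ : ℂ) : ℂ := bess 0 (rArg Q μ z w ζ) * p ζ

/-- The closed form used for polarization. -/
def rForm (Q V p : ℂ → ℂ) (μ : ℝ) (z w ζ : ℂ) : ℂ →L[ℝ] ℂ :=
  wd (rHol Q p μ z w ζ) (rBar Q V μ z w ζ)

/-- The integral of the closed form along a segment. -/
def rInt (Q V p : ℂ → ℂ) (μ : ℝ) (z w σ t : ℂ) : ℂ :=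
  ∫ᶜ x in .segment σ t, rForm Q V p μ z w x

/-- The polarization of `V`: the holomorphic function of two variables extending
`(t, t̄) ↦ V t`. -/
def pol (Q V p : ℂ → ℂ) (μ : ℝ) (t τ : ℂ) : ℂ :=
  V (conj τ) + rInt Q V p μ (Q t) (conj (Q (conj τ))) (conj τ) t

namespace PolData

variable {K : Set ℂ} {Q V p : ℂ → ℂ} {μ : ℝ} (h : PolData K Q V p μ)
include h

lemma hasDerivAt_Q {ζ : ℂ} (hζ : ζ ∈ K) : HasDerivAt Q (deriv Q ζ) ζ :=
  (h.holo.differentiableAt (h.isOpen.mem_nhds hζ)).hasDerivAt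

lemma hasDerivAt_deriv {ζ : ℂ} (hζ : ζ ∈ K) : HasDerivAt (deriv Q) (deriv (deriv Q) ζ) ζ :=
  ((h.holo.deriv h.isOpen).differentiableAt (h.isOpen.mem_nhds hζ)).hasDerivAt

lemma hasWD_arg (z w : ℂ) {ζ : ℂ} (hζ : ζ ∈ K) :
    HasWD (rArg Q μ z w) (μ * deriv Q ζ * (conj (Q ζ) - w)) (μ * (Q ζ - z) * conj (deriv Q ζ)) ζ := by
  have hQ := HasDerivAt.hasWD (h.hasDerivAt_Q hζ)
  have := ((hasWD_const (μ : ℂ) ζ).mul (hQ.sub (hasWD_const z ζ))).mul (hQ.conj.sub (hasWD_const w ζ))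
  exact this.congr_deriv (by simp) (by simp)

lemma continuousOn_V : ContinuousOn V K := fun ζ hζ => (h.hasWD_V ζ hζ).continuousAt.continuousWithinAt

lemma continuousOn_p : ContinuousOn p K := fun ζ hζ =>
  (h.hasWD_p ζ hζ).choose_spec.continuousAt.continuousWithinAt

lemma continuousOn_deriv : ContinuousOn (deriv Q) K := (h.holo.deriv h.isOpen).continuousOn

lemma exists_fderiv_form (z w : ℂ) {ζ : ℂ} (hζ : ζ ∈ K) :
    ∃ D : ℂ →L[ℝ] ℂ →L[ℝ] ℂ, HasFDerivAt (rForm Q V p μ z w) D ζ ∧ ∀ x y, D x y = D y x := by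
  obtain ⟨m, hm⟩ := h.hasWD_p ζ hζ
  have hX := h.hasWD_arg z w hζ
  have hQ := HasDerivAt.hasWD (h.hasDerivAt_Q hζ)
  have hP := (hX.comp_holo (hasDerivAt_bess 0 _)).mul hm
  have hc := (((hasWD_const (μ : ℂ) ζ).mul (hQ.sub (hasWD_const z ζ))).mul
    (HasDerivAt.hasWD (h.hasDerivAt_deriv hζ)).conj)
  have hR := ((hX.comp_holo (hasDerivAt_bess 1 _)).mul hc).neg.mul (h.hasWD_V ζ hζ)
  have key := fun a b c d (ha : _ = a) (hb : _ = b) (hc : _ = c) (hd : _ = d) =>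
    hasFDerivAt_wd (hP.congr_deriv (a' := a) (b' := b) ha hb) (hR.congr_deriv (a' := c) (b' := d) hc hd)
  refine ⟨_, key _ (-(bess 1 (rArg Q μ z w ζ) * (μ * (Q ζ - z) * conj (deriv Q ζ)) * p ζ)
      - bess 0 (rArg Q μ z w ζ) * (μ * deriv Q ζ * conj (deriv Q ζ) * V ζ)) _ _ rfl ?_ ?_ rfl, wd_symm⟩
  · ring
  · have ode := bess_ode (rArg Q μ z w ζ)
    have hX' : rArg Q μ z w ζ = μ * (Q ζ - z) * (conj (Q ζ) - w) := rfl
    rw [show bess 0 (rArg Q μ z w ζ) = bess 1 (rArg Q μ z w ζ) - rArg Q μ z w ζ * bess (1 + 1) (rArg Q μ z w ζ)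
      by linear_combination ode]
    generalize bess 1 (rArg Q μ z w ζ) = b1
    generalize bess (1 + 1) (rArg Q μ z w ζ) = b2
    rw [hX']
    simp only [map_zero]
    ring

lemma continuousOn_rHol {T : Type*} [TopologicalSpace T] {S : Set T} {a b g : T → ℂ}
    (ha : ContinuousOn a S) (hb : ContinuousOn b S) (hg : ContinuousOn g S) (hgS : ∀ x ∈ S, g x ∈ K) :
    ContinuousOn (fun x => rHol Q p μ (a x) (b x) (g x)) S := by
  have hQ := h.holo.continuousOn.comp hg hgS
  have hp := h.continuousOn_p.comp hg hgS
  have hQc : ContinuousOn (fun x => conj (Q (g x))) S := Complex.continuous_conj.comp_continuousOn hQ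
  refine ((continuous_bess 0).comp_continuousOn ?_).mul hp
  exact (continuousOn_const.mul (hQ.sub ha)).mul (hQc.sub hb)

lemma continuousOn_rBar {T : Type*} [TopologicalSpace T] {S : Set T} {a b g : T → ℂ}
    (ha : ContinuousOn a S) (hb : ContinuousOn b S) (hg : ContinuousOn g S) (hgS : ∀ x ∈ S, g x ∈ K) :
    ContinuousOn (fun x => rBar Q V μ (a x) (b x) (g x)) S := by
  have hQ := h.holo.continuousOn.comp hg hgS
  have hp := h.continuousOn_V.comp hg hgS
  have hQc : ContinuousOn (fun x => conj (Q (g x))) S := Complex.continuous_conj.comp_continuousOn hQ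
  have hQd : ContinuousOn (fun x => conj (deriv Q (g x))) S :=
    Complex.continuous_conj.comp_continuousOn (h.continuousOn_deriv.comp hg hgS)
  refine ((((continuous_bess 1).comp_continuousOn ?_).mul ?_).neg).mul hp
  · exact (continuousOn_const.mul (hQ.sub ha)).mul (hQc.sub hb)
  · exact (continuousOn_const.mul (hQ.sub ha)).mul hQd

lemma continuousOn_rForm {T : Type*} [TopologicalSpace T] {S : Set T} {a b g : T → ℂ}
    (ha : ContinuousOn a S) (hb : ContinuousOn b S) (hg : ContinuousOn g S) (hgS : ∀ x ∈ S, g x ∈ K) :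
    ContinuousOn (fun x => rForm Q V p μ (a x) (b x) (g x)) S := by
  have h₁ := wdHol.continuous.comp_continuousOn (h.continuousOn_rHol ha hb hg hgS)
  have h₂ := wdAnti.continuous.comp_continuousOn (h.continuousOn_rBar ha hb hg hgS)
  exact h₁.add h₂

lemma hasFDerivAt_rInt (z w : ℂ) {σ t : ℂ} (hσ : σ ∈ K) (ht : t ∈ K) :
    HasFDerivAt (fun t => rInt Q V p μ z w σ t) (rForm Q V p μ z w t) t := by
  choose! D hD hs using fun ζ (hζ : ζ ∈ K) => h.exists_fderiv_form z w hζ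
  exact (h.convex.hasFDerivWithinAt_curveIntegral_segment_of_hasFDerivWithinAt_symmetric
    (fun x hx => (hD x hx).hasFDerivWithinAt) (fun a ha x _ y _ => hs a ha x y) hσ ht).hasFDerivAt
    (h.isOpen.mem_nhds ht)

omit h in
lemma rInt_eq (z w σ t : ℂ) : rInt Q V p μ z w σ t =
    ∫ x in (0 : ℝ)..1, (rHol Q p μ z w (AffineMap.lineMap σ t x) * (t - σ) +
      rBar Q V μ z w (AffineMap.lineMap σ t x) * conj (t - σ)) := by
  rw [rInt, curveIntegral_segment]
  simp [rForm]

omit h in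
lemma rInt_self (z w σ : ℂ) : rInt Q V p μ z w σ σ = 0 := by
  simp [rInt]

lemma rInt_symm (z w : ℂ) {σ t : ℂ} (hσ : σ ∈ K) (ht : t ∈ K) :
    rInt Q V p μ z w σ t = -rInt Q V p μ z w t σ := by
  choose! D hD hs using fun ζ (hζ : ζ ∈ K) => h.exists_fderiv_form z w hζ
  have := h.convex.curveIntegral_segment_add_eq_of_hasFDerivWithinAt_symmetric
    (fun x hx => (hD x hx).hasFDerivWithinAt) (fun a ha x _ y _ => hs a ha x y) hσ ht hσ
  rw [eq_neg_iff_add_eq_zero]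
  refine this.trans ?_
  simp

lemma lineMap_mem {σ t : ℂ} {x : ℝ} (hσ : σ ∈ K) (ht : t ∈ K) (hx : x ∈ Icc (0 : ℝ) 1) :
    AffineMap.lineMap σ t x ∈ K := h.convex.lineMap_mem hσ ht hx

lemma differentiable_rInt_fst (w : ℂ) {σ t : ℂ} (hσ : σ ∈ K) (ht : t ∈ K) :
    Differentiable ℂ (fun z => rInt Q V p μ z w σ t) := by
  rw [← differentiableOn_univ]
  simp only [rInt_eq]
  have hl : ContinuousOn (fun x : ℂ × ℝ => (AffineMap.lineMap σ t x.2 : ℂ)) (univ ×ˢ Icc (0 : ℝ) 1) := by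
    simp only [AffineMap.lineMap_apply]; fun_prop
  apply differentiableOn_integral_param zero_le_one isOpen_univ
  · exact ((h.continuousOn_rHol (by fun_prop) (by fun_prop) hl fun x hx => h.lineMap_mem hσ ht hx.2).mul
      continuousOn_const).add ((h.continuousOn_rBar (by fun_prop) (by fun_prop) hl
      fun x hx => h.lineMap_mem hσ ht hx.2).mul continuousOn_const)
  · intro x _
    unfold rHol rBar rArg
    have := differentiable_bess 0
    have := differentiable_bess 1
    rw [differentiableOn_univ]
    fun_prop

lemma differentiable_rInt_snd (z : ℂ) {σ t : ℂ} (hσ : σ ∈ K) (ht : t ∈ K) :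
    Differentiable ℂ (fun w => rInt Q V p μ z w σ t) := by
  rw [← differentiableOn_univ]
  simp only [rInt_eq]
  have hl : ContinuousOn (fun x : ℂ × ℝ => (AffineMap.lineMap σ t x.2 : ℂ)) (univ ×ˢ Icc (0 : ℝ) 1) := by
    simp only [AffineMap.lineMap_apply]; fun_prop
  apply differentiableOn_integral_param zero_le_one isOpen_univ
  · exact ((h.continuousOn_rHol (by fun_prop) (by fun_prop) hl fun x hx => h.lineMap_mem hσ ht hx.2).mul
      continuousOn_const).add ((h.continuousOn_rBar (by fun_prop) (by fun_prop) hl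
      fun x hx => h.lineMap_mem hσ ht hx.2).mul continuousOn_const)
  · intro x _
    unfold rHol rBar rArg
    have := differentiable_bess 0
    have := differentiable_bess 1
    rw [differentiableOn_univ]
    fun_prop

lemma continuousOn_pol : ContinuousOn (fun z : ℂ × ℂ => pol Q V p μ z.1 z.2) (K ×ˢ (conj ⁻¹' K)) := by
  unfold pol
  simp only [rInt_eq]
  have hQ1 : ContinuousOn (fun z : ℂ × ℂ => Q z.1) (K ×ˢ (conj ⁻¹' K)) :=
    h.holo.continuousOn.comp continuousOn_fst fun z hz => hz.1
  have hcs : ContinuousOn (fun z : ℂ × ℂ => conj z.2) (K ×ˢ (conj ⁻¹' K)) := by fun_prop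
  have hQ2 : ContinuousOn (fun z : ℂ × ℂ => conj (Q (conj z.2))) (K ×ˢ (conj ⁻¹' K)) :=
    Complex.continuous_conj.comp_continuousOn (h.holo.continuousOn.comp hcs fun z hz => hz.2)
  refine (h.continuousOn_V.comp hcs fun z hz => hz.2).add ?_
  apply continuousOn_integral_param zero_le_one
  have hm : MapsTo (Prod.fst : (ℂ × ℂ) × ℝ → ℂ × ℂ) ((K ×ˢ (conj ⁻¹' K)) ×ˢ Icc (0 : ℝ) 1) (K ×ˢ (conj ⁻¹' K)) :=
    fun z hz => hz.1
  have hl : ContinuousOn (fun x : (ℂ × ℂ) × ℝ => (AffineMap.lineMap (conj x.1.2) x.1.1 x.2 : ℂ)) ((K ×ˢ (conj ⁻¹' K)) ×ˢ Icc (0 : ℝ) 1) := by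
    simp only [AffineMap.lineMap_apply]; fun_prop
  have hlK : ∀ x ∈ ((K ×ˢ (conj ⁻¹' K)) ×ˢ Icc (0 : ℝ) 1), (AffineMap.lineMap (conj x.1.2) x.1.1 x.2 : ℂ) ∈ K :=
    fun x hx => h.lineMap_mem hx.1.2 hx.1.1 hx.2
  have hQ1' := hQ1.comp continuousOn_fst hm
  have hQ2' := hQ2.comp continuousOn_fst hm
  exact ((h.continuousOn_rHol hQ1' hQ2' hl hlK).mul (by fun_prop)).add
    ((h.continuousOn_rBar hQ1' hQ2' hl hlK).mul (by fun_prop))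

omit h in
lemma pol_conj (t : ℂ) : pol Q V p μ t (conj t) = V t := by
  simp [pol, rInt_self]

lemma hasDerivAt_pol_left {t τ : ℂ} (ht : t ∈ K) (hτ : conj τ ∈ K) :
    DifferentiableAt ℂ (fun t => pol Q V p μ t τ) t := by
  set w := conj (Q (conj τ))
  set σ := conj τ
  have hz : HasWD (fun z => rInt Q V p μ z w σ t) (deriv (fun z => rInt Q V p μ z w σ t) (Q t)) 0 (Q t) :=
    HasDerivAt.hasWD (h.differentiable_rInt_fst w hτ ht (Q t)).hasDerivAt
  have key := hasFDerivAt_of_partial (u := (t, Q t)) (f := fun t z => rInt Q V p μ z w σ t)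
    (f₁ := fun t z => rForm Q V p μ z w t) ?_ ?_ hz
  · have hQ := h.hasDerivAt_Q ht
    have h2 := (hasFDerivAt_id (𝕜 := ℝ) t).prodMk (hQ.hasFDerivAt.restrictScalars ℝ)
    have h3 := HasFDerivAt.comp t (f := fun t => (t, Q t)) key h2
    have h4 : HasWD (fun t => rInt Q V p μ (Q t) w σ t) (p t + deriv (fun z => rInt Q V p μ z w σ t) (Q t) * deriv Q t) 0 t := by
      refine h3.congr_fderiv ?_
      ext x
      simp [rForm, rHol, rBar, rArg, bess_zero_zero]
      ring
    exact (h4.hasDerivAt.const_add _).differentiableAt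
  · have : (K ×ˢ univ : Set (ℂ × ℂ)) ∈ 𝓝 (t, Q t) := prod_mem_nhds (h.isOpen.mem_nhds ht) univ_mem
    filter_upwards [this] with v hv using h.hasFDerivAt_rInt v.2 w hτ hv.1
  · have : (K ×ˢ univ : Set (ℂ × ℂ)) ∈ 𝓝 (t, Q t) := prod_mem_nhds (h.isOpen.mem_nhds ht) univ_mem
    exact (h.continuousOn_rForm continuousOn_snd continuousOn_const continuousOn_fst fun x hx => hx.1).continuousAt this

lemma hasDerivAt_pol_right {t τ : ℂ} (ht : t ∈ K) (hτ : conj τ ∈ K) :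
    DifferentiableAt ℂ (fun τ => pol Q V p μ t τ) τ := by
  set σ := conj τ with hσ
  have hz : HasWD (fun w => rInt Q V p μ (Q t) w t σ) (deriv (fun w => rInt Q V p μ (Q t) w t σ) (conj (Q σ))) 0 (conj (Q σ)) :=
    HasDerivAt.hasWD (h.differentiable_rInt_snd (Q t) ht hτ (conj (Q σ))).hasDerivAt
  have key := hasFDerivAt_of_partial (u := (σ, conj (Q σ))) (f := fun σ w => rInt Q V p μ (Q t) w t σ)
    (f₁ := fun σ w => rForm Q V p μ (Q t) w σ) ?_ ?_ hz
  · have hQ := (HasDerivAt.hasWD (h.hasDerivAt_Q hτ)).conj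
    have h2 := (hasFDerivAt_id (𝕜 := ℝ) σ).prodMk hQ
    have h3 := HasFDerivAt.comp σ (f := fun t => (t, conj (Q t))) key h2
    have h4 : HasWD (fun σ => V σ - rInt Q V p μ (Q t) (conj (Q σ)) t σ) 0
        (conj (p σ) + (bess 1 0 * (μ * (Q σ - Q t) * conj (deriv Q σ))) * V σ
          - deriv (fun w => rInt Q V p μ (Q t) w t σ) (conj (Q σ)) * conj (deriv Q σ)) σ := by
      refine (HasFDerivAt.sub (h.hasWD_V σ hτ) h3).congr_fderiv ?_
      ext x
      simp [rForm, rHol, rBar, rArg, bess_zero_zero]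
      ring
    have h5 := HasFDerivAt.comp τ (g := fun σ => V σ - rInt Q V p μ (Q t) (conj (Q σ)) t σ)
      (f := fun τ => conj τ) h4 (Complex.conjCLE : ℂ →L[ℝ] ℂ).hasFDerivAt
    have h6 : HasWD (fun τ => V (conj τ) - rInt Q V p μ (Q t) (conj (Q (conj τ))) t (conj τ)) (conj (p σ) + (bess 1 0 * (μ * (Q σ - Q t) * conj (deriv Q σ))) * V σ
          - deriv (fun w => rInt Q V p μ (Q t) w t σ) (conj (Q σ)) * conj (deriv Q σ)) 0 τ := by
      refine h5.congr_fderiv ?_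
      ext x
      simp
    refine h6.hasDerivAt.differentiableAt.congr_of_eventuallyEq ?_
    have : conj ⁻¹' K ∈ 𝓝 τ := (h.isOpen.preimage Complex.continuous_conj).mem_nhds hτ
    filter_upwards [this] with x hx
    rw [pol, h.rInt_symm _ _ hx ht, sub_eq_add_neg]
  · have : (K ×ˢ univ : Set (ℂ × ℂ)) ∈ 𝓝 (σ, conj (Q σ)) := prod_mem_nhds (h.isOpen.mem_nhds hτ) univ_mem
    filter_upwards [this] with v hv using h.hasFDerivAt_rInt (Q t) v.2 ht hv.1
  · have : (K ×ˢ univ : Set (ℂ × ℂ)) ∈ 𝓝 (σ, conj (Q σ)) := prod_mem_nhds (h.isOpen.mem_nhds hτ) univ_mem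
    exact (h.continuousOn_rForm continuousOn_const continuousOn_snd continuousOn_fst fun x hx => hx.1).continuousAt this

end PolData

/-- Size of the polarization. -/
lemma norm_pol_le {Q V p : ℂ → ℂ} {μ M R d : ℝ} (hμ : 0 ≤ μ) (hM : 0 ≤ M) (hR : 0 ≤ R) {t τ : ℂ}
    (hV : ∀ ζ ∈ segment ℝ (conj τ) t, ‖V ζ‖ ≤ M) (hp : ∀ ζ ∈ segment ℝ (conj τ) t, ‖p ζ‖ ≤ M)
    (hQt : ∀ ζ ∈ segment ℝ (conj τ) t, ‖Q ζ - Q t‖ ≤ R)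
    (hQτ : ∀ ζ ∈ segment ℝ (conj τ) t, ‖Q ζ - Q (conj τ)‖ ≤ R)
    (hQ' : ∀ ζ ∈ segment ℝ (conj τ) t, ‖deriv Q ζ‖ ≤ 2) (hd : ‖t - conj τ‖ ≤ d) :
    ‖pol Q V p μ t τ‖ ≤ M * (1 + Real.exp (2 * (√μ * R)) * (1 + 2 * μ * R) * d) := by
  have hbound : ‖rInt Q V p μ (Q t) (conj (Q (conj τ))) (conj τ) t‖ ≤
      M * (Real.exp (2 * (√μ * R)) * (1 + 2 * μ * R)) * ‖t - conj τ‖ := by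
    apply norm_curveIntegral_segment_le
    intro ζ hζ
    have hX : ‖rArg Q μ (Q t) (conj (Q (conj τ))) ζ‖ ≤ μ * R * R := by
      rw [rArg, norm_mul, norm_mul, ← map_sub, Complex.norm_conj, Complex.norm_real, Real.norm_of_nonneg hμ]
      have := hQt ζ hζ
      have := hQτ ζ hζ
      gcongr
    have hs : √‖rArg Q μ (Q t) (conj (Q (conj τ))) ζ‖ ≤ √μ * R := by
      refine (Real.sqrt_le_sqrt hX).trans (le_of_eq ?_)
      rw [mul_assoc, Real.sqrt_mul hμ, Real.sqrt_mul_self hR]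
    have hb : ∀ m, ‖bess m (rArg Q μ (Q t) (conj (Q (conj τ))) ζ)‖ ≤ Real.exp (2 * (√μ * R)) := fun m =>
      (norm_bess_le m _).trans (Real.exp_le_exp.2 (by linarith))
    have h0 : ‖rHol Q p μ (Q t) (conj (Q (conj τ))) ζ‖ ≤ Real.exp (2 * (√μ * R)) * M := by
      rw [rHol, norm_mul]
      have := hb 0; have := hp ζ hζ
      gcongr
    have h1 : ‖rBar Q V μ (Q t) (conj (Q (conj τ))) ζ‖ ≤ Real.exp (2 * (√μ * R)) * (μ * R * 2) * M := by
      rw [rBar, norm_mul, norm_neg, norm_mul, norm_mul, norm_mul, Complex.norm_conj, Complex.norm_real, Real.norm_of_nonneg hμ]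
      have := hb 1; have := hV ζ hζ; have := hQt ζ hζ; have := hQ' ζ hζ
      gcongr
    refine ContinuousLinearMap.opNorm_le_bound _ (by positivity) fun x => ?_
    rw [rForm, wd_apply]
    refine (norm_add_le _ _).trans ?_
    rw [norm_mul, norm_mul, Complex.norm_conj, ← add_mul]
    gcongr
    linarith
  have hd' : M * (Real.exp (2 * (√μ * R)) * (1 + 2 * μ * R)) * ‖t - conj τ‖ ≤
    M * (Real.exp (2 * (√μ * R)) * (1 + 2 * μ * R)) * d := by gcongr
  have := hV _ (left_mem_segment ℝ (conj τ) t)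
  rw [pol]
  refine (norm_add_le _ _).trans ?_
  linarith

end Nodal

namespace Nodal
open Set Filter Topology Metric ComplexConjugate

lemma hasDerivAt_integral_of_continuous {g g' : ℝ → ℝ → ℂ} (hg : Continuous (fun z : ℝ × ℝ => g z.1 z.2))
    (hg' : Continuous (fun z : ℝ × ℝ => g' z.1 z.2)) (hd : ∀ t s, HasDerivAt (fun t => g t s) (g' t s) t)
    (b y t : ℝ) : HasDerivAt (fun t => ∫ s in b..y, g t s) (∫ s in b..y, g' t s) t := by
  have e : (fun t' => ∫ s in b..y, g t' s) =
      fun t' => (∫ s in b..y, g t s) + ∫ r in t..t', ∫ s in b..y, g' r s := by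
    ext t'
    rw [intervalIntegral_intervalIntegral_swap]
    · have : ∀ s, ∫ r in t..t', g' r s = g t' s - g t s := fun s =>
        intervalIntegral.integral_eq_sub_of_hasDerivAt (fun r _ => hd r s)
          (Continuous.intervalIntegrable (by fun_prop) _ _)
      simp only [this]
      rw [intervalIntegral.integral_sub (Continuous.intervalIntegrable (by fun_prop) _ _)
        (Continuous.intervalIntegrable (by fun_prop) _ _)]
      ring
    · exact (hg'.continuousOn.integrableOn_compact (isCompact_uIcc.prod isCompact_uIcc)).mono_set
        (prod_mono uIoc_subset_uIcc uIoc_subset_uIcc)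
  rw [e]
  refine HasDerivAt.const_add _ ?_
  have hc : Continuous fun r => ∫ s in b..y, g' r s :=
    intervalIntegral.continuous_parametric_intervalIntegral_of_continuous' hg' _ _
  exact intervalIntegral.integral_hasDerivAt_right (hc.intervalIntegrable _ _)
    hc.aestronglyMeasurable.stronglyMeasurableAtFilter hc.continuousAt

lemma continuous_integral_right {g : ℝ → ℝ → ℂ} (hg : Continuous (fun z : ℝ × ℝ => g z.1 z.2)) (b : ℝ) :
    Continuous (fun z : ℝ × ℝ => ∫ s in b..z.2, g z.1 s) :=
  intervalIntegral.continuous_parametric_intervalIntegral_of_continuous (by fun_prop) continuous_snd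

/-- The Leibniz rule with a moving endpoint. -/
lemma hasDerivAt_integral_endpoint {g g' : ℝ → ℝ → ℂ} (hg : Continuous (fun z : ℝ × ℝ => g z.1 z.2))
    (hg' : Continuous (fun z : ℝ × ℝ => g' z.1 z.2)) (hd : ∀ t s, HasDerivAt (fun t => g t s) (g' t s) t)
    (b t : ℝ) : HasDerivAt (fun t => ∫ s in b..t, g t s) (g t t + ∫ s in b..t, g' t s) t := by
  have key := hasStrictFDerivAt_uncurry_coprod (𝕜 := ℝ) (u := (t, t)) (f := fun t y => ∫ s in b..y, g t s)
    (f₁ := fun t y => ContinuousLinearMap.toSpanSingleton ℝ (∫ s in b..y, g' t s))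
    (f₂ := fun t y => ContinuousLinearMap.toSpanSingleton ℝ (g t y)) ?_ ?_ ?_ ?_
  · have h2 := key.hasFDerivAt.comp_hasDerivAt t (f := fun t => (t, t)) ((hasDerivAt_id t).prodMk (hasDerivAt_id t))
    simpa [Function.comp_def, Function.HasUncurry.uncurry, add_comm] using! h2
  · exact Eventually.of_forall fun v => (hasDerivAt_integral_of_continuous hg hg' hd b v.2 v.1).hasFDerivAt
  · refine Eventually.of_forall fun v => HasDerivAt.hasFDerivAt ?_
    have hc : Continuous (g v.1) := by fun_prop
    exact intervalIntegral.integral_hasDerivAt_right (hc.intervalIntegrable _ _)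
      hc.aestronglyMeasurable.stronglyMeasurableAtFilter hc.continuousAt
  · exact ((ContinuousLinearMap.toSpanSingletonCLE (𝕜 := ℝ) (E := ℂ)).continuous.comp
      (continuous_integral_right hg' b)).continuousAt
  · exact ((ContinuousLinearMap.toSpanSingletonCLE (𝕜 := ℝ) (E := ℂ)).continuous.comp hg).continuousAt

/-- Data on the real line: `ψ`, `χ` are `C¹` with derivatives `ψ'`, `χ'`, and `u' = 2p`. -/
structure RData (ψ ψ' χ χ' u p : ℝ → ℂ) : Prop where
  hψ : ∀ s, HasDerivAt ψ (ψ' s) s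
  hχ : ∀ s, HasDerivAt χ (χ' s) s
  hu : ∀ s, HasDerivAt u (2 * p s) s
  cψ : Continuous ψ'
  cχ : Continuous χ'
  cp : Continuous p

/-- The Riemann representation of the polarization at real points. -/
def rW (ψ χ χ' u p : ℝ → ℂ) (μ : ℂ) (t τ : ℝ) : ℂ :=
  u τ + ∫ s in τ..t, (bess 0 (μ * (ψ s - ψ t) * (χ s - χ τ)) * p s
    - bess 1 (μ * (ψ s - ψ t) * (χ s - χ τ)) * (μ * (ψ s - ψ t) * χ' s) * u s)

/-- The derivative of `rW` in its first argument. -/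
def rWt (ψ ψ' χ χ' u p : ℝ → ℂ) (μ : ℂ) (t τ : ℝ) : ℂ :=
  p t + ∫ s in τ..t, (bess 1 (μ * (ψ s - ψ t) * (χ s - χ τ)) * (μ * ψ' t * (χ s - χ τ)) * p s
    + bess 0 (μ * (ψ s - ψ t) * (χ s - χ τ)) * (μ * ψ' t * χ' s) * u s)

namespace RData

variable {ψ ψ' χ χ' u p : ℝ → ℂ} (h : RData ψ ψ' χ χ' u p) (μ : ℂ)
include h

lemma symm : RData χ χ' ψ ψ' u p := ⟨h.hχ, h.hψ, h.hu, h.cχ, h.cψ, h.cp⟩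

lemma cψ₀ : Continuous ψ := continuous_iff_continuousAt.2 fun s => (h.hψ s).continuousAt
lemma cχ₀ : Continuous χ := h.symm.cψ₀
lemma cu : Continuous u := continuous_iff_continuousAt.2 fun s => (h.hu s).continuousAt

/-- Integration by parts, giving a representation in terms of `u` only. -/
lemma rW_eq_half (t τ : ℝ) : rW ψ χ χ' u p μ t τ = (u t + u τ) / 2 + (1 / 2) * ∫ s in τ..t,
    bess 1 (μ * (ψ s - ψ t) * (χ s - χ τ)) * (μ * (ψ' s * (χ s - χ τ) - (ψ s - ψ t) * χ' s)) * u s := by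
  have := h.cψ₀; have := h.cχ₀; have := h.cu; have := h.cψ; have := h.cχ; have := h.cp
  have b0 := continuous_bess 0; have b1 := continuous_bess 1
  have e : ∫ s in τ..t, (-bess 1 (μ * (ψ s - ψ t) * (χ s - χ τ)) *
      (μ * ψ' s * (χ s - χ τ) + μ * (ψ s - ψ t) * χ' s) * u s
        + bess 0 (μ * (ψ s - ψ t) * (χ s - χ τ)) * (2 * p s)) = u t - u τ := by
    rw [intervalIntegral.integral_eq_sub_of_hasDerivAt (f := fun s => bess 0 (μ * (ψ s - ψ t) * (χ s - χ τ)) * u s)]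
    · simp [bess_zero_zero]
    · intro s _
      have h1 := (((h.hψ s).sub_const (ψ t)).const_mul μ).mul ((h.hχ s).sub_const (χ τ))
      exact ((hasDerivAt_bess 0 _).comp s h1).mul (h.hu s)
    · exact Continuous.intervalIntegrable (by fun_prop) _ _
  have e1 : ∀ f g : ℝ → ℂ, Continuous f → Continuous g →
      (∫ s in τ..t, f s) = (1 / 2) * (∫ s in τ..t, g s) + ∫ s in τ..t, (f s - (1 / 2) * g s) := by
    intro f g hf hg
    rw [intervalIntegral.integral_sub (hf.intervalIntegrable _ _) ((hg.const_mul _).intervalIntegrable _ _),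
      intervalIntegral.integral_const_mul]
    ring
  rw [rW, e1 _ _ _ (by fun_prop : Continuous fun s => (-bess 1 (μ * (ψ s - ψ t) * (χ s - χ τ)) *
      (μ * ψ' s * (χ s - χ τ) + μ * (ψ s - ψ t) * χ' s) * u s
        + bess 0 (μ * (ψ s - ψ t) * (χ s - χ τ)) * (2 * p s))), e, ← intervalIntegral.integral_const_mul]
  · rw [show ∀ a b c d : ℂ, c = d → a + (1 / 2 * (b - a) + c) = (b + a) / 2 + d from
      fun a b c d hcd => by rw [hcd]; ring]
    congr 1 with s
    ring
  · fun_prop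

lemma rW_symm (t τ : ℝ) : rW ψ χ χ' u p μ t τ = rW χ ψ ψ' u p μ τ t := by
  rw [h.rW_eq_half, h.symm.rW_eq_half, intervalIntegral.integral_symm τ t,
    ← intervalIntegral.integral_neg]
  congr 1
  · ring
  · congr 2 with s
    rw [show μ * (χ s - χ τ) * (ψ s - ψ t) = μ * (ψ s - ψ t) * (χ s - χ τ) by ring]
    ring

lemma hasDerivAt_rW (t τ : ℝ) :
    HasDerivAt (fun t => rW ψ χ χ' u p μ t τ) (rWt ψ ψ' χ χ' u p μ t τ) t := by
  have := h.cψ₀; have := h.cχ₀; have := h.cu; have := h.cψ; have := h.cχ; have := h.cp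
  have b0 := continuous_bess 0; have b1 := continuous_bess 1
  have key := hasDerivAt_integral_endpoint
    (g := fun t s => bess 0 (μ * (ψ s - ψ t) * (χ s - χ τ)) * p s
      - bess 1 (μ * (ψ s - ψ t) * (χ s - χ τ)) * (μ * (ψ s - ψ t) * χ' s) * u s)
    (g' := fun t s => bess 1 (μ * (ψ s - ψ t) * (χ s - χ τ)) * (μ * ψ' t * (χ s - χ τ)) * p s
      + bess 0 (μ * (ψ s - ψ t) * (χ s - χ τ)) * (μ * ψ' t * χ' s) * u s)
    (by fun_prop) (by fun_prop) ?_ τ t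
  · refine (show HasDerivAt (fun t => rW ψ χ χ' u p μ t τ) _ t from key.const_add (u τ)).congr_deriv ?_
    simp [bess_zero_zero, rWt]
  · intro t s
    have h0 := ((h.hψ t).const_sub (ψ s)).const_mul μ
    have h1 := h0.mul_const (χ s - χ τ)
    have h2 := (((hasDerivAt_bess 0 _).comp t h1).mul_const (p s)).sub
      ((((hasDerivAt_bess 1 _).comp t h1).mul (h0.mul_const (χ' s))).mul_const (u s))
    refine h2.congr_deriv ?_
    have ode := bess_ode (μ * (ψ s - ψ t) * (χ s - χ τ))
    simp only [Function.comp]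
    linear_combination (-(μ * ψ' t * χ' s * u s)) * ode

lemma hasDerivAt_rWt (t τ : ℝ) :
    HasDerivAt (fun τ => rWt ψ ψ' χ χ' u p μ t τ) (-μ * (ψ' t * χ' τ) * rW ψ χ χ' u p μ t τ) τ := by
  have := h.cψ₀; have := h.cχ₀; have := h.cu; have := h.cψ; have := h.cχ; have := h.cp
  have b0 := continuous_bess 0; have b1 := continuous_bess 1
  have key := hasDerivAt_integral_endpoint
    (g := fun τ s => bess 1 (μ * (ψ s - ψ t) * (χ s - χ τ)) * (μ * ψ' t * (χ s - χ τ)) * p s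
      + bess 0 (μ * (ψ s - ψ t) * (χ s - χ τ)) * (μ * ψ' t * χ' s) * u s)
    (g' := fun τ s => -μ * (ψ' t * χ' τ) * (bess 0 (μ * (ψ s - ψ t) * (χ s - χ τ)) * p s
      - bess 1 (μ * (ψ s - ψ t) * (χ s - χ τ)) * (μ * (ψ s - ψ t) * χ' s) * u s))
    (by fun_prop) (by fun_prop) ?_ t τ
  · have e : (fun τ => rWt ψ ψ' χ χ' u p μ t τ) = fun τ => p t - ∫ s in t..τ,
        (bess 1 (μ * (ψ s - ψ t) * (χ s - χ τ)) * (μ * ψ' t * (χ s - χ τ)) * p s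
      + bess 0 (μ * (ψ s - ψ t) * (χ s - χ τ)) * (μ * ψ' t * χ' s) * u s) := by
      ext τ
      rw [rWt, intervalIntegral.integral_symm, sub_eq_add_neg]
    rw [e]
    refine (key.const_sub (p t)).congr_deriv ?_
    rw [rW, intervalIntegral.integral_const_mul, intervalIntegral.integral_symm τ t]
    simp only [sub_self, mul_zero, bess_zero_zero]
    ring
  · intro τ s
    have h0 := ((h.hχ τ).const_sub (χ s))
    have h1 := h0.const_mul (μ * (ψ s - ψ t))
    have h2 := ((((hasDerivAt_bess 1 _).comp τ h1).mul (h0.const_mul (μ * ψ' t))).mul_const (p s)).add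
      ((((hasDerivAt_bess 0 _).comp τ h1).mul_const (μ * ψ' t * χ' s)).mul_const (u s))
    refine h2.congr_deriv ?_
    have ode := bess_ode (μ * (ψ s - ψ t) * (χ s - χ τ))
    simp only [Function.comp]
    linear_combination (μ * ψ' t * χ' τ * p s) * ode

omit h in
lemma rWt_self (s : ℝ) : rWt ψ ψ' χ χ' u p μ s s = p s := by simp [rWt]

lemma continuous_rW : Continuous (fun z : ℝ × ℝ => rW ψ χ χ' u p μ z.1 z.2) := by
  have := h.cψ₀; have := h.cχ₀; have := h.cu; have := h.cψ; have := h.cχ; have := h.cp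
  have b0 := continuous_bess 0; have b1 := continuous_bess 1
  have e : (fun z : ℝ × ℝ => rW ψ χ χ' u p μ z.1 z.2) = fun z : ℝ × ℝ => u z.2 +
     ((∫ s in (0 : ℝ)..z.1, (bess 0 (μ * (ψ s - ψ z.1) * (χ s - χ z.2)) * p s
    - bess 1 (μ * (ψ s - ψ z.1) * (χ s - χ z.2)) * (μ * (ψ s - ψ z.1) * χ' s) * u s)) -
     (∫ s in (0 : ℝ)..z.2, (bess 0 (μ * (ψ s - ψ z.1) * (χ s - χ z.2)) * p s
    - bess 1 (μ * (ψ s - ψ z.1) * (χ s - χ z.2)) * (μ * (ψ s - ψ z.1) * χ' s) * u s))) := by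
    ext z
    rw [rW, intervalIntegral.integral_interval_sub_left] <;>
    exact Continuous.intervalIntegrable (by fun_prop) _ _
  rw [e]
  fun_prop

end RData

end Nodal

namespace Nodal
open Set Filter Topology Metric ComplexConjugate

namespace RData

variable {ψ ψ' χ χ' u p : ℝ → ℂ} (h : RData ψ ψ' χ χ' u p) (μ : ℂ)
include h

lemma p_eq (y : ℝ) : p y = rWt χ χ' ψ ψ' u p μ y 0 +
    ∫ s in (0 : ℝ)..y, -μ * (ψ' s * χ' y) * rW ψ χ χ' u p μ s y := by
  have := h.cψ; have := h.cχ; have hW := h.continuous_rW μ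
  rw [intervalIntegral.integral_eq_sub_of_hasDerivAt
    (f := fun s => rWt χ χ' ψ ψ' u p μ y s)]
  · rw [rWt_self]; ring
  · intro s _
    have := h.symm.hasDerivAt_rWt μ y s
    rw [h.rW_symm]
    exact this.congr_deriv (by ring)
  · exact Continuous.intervalIntegrable (by fun_prop) _ _

lemma rWt_eq (x y : ℝ) : rWt ψ ψ' χ χ' u p μ x y = p x +
    ∫ s in x..y, -μ * (ψ' x * χ' s) * rW ψ χ χ' u p μ x s := by
  have := h.cψ; have := h.cχ; have hW := h.continuous_rW μ
  rw [intervalIntegral.integral_eq_sub_of_hasDerivAt (f := fun s => rWt ψ ψ' χ χ' u p μ x s)]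
  · rw [rWt_self]; ring
  · intro s _
    exact h.hasDerivAt_rWt μ x s
  · exact Continuous.intervalIntegrable (by fun_prop) _ _

/-- The Goursat problem solved by the symmetrization of `rW`. -/
lemma goursat {x y : ℝ} (hx : 0 ≤ x) (hy : 0 ≤ y) :
    rW ψ χ χ' u p μ (min x y) (max x y) =
      rW ψ χ χ' u p μ 0 x + rW ψ χ χ' u p μ 0 y - rW ψ χ χ' u p μ 0 0 +
      ∫ r in (0 : ℝ)..x, ∫ s in (0 : ℝ)..y,
        -μ * (ψ' (min r s) * χ' (max r s)) * rW ψ χ χ' u p μ (min r s) (max r s) := by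
  have := h.cψ; have := h.cχ; have hW := h.continuous_rW μ
  have hc : Continuous fun z : ℝ × ℝ => -μ * (ψ' (min z.1 z.2) * χ' (max z.1 z.2)) *
      rW ψ χ χ' u p μ (min z.1 z.2) (max z.1 z.2) := by
    have := hW.comp (f := fun z : ℝ × ℝ => (min z.1 z.2, max z.1 z.2)) (by fun_prop)
    simp only [Function.comp_def] at this
    fun_prop
  wlog hxy : x ≤ y generalizing x y
  · rw [min_comm, max_comm, this hy hx (le_of_not_ge hxy), intervalIntegral_intervalIntegral_swap]
    · simp only [min_comm, max_comm]
      ring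
    · exact (hc.continuousOn.integrableOn_compact (isCompact_uIcc.prod isCompact_uIcc)).mono_set
        (prod_mono uIoc_subset_uIcc uIoc_subset_uIcc)
  have hci : Continuous fun r => ∫ s in (0 : ℝ)..y,
        -μ * (ψ' (min r s) * χ' (max r s)) * rW ψ χ χ' u p μ (min r s) (max r s) :=
    intervalIntegral.continuous_parametric_intervalIntegral_of_continuous' hc _ _
  have hd : ∀ ξ ∈ Icc 0 y, HasDerivAt (fun ξ => rW ψ χ χ' u p μ ξ y - rW ψ χ χ' u p μ 0 ξ -
      ∫ r in (0 : ℝ)..ξ, ∫ s in (0 : ℝ)..y,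
        -μ * (ψ' (min r s) * χ' (max r s)) * rW ψ χ χ' u p μ (min r s) (max r s)) 0 ξ := by
    intro ξ hξ
    have h1 := h.hasDerivAt_rW μ ξ y
    have h2 := h.symm.hasDerivAt_rW μ ξ 0
    have h3 : HasDerivAt (fun ξ => ∫ r in (0 : ℝ)..ξ, ∫ s in (0 : ℝ)..y,
        -μ * (ψ' (min r s) * χ' (max r s)) * rW ψ χ χ' u p μ (min r s) (max r s)) _ ξ :=
      intervalIntegral.integral_hasDerivAt_right (hci.intervalIntegrable _ _)
        hci.aestronglyMeasurable.stronglyMeasurableAtFilter hci.continuousAt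
    simp only [← h.rW_symm] at h2
    refine ((h1.sub h2).sub h3).congr_deriv ?_
    rw [h.rWt_eq, h.p_eq μ ξ, ← intervalIntegral.integral_add_adjacent_intervals (a := 0) (b := ξ) (c := y)]
    · have e1 : ∫ s in (0 : ℝ)..ξ, -μ * (ψ' (min ξ s) * χ' (max ξ s)) * rW ψ χ χ' u p μ (min ξ s) (max ξ s)
          = ∫ s in (0 : ℝ)..ξ, -μ * (ψ' s * χ' ξ) * rW ψ χ χ' u p μ s ξ := by
        apply intervalIntegral.integral_congr
        intro s hs
        rw [uIcc_of_le hξ.1] at hs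
        simp only [min_eq_right hs.2, max_eq_left hs.2]
      have e2 : ∫ s in ξ..y, -μ * (ψ' (min ξ s) * χ' (max ξ s)) * rW ψ χ χ' u p μ (min ξ s) (max ξ s)
          = ∫ s in ξ..y, -μ * (ψ' ξ * χ' s) * rW ψ χ χ' u p μ ξ s := by
        apply intervalIntegral.integral_congr
        intro s hs
        rw [uIcc_of_le hξ.2] at hs
        simp only [min_eq_left hs.1, max_eq_right hs.1]
      rw [e1, e2]
      ring
    · exact Continuous.intervalIntegrable (by fun_prop) _ _
    · exact Continuous.intervalIntegrable (by fun_prop) _ _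
  have key := constant_of_has_deriv_right_zero (a := 0) (b := y)
    (fun ξ hξ => (hd ξ hξ).continuousAt.continuousWithinAt)
    (fun ξ hξ => (hd ξ ⟨hξ.1, hξ.2.le⟩).hasDerivWithinAt) x ⟨hx, hxy⟩
  simp only [intervalIntegral.integral_same, sub_zero] at key
  rw [min_eq_left hxy, max_eq_right hxy]
  linear_combination key

end RData

end Nodal

namespace Nodal
open Set Filter Topology Metric ComplexConjugate

/-- The integral operator of a Goursat problem. -/
def goursatOp (κ w : ℝ → ℝ → ℂ) (x y : ℝ) : ℂ :=
  x * y * ∫ r in (0 : ℝ)..1, ∫ s in (0 : ℝ)..1, κ (x * r) (y * s) * w (x * r) (y * s)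

lemma mul_mem_Icc01 {x r : ℝ} (hx : x ∈ Icc (0 : ℝ) 1) (hr : r ∈ Icc (0 : ℝ) 1) : x * r ∈ Icc (0 : ℝ) 1 :=
  ⟨mul_nonneg hx.1 hr.1, mul_le_one₀ hx.2 hr.1 hr.2⟩

lemma norm_goursatOp_iterate_le {κ w : ℝ → ℝ → ℂ} {N A : ℝ}
    (hκ : ∀ x ∈ Icc (0 : ℝ) 1, ∀ y ∈ Icc (0 : ℝ) 1, ‖κ x y‖ ≤ N)
    (hw : ∀ x ∈ Icc (0 : ℝ) 1, ∀ y ∈ Icc (0 : ℝ) 1, ‖w x y‖ ≤ A) (n : ℕ) {x y : ℝ}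
    (hx : x ∈ Icc (0 : ℝ) 1) (hy : y ∈ Icc (0 : ℝ) 1) :
    ‖(goursatOp κ)^[n] w x y‖ ≤ A * (N ^ n * (x * y) ^ n / (n.factorial * n.factorial)) := by
  induction n generalizing x y with
  | zero => simpa using hw x hx y hy
  | succ n ih =>
    have hA : 0 ≤ A := (norm_nonneg _).trans (hw x hx y hy)
    have hN : 0 ≤ N := (norm_nonneg _).trans (hκ x hx y hy)
    rw [Function.iterate_succ_apply', goursatOp]
    have hin : ∀ r ∈ Icc (0 : ℝ) 1, ‖∫ s in (0 : ℝ)..1, κ (x * r) (y * s) * (goursatOp κ)^[n] w (x * r) (y * s)‖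
        ≤ A * (N ^ (n + 1) * (x * y) ^ n / (n.factorial * n.factorial)) / (n + 1) * r ^ n := by
      intro r hr
      have : ∫ s in (0 : ℝ)..1, (A * (N ^ (n + 1) * (x * y) ^ n / (n.factorial * n.factorial)) * r ^ n) * s ^ n
          = A * (N ^ (n + 1) * (x * y) ^ n / (n.factorial * n.factorial)) / (n + 1) * r ^ n := by
        rw [intervalIntegral.integral_const_mul, integral_pow]
        simp
        ring
      rw [← this]
      refine intervalIntegral.norm_integral_le_of_norm_le zero_le_one (Eventually.of_forall fun s hs => ?_)
        (Continuous.intervalIntegrable (by fun_prop) _ _)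
      have hs' : s ∈ Icc (0 : ℝ) 1 := ⟨hs.1.le, hs.2⟩
      have h1 := hκ _ (mul_mem_Icc01 hx hr) _ (mul_mem_Icc01 hy hs')
      have h2 := ih (mul_mem_Icc01 hx hr) (mul_mem_Icc01 hy hs')
      rw [norm_mul]
      refine (mul_le_mul h1 h2 (norm_nonneg _) hN).trans (le_of_eq ?_)
      rw [show x * r * (y * s) = (x * y) * r * s by ring, mul_pow, mul_pow]
      ring
    have hout : ‖∫ r in (0 : ℝ)..1, ∫ s in (0 : ℝ)..1, κ (x * r) (y * s) * (goursatOp κ)^[n] w (x * r) (y * s)‖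
        ≤ A * (N ^ (n + 1) * (x * y) ^ n / (n.factorial * n.factorial)) / (n + 1) / (n + 1) := by
      have : ∫ r in (0 : ℝ)..1, A * (N ^ (n + 1) * (x * y) ^ n / (n.factorial * n.factorial)) / (n + 1) * r ^ n
          = A * (N ^ (n + 1) * (x * y) ^ n / (n.factorial * n.factorial)) / (n + 1) / (n + 1) := by
        rw [intervalIntegral.integral_const_mul, integral_pow]
        simp
        ring
      rw [← this]
      exact intervalIntegral.norm_integral_le_of_norm_le zero_le_one (Eventually.of_forall fun r hr =>
        hin r ⟨hr.1.le, hr.2⟩) (Continuous.intervalIntegrable (by fun_prop) _ _)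
    have hxy : 0 ≤ x * y := mul_nonneg hx.1 hy.1
    rw [norm_mul, ← Complex.ofReal_mul, Complex.norm_real, Real.norm_of_nonneg hxy]
    refine (mul_le_mul_of_nonneg_left hout hxy).trans (le_of_eq ?_)
    rw [Nat.factorial_succ]
    push_cast
    field_simp
    ring

lemma continuousOn_goursatOp {T : Type*} [TopologicalSpace T] {S : Set T} {κ w : T → ℝ → ℝ → ℂ}
    (hκ : ContinuousOn (fun z : T × ℝ × ℝ => κ z.1 z.2.1 z.2.2) (S ×ˢ (Icc 0 1 ×ˢ Icc 0 1)))
    (hw : ContinuousOn (fun z : T × ℝ × ℝ => w z.1 z.2.1 z.2.2) (S ×ˢ (Icc 0 1 ×ˢ Icc 0 1))) :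
    ContinuousOn (fun z : T × ℝ × ℝ => goursatOp (κ z.1) (w z.1) z.2.1 z.2.2) (S ×ˢ (Icc 0 1 ×ˢ Icc 0 1)) := by
  unfold goursatOp
  refine ContinuousOn.mul (by fun_prop) ?_
  refine continuousOn_integral_param (g := fun (z : T × ℝ × ℝ) r => ∫ s in (0 : ℝ)..1, κ z.1 (z.2.1 * r) (z.2.2 * s) *
    w z.1 (z.2.1 * r) (z.2.2 * s)) zero_le_one ?_
  refine continuousOn_integral_param (g := fun (z : (T × ℝ × ℝ) × ℝ) s => κ z.1.1 (z.1.2.1 * z.2) (z.1.2.2 * s) *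
    w z.1.1 (z.1.2.1 * z.2) (z.1.2.2 * s)) zero_le_one ?_
  have hm : MapsTo (fun z : ((T × ℝ × ℝ) × ℝ) × ℝ => (z.1.1.1, z.1.1.2.1 * z.1.2, z.1.1.2.2 * z.2))
      (((S ×ˢ (Icc 0 1 ×ˢ Icc 0 1)) ×ˢ Icc 0 1) ×ˢ Icc 0 1) (S ×ˢ (Icc (0 : ℝ) 1 ×ˢ Icc (0 : ℝ) 1)) :=
    fun z hz => ⟨hz.1.1.1, mul_mem_Icc01 hz.1.1.2.1 hz.1.2, mul_mem_Icc01 hz.1.1.2.2 hz.2⟩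
  exact (hκ.comp (by fun_prop) hm).mul (hw.comp (by fun_prop) hm)

lemma differentiableOn_goursatOp {U : Set ℂ} (hU : IsOpen U) {κ w : ℂ → ℝ → ℝ → ℂ}
    (hκ : ContinuousOn (fun z : ℂ × ℝ × ℝ => κ z.1 z.2.1 z.2.2) (U ×ˢ (Icc 0 1 ×ˢ Icc 0 1)))
    (hw : ContinuousOn (fun z : ℂ × ℝ × ℝ => w z.1 z.2.1 z.2.2) (U ×ˢ (Icc 0 1 ×ˢ Icc 0 1)))
    (hκ' : ∀ x ∈ Icc (0 : ℝ) 1, ∀ y ∈ Icc (0 : ℝ) 1, DifferentiableOn ℂ (fun t => κ t x y) U)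
    (hw' : ∀ x ∈ Icc (0 : ℝ) 1, ∀ y ∈ Icc (0 : ℝ) 1, DifferentiableOn ℂ (fun t => w t x y) U) :
    ∀ x ∈ Icc (0 : ℝ) 1, ∀ y ∈ Icc (0 : ℝ) 1, DifferentiableOn ℂ (fun t => goursatOp (κ t) (w t) x y) U := by
  intro x hx y hy
  unfold goursatOp
  refine DifferentiableOn.const_mul ?_ _
  have hc : ContinuousOn (fun z : (ℂ × ℝ) × ℝ => κ z.1.1 (x * z.1.2) (y * z.2) *
    w z.1.1 (x * z.1.2) (y * z.2)) ((U ×ˢ Icc 0 1) ×ˢ Icc 0 1) := by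
    have hm : MapsTo (fun z : (ℂ × ℝ) × ℝ => (z.1.1, x * z.1.2, y * z.2))
        ((U ×ˢ Icc 0 1) ×ˢ Icc 0 1) (U ×ˢ (Icc (0 : ℝ) 1 ×ˢ Icc (0 : ℝ) 1)) :=
      fun z hz => ⟨hz.1.1, mul_mem_Icc01 hx hz.1.2, mul_mem_Icc01 hy hz.2⟩
    exact (hκ.comp (by fun_prop) hm).mul (hw.comp (by fun_prop) hm)
  refine differentiableOn_integral_param zero_le_one hU ?_ fun r hr => ?_
  · exact continuousOn_integral_param (g := fun (z : ℂ × ℝ) s => κ z.1 (x * z.2) (y * s) *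
      w z.1 (x * z.2) (y * s)) zero_le_one hc
  · refine differentiableOn_integral_param zero_le_one hU ?_ fun s hs => ?_
    · exact hc.comp (f := fun z : ℂ × ℝ => ((z.1, r), z.2)) (by fun_prop) fun z hz => ⟨⟨hz.1, hr⟩, hz.2⟩
    · exact (hκ' _ (mul_mem_Icc01 hx hr) _ (mul_mem_Icc01 hy hs)).mul
        (hw' _ (mul_mem_Icc01 hx hr) _ (mul_mem_Icc01 hy hs))

lemma continuousOn_goursatOp_iterate {T : Type*} [TopologicalSpace T] {S : Set T} {κ w : T → ℝ → ℝ → ℂ}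
    (hκ : ContinuousOn (fun z : T × ℝ × ℝ => κ z.1 z.2.1 z.2.2) (S ×ˢ (Icc 0 1 ×ˢ Icc 0 1)))
    (hw : ContinuousOn (fun z : T × ℝ × ℝ => w z.1 z.2.1 z.2.2) (S ×ˢ (Icc 0 1 ×ˢ Icc 0 1))) (n : ℕ) :
    ContinuousOn (fun z : T × ℝ × ℝ => (goursatOp (κ z.1))^[n] (w z.1) z.2.1 z.2.2)
      (S ×ˢ (Icc 0 1 ×ˢ Icc 0 1)) := by
  induction n with
  | zero => exact hw
  | succ n ih =>
    simp only [Function.iterate_succ_apply']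
    exact continuousOn_goursatOp (w := fun t => (goursatOp (κ t))^[n] (w t)) hκ ih

lemma differentiableOn_goursatOp_iterate {U : Set ℂ} (hU : IsOpen U) {κ w : ℂ → ℝ → ℝ → ℂ}
    (hκ : ContinuousOn (fun z : ℂ × ℝ × ℝ => κ z.1 z.2.1 z.2.2) (U ×ˢ (Icc 0 1 ×ˢ Icc 0 1)))
    (hw : ContinuousOn (fun z : ℂ × ℝ × ℝ => w z.1 z.2.1 z.2.2) (U ×ˢ (Icc 0 1 ×ˢ Icc 0 1)))
    (hκ' : ∀ x ∈ Icc (0 : ℝ) 1, ∀ y ∈ Icc (0 : ℝ) 1, DifferentiableOn ℂ (fun t => κ t x y) U)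
    (hw' : ∀ x ∈ Icc (0 : ℝ) 1, ∀ y ∈ Icc (0 : ℝ) 1, DifferentiableOn ℂ (fun t => w t x y) U) (n : ℕ) :
    ∀ x ∈ Icc (0 : ℝ) 1, ∀ y ∈ Icc (0 : ℝ) 1,
      DifferentiableOn ℂ (fun t => (goursatOp (κ t))^[n] (w t) x y) U := by
  induction n with
  | zero => exact hw'
  | succ n ih =>
    simp only [Function.iterate_succ_apply']
    exact differentiableOn_goursatOp (w := fun t => (goursatOp (κ t))^[n] (w t)) hU hκ
      (continuousOn_goursatOp_iterate hκ hw n) hκ' ih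

lemma goursatOp_eq_add {κ a b c : ℝ → ℝ → ℂ}
    (hκ : ContinuousOn (fun z : ℝ × ℝ => κ z.1 z.2) (Icc 0 1 ×ˢ Icc 0 1))
    (hb : ContinuousOn (fun z : ℝ × ℝ => b z.1 z.2) (Icc 0 1 ×ˢ Icc 0 1))
    (hc : ContinuousOn (fun z : ℝ × ℝ => c z.1 z.2) (Icc 0 1 ×ˢ Icc 0 1))
    (h : ∀ x ∈ Icc (0 : ℝ) 1, ∀ y ∈ Icc (0 : ℝ) 1, a x y = b x y + c x y) :
    ∀ x ∈ Icc (0 : ℝ) 1, ∀ y ∈ Icc (0 : ℝ) 1, goursatOp κ a x y = goursatOp κ b x y + goursatOp κ c x y := by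
  intro x hx y hy
  have hm : MapsTo (fun z : ℝ × ℝ => (x * z.1, y * z.2)) (Icc 0 1 ×ˢ Icc 0 1) (Icc (0 : ℝ) 1 ×ˢ Icc (0 : ℝ) 1) :=
    fun z hz => ⟨mul_mem_Icc01 hx hz.1, mul_mem_Icc01 hy hz.2⟩
  have hκb : ContinuousOn (fun z : ℝ × ℝ => κ (x * z.1) (y * z.2) * b (x * z.1) (y * z.2)) (Icc 0 1 ×ˢ Icc 0 1) :=
    (hκ.comp (by fun_prop) hm).mul (hb.comp (by fun_prop) hm)
  have hκc : ContinuousOn (fun z : ℝ × ℝ => κ (x * z.1) (y * z.2) * c (x * z.1) (y * z.2)) (Icc 0 1 ×ˢ Icc 0 1) :=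
    (hκ.comp (by fun_prop) hm).mul (hc.comp (by fun_prop) hm)
  have hs : ∀ {f : ℝ × ℝ → ℂ}, ContinuousOn f (Icc 0 1 ×ˢ Icc 0 1) → ∀ r ∈ Icc (0 : ℝ) 1,
      IntervalIntegrable (fun s => f (r, s)) volume 0 1 := fun hf r hr =>
    ContinuousOn.intervalIntegrable_of_Icc zero_le_one
      (hf.comp (by fun_prop) fun s hs => ⟨hr, hs⟩)
  have hs' : ∀ {f : ℝ × ℝ → ℂ}, ContinuousOn f (Icc 0 1 ×ˢ Icc 0 1) →
      IntervalIntegrable (fun r => ∫ s in (0 : ℝ)..1, f (r, s)) volume 0 1 := fun {f} hf =>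
    ContinuousOn.intervalIntegrable_of_Icc zero_le_one
      (continuousOn_integral_param (g := fun r s => f (r, s)) zero_le_one hf)
  have e1 := hs' hκb
  have e2 := hs' hκc
  unfold goursatOp
  rw [← mul_add]
  congr 1
  rw [← intervalIntegral.integral_add e1 e2]
  apply intervalIntegral.integral_congr
  intro r hr
  rw [uIcc_of_le zero_le_one] at hr
  have f1 := hs hκb r hr
  have f2 := hs hκc r hr
  simp only
  rw [← intervalIntegral.integral_add f1 f2]
  apply intervalIntegral.integral_congr
  intro s hs
  rw [uIcc_of_le zero_le_one] at hs
  simp only [h _ (mul_mem_Icc01 hx hr) _ (mul_mem_Icc01 hy hs)]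
  ring

/-- The solution of a Goursat problem is given by the Neumann series. -/
lemma hasSum_goursatOp {κ w₀ w : ℝ → ℝ → ℂ}
    (hκ : ContinuousOn (fun z : ℝ × ℝ => κ z.1 z.2) (Icc 0 1 ×ˢ Icc 0 1))
    (hw₀ : ContinuousOn (fun z : ℝ × ℝ => w₀ z.1 z.2) (Icc 0 1 ×ˢ Icc 0 1))
    (hw : ContinuousOn (fun z : ℝ × ℝ => w z.1 z.2) (Icc 0 1 ×ˢ Icc 0 1))
    (h : ∀ x ∈ Icc (0 : ℝ) 1, ∀ y ∈ Icc (0 : ℝ) 1, w x y = w₀ x y + goursatOp κ w x y)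
    {x y : ℝ} (hx : x ∈ Icc (0 : ℝ) 1) (hy : y ∈ Icc (0 : ℝ) 1) :
    ∑' n, (goursatOp κ)^[n] w₀ x y = w x y := by
  have hit : ∀ {v : ℝ → ℝ → ℂ}, ContinuousOn (fun z : ℝ × ℝ => v z.1 z.2) (Icc 0 1 ×ˢ Icc 0 1) → ∀ n,
      ContinuousOn (fun z : ℝ × ℝ => (goursatOp κ)^[n] v z.1 z.2) (Icc 0 1 ×ˢ Icc 0 1) := by
    intro v hv n
    have := continuousOn_goursatOp_iterate (T := Unit) (S := univ) (κ := fun _ => κ) (w := fun _ => v)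
      (hκ.comp (f := Prod.snd) (by fun_prop) fun z hz => hz.2)
      (hv.comp (f := Prod.snd) (by fun_prop) fun z hz => hz.2) n
    exact this.comp (f := fun z : ℝ × ℝ => ((), z)) (by fun_prop) fun z hz => ⟨mem_univ _, hz⟩
  have step : ∀ n, ∀ x ∈ Icc (0 : ℝ) 1, ∀ y ∈ Icc (0 : ℝ) 1, (goursatOp κ)^[n] w x y =
      (goursatOp κ)^[n] w₀ x y + (goursatOp κ)^[n + 1] w x y := by
    intro n
    induction n with
    | zero => exact h
    | succ n ih =>
      simp only [Function.iterate_succ_apply' (f := goursatOp κ)] at ih ⊢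
      simp only [← Function.iterate_succ_apply' (f := goursatOp κ)] at ih ⊢
      have := goursatOp_eq_add hκ (hit hw₀ n) (hit hw (n + 1)) ih
      simpa only [← Function.iterate_succ_apply' (f := goursatOp κ)] using this
  have hsum : ∀ n, ∑ k ∈ Finset.range n, (goursatOp κ)^[k] w₀ x y = w x y - (goursatOp κ)^[n] w x y := by
    intro n
    induction n with
    | zero => simp
    | succ n ih =>
      rw [Finset.sum_range_succ, ih, step n x hx y hy]
      ring
  have hcomp : IsCompact (Icc (0 : ℝ) 1 ×ˢ Icc (0 : ℝ) 1) := isCompact_Icc.prod isCompact_Icc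
  obtain ⟨N, hN⟩ := hcomp.exists_bound_of_continuousOn hκ
  obtain ⟨A, hA⟩ := hcomp.exists_bound_of_continuousOn hw
  obtain ⟨A₀, hA₀⟩ := hcomp.exists_bound_of_continuousOn hw₀
  have hN0 : 0 ≤ N := (norm_nonneg _).trans (hN (x, y) ⟨hx, hy⟩)
  have b := fun n => norm_goursatOp_iterate_le (fun x hx y hy => hN (x, y) ⟨hx, hy⟩)
    (fun x hx y hy => hA (x, y) ⟨hx, hy⟩) n hx hy
  have b₀ := fun n => norm_goursatOp_iterate_le (fun x hx y hy => hN (x, y) ⟨hx, hy⟩)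
    (fun x hx y hy => hA₀ (x, y) ⟨hx, hy⟩) n hx hy
  have hs := (summable_pow_div (N * (x * y)) (mul_nonneg hN0 (mul_nonneg hx.1 hy.1))).1
  simp only [mul_pow N] at hs
  have hs₀ : Summable fun n => (goursatOp κ)^[n] w₀ x y := Summable.of_norm_bounded (hs.mul_left A₀) b₀
  refine tendsto_nhds_unique hs₀.hasSum.tendsto_sum_nat ?_
  simp only [hsum]
  have : Tendsto (fun n => (goursatOp κ)^[n] w x y) atTop (𝓝 0) :=
    squeeze_zero_norm b (hs.mul_left A).tendsto_atTop_zero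
  simpa using this.const_sub (w x y)

/-- Solving a Goursat problem depending holomorphically on a parameter. -/
lemma exists_goursat_solution {U : Set ℂ} (hU : IsOpen U) {κ w : ℂ → ℝ → ℝ → ℂ} {N A : ℝ}
    (hκ : ContinuousOn (fun z : ℂ × ℝ × ℝ => κ z.1 z.2.1 z.2.2) (U ×ˢ (Icc 0 1 ×ˢ Icc 0 1)))
    (hw : ContinuousOn (fun z : ℂ × ℝ × ℝ => w z.1 z.2.1 z.2.2) (U ×ˢ (Icc 0 1 ×ˢ Icc 0 1)))
    (hκ' : ∀ x ∈ Icc (0 : ℝ) 1, ∀ y ∈ Icc (0 : ℝ) 1, DifferentiableOn ℂ (fun t => κ t x y) U)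
    (hw' : ∀ x ∈ Icc (0 : ℝ) 1, ∀ y ∈ Icc (0 : ℝ) 1, DifferentiableOn ℂ (fun t => w t x y) U)
    (bκ : ∀ t ∈ U, ∀ x ∈ Icc (0 : ℝ) 1, ∀ y ∈ Icc (0 : ℝ) 1, ‖κ t x y‖ ≤ N)
    (bw : ∀ t ∈ U, ∀ x ∈ Icc (0 : ℝ) 1, ∀ y ∈ Icc (0 : ℝ) 1, ‖w t x y‖ ≤ A) (hN : 0 ≤ N) :
    DifferentiableOn ℂ (fun t => ∑' n, (goursatOp (κ t))^[n] (w t) 1 1) U ∧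
    ∀ t ∈ U, ‖∑' n, (goursatOp (κ t))^[n] (w t) 1 1‖ ≤ A * Real.exp (2 * √N) := by
  have h1 : (1 : ℝ) ∈ Icc (0 : ℝ) 1 := ⟨zero_le_one, le_rfl⟩
  have b : ∀ n t, t ∈ U → ‖(goursatOp (κ t))^[n] (w t) 1 1‖ ≤ A * (N ^ n / (n.factorial * n.factorial)) := by
    intro n t ht
    simpa using norm_goursatOp_iterate_le (bκ t ht) (bw t ht) n h1 h1
  obtain ⟨hs, hle⟩ := summable_pow_div N hN
  refine ⟨Complex.differentiableOn_tsum_of_summable_norm (hs.mul_left A) (fun n =>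
    differentiableOn_goursatOp_iterate hU hκ hw hκ' hw' n 1 h1 1 h1) hU b, fun t ht => ?_⟩
  have hA : 0 ≤ A := (norm_nonneg _).trans (bw t ht 1 h1 1 h1)
  refine (tsum_of_norm_bounded (hs.mul_left A).hasSum fun n => b n t ht).trans ?_
  rw [tsum_mul_left]
  gcongr

end Nodal

namespace Nodal
open Set Filter Topology Metric ComplexConjugate

lemma goursatOp_eq_integral (F : ℝ → ℝ → ℂ) (κ w : ℝ → ℝ → ℂ) (hF : ∀ r s, F r s = κ r s * w r s) (x y : ℝ) :
    ∫ r in (0 : ℝ)..x, ∫ s in (0 : ℝ)..y, F r s = goursatOp κ w x y := by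
  have h1 : ∀ f : ℝ → ℂ, ∀ c : ℝ, ∫ r in (0 : ℝ)..c, f r = c * ∫ r in (0 : ℝ)..1, f (c * r) := by
    intro f c
    have := intervalIntegral.smul_integral_comp_mul_left (a := 0) (b := 1) f c
    simp only [mul_zero, mul_one, Complex.real_smul] at this
    exact this.symm
  rw [h1, goursatOp, mul_assoc, ← intervalIntegral.integral_const_mul (y : ℂ)]
  simp only [h1 _ y, hF]

lemma differentiableOn_conj_conj {f : ℂ → ℂ} {s : Set ℂ} (hs : IsOpen s) (hf : DifferentiableOn ℂ f s) :
    DifferentiableOn ℂ (fun z => conj (f (conj z))) (conj ⁻¹' s) := by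
  intro z hz
  have h := (hf.differentiableAt (hs.mem_nhds hz)).hasDerivAt.conj_conj
  rw [Complex.conj_conj] at h
  exact h.differentiableAt.differentiableWithinAt

/-- The rescaling of real data by an affine change of variable. -/
lemma RData.comp_affine {ψ ψ' χ χ' u p : ℝ → ℂ} (h : RData ψ ψ' χ χ' u p) (a b : ℝ) :
    RData (fun x => ψ (a + b * x)) (fun x => b * ψ' (a + b * x)) (fun x => χ (a + b * x))
      (fun x => b * χ' (a + b * x)) (fun x => u (a + b * x)) (fun x => b * p (a + b * x)) := by
  have := h.cψ; have := h.cχ; have := h.cp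
  have hd : ∀ s : ℝ, HasDerivAt (fun x : ℝ => a + b * x) b s := fun s => by
    simpa using ((hasDerivAt_id s).const_mul b).const_add a
  refine ⟨fun s => ?_, fun s => ?_, fun s => ?_, by fun_prop, by fun_prop, by fun_prop⟩
  · simpa using! (h.hψ _).scomp s (hd s)
  · simpa using! (h.hχ _).scomp s (hd s)
  · have := (h.hu _).scomp s (hd s)
    simp only [Complex.real_smul] at this
    exact this.congr_deriv (by ring)

/-- The holomorphic extension of the boundary values near a real point. -/
lemma PolData.exists_extension {a r δ μ A : ℝ} {Q V p : ℂ → ℂ} {u pr : ℝ → ℂ} (hδ : 0 < δ)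
    (h : PolData (ball (a : ℂ) r ∩ {z | -δ < z.im}) Q V p μ)
    (hQ : DifferentiableOn ℂ Q (ball (a : ℂ) r)) (hQ' : ∀ z ∈ ball (a : ℂ) r, ‖deriv Q z‖ ≤ 2)
    (hR : RData (fun s => Q s) (fun s => deriv Q s) (fun s => conj (Q s)) (fun s => conj (deriv Q s)) u pr)
    (hu : ∀ s : ℝ, (s : ℂ) ∈ ball (a : ℂ) r → V s = u s)
    (hp : ∀ s : ℝ, (s : ℂ) ∈ ball (a : ℂ) r → p s = pr s)
    (hA : ∀ τ ∈ ball (a : ℂ) r, τ.im < δ → ‖pol Q V p μ a τ‖ ≤ A) :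
    ∃ F : ℂ → ℂ, DifferentiableOn ℂ F (ball (a : ℂ) r ∩ {z | z.im < δ}) ∧
      (∀ s : ℝ, (s : ℂ) ∈ ball (a : ℂ) r → F s = u s) ∧
      ∀ t ∈ ball (a : ℂ) r, t.im < δ → ‖F t‖ ≤ 3 * A * Real.exp (2 * √(4 * μ * r ^ 2)) := by
  set G := ball (a : ℂ) r ∩ {z : ℂ | z.im < δ} with hG
  have hμ := h.mu_nonneg
  have hGo : IsOpen G := isOpen_ball.inter (isOpen_lt Complex.continuous_im continuous_const)
  have hconj : conj ⁻¹' (ball (a : ℂ) r) = ball (a : ℂ) r := by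
    ext z
    simp only [mem_preimage, mem_ball, Complex.dist_eq]
    rw [← Complex.norm_conj (z - a)]
    simp
  have hGK : ∀ z ∈ G, conj z ∈ ball (a : ℂ) r ∩ {z : ℂ | -δ < z.im} := by
    intro z hz
    refine ⟨?_, ?_⟩
    · have := hz.1; rw [← hconj] at this; exact this
    · have := hz.2; simp at this ⊢; linarith
  have hline : ∀ t ∈ G, ∀ x ∈ Icc (0 : ℝ) 1, (a : ℂ) + x * (t - a) ∈ G := by
    intro t ht x hx
    refine ⟨?_, ?_⟩
    · have := ht.1
      simp only [mem_ball, Complex.dist_eq, add_sub_cancel_left, norm_mul, Complex.norm_real,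
        Real.norm_of_nonneg hx.1] at this ⊢
      exact (mul_le_of_le_one_left (norm_nonneg _) hx.2).trans_lt this
    · have := ht.2
      simp at this ⊢
      rcases le_total t.im 0 with h0 | h0
      · nlinarith [hx.1]
      · nlinarith [hx.2]
  have hline' : MapsTo (fun z : ℂ × ℝ => (a : ℂ) + z.2 * (z.1 - a)) (G ×ˢ Icc 0 1) G :=
    fun z hz => hline z.1 hz.1 z.2 hz.2
  have haK : r > 0 → (a : ℂ) ∈ ball (a : ℂ) r ∩ {z | -δ < z.im} := fun hr => ⟨mem_ball_self hr, by simpa using hδ⟩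
  have hGr : ∀ t ∈ G, r > 0 := fun t ht => dist_nonneg.trans_lt ht.1
  set v : ℂ → ℂ := fun τ => pol Q V p μ a τ with hv
  have hvd : DifferentiableOn ℂ v G := fun τ hτ =>
    (h.hasDerivAt_pol_right (haK (hGr τ hτ)) (hGK τ hτ)).differentiableWithinAt
  set ψ' : ℂ → ℂ := deriv Q with hψ'
  set χ' : ℂ → ℂ := fun z => conj (deriv Q (conj z)) with hχ'
  have hψd : DifferentiableOn ℂ ψ' G := (hQ.deriv isOpen_ball).mono inter_subset_left
  have hχd : DifferentiableOn ℂ χ' G := by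
    have := differentiableOn_conj_conj isOpen_ball (hQ.deriv isOpen_ball)
    rw [hconj] at this
    exact this.mono inter_subset_left
  set κ : ℂ → ℝ → ℝ → ℂ := fun t x y => -μ * (((t - a) * ψ' (a + (min x y : ℝ) * (t - a))) *
    ((t - a) * χ' (a + (max x y : ℝ) * (t - a)))) with hκ
  set w : ℂ → ℝ → ℝ → ℂ := fun t x y => v (a + x * (t - a)) + v (a + y * (t - a)) - v a with hw
  have hmin : ∀ {x y : ℝ}, x ∈ Icc (0 : ℝ) 1 → y ∈ Icc (0 : ℝ) 1 → min x y ∈ Icc (0 : ℝ) 1 :=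
    fun hx hy => ⟨le_min hx.1 hy.1, (min_le_left _ _).trans hx.2⟩
  have hmax : ∀ {x y : ℝ}, x ∈ Icc (0 : ℝ) 1 → y ∈ Icc (0 : ℝ) 1 → max x y ∈ Icc (0 : ℝ) 1 :=
    fun hx hy => ⟨hx.1.trans (le_max_left _ _), max_le hx.2 hy.2⟩
  have hcl : ∀ {f : ℂ → ℂ}, ContinuousOn f G → ∀ {g : ℂ × ℝ × ℝ → ℝ}, Continuous g →
      (∀ z ∈ G ×ˢ (Icc (0 : ℝ) 1 ×ˢ Icc (0 : ℝ) 1), g z ∈ Icc (0 : ℝ) 1) →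
      ContinuousOn (fun z => f (a + g z * (z.1 - a))) (G ×ˢ (Icc (0 : ℝ) 1 ×ˢ Icc (0 : ℝ) 1)) := by
    intro f hf g hg hgm
    exact hf.comp (by fun_prop) fun z hz => hline z.1 hz.1 _ (hgm z hz)
  have hdl : ∀ {f : ℂ → ℂ}, DifferentiableOn ℂ f G → ∀ x ∈ Icc (0 : ℝ) 1,
      DifferentiableOn ℂ (fun t => f (a + x * (t - a))) G := by
    intro f hf x hx
    exact hf.comp (by fun_prop) fun z hz => hline z hz x hx
  have cκ : ContinuousOn (fun z : ℂ × ℝ × ℝ => κ z.1 z.2.1 z.2.2) (G ×ˢ (Icc 0 1 ×ˢ Icc 0 1)) :=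
    continuousOn_const.mul ((ContinuousOn.mul (by fun_prop)
      (hcl hψd.continuousOn (g := fun z => min z.2.1 z.2.2) (by fun_prop) fun z hz => hmin hz.2.1 hz.2.2)).mul
      (ContinuousOn.mul (by fun_prop)
      (hcl hχd.continuousOn (g := fun z => max z.2.1 z.2.2) (by fun_prop) fun z hz => hmax hz.2.1 hz.2.2)))
  have cw : ContinuousOn (fun z : ℂ × ℝ × ℝ => w z.1 z.2.1 z.2.2) (G ×ˢ (Icc 0 1 ×ˢ Icc 0 1)) :=
    ((hcl hvd.continuousOn (g := fun z => z.2.1) (by fun_prop) fun z hz => hz.2.1).add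
    (hcl hvd.continuousOn (g := fun z => z.2.2) (by fun_prop) fun z hz => hz.2.2)).sub continuousOn_const
  have dκ : ∀ x ∈ Icc (0 : ℝ) 1, ∀ y ∈ Icc (0 : ℝ) 1, DifferentiableOn ℂ (fun t => κ t x y) G := by
    intro x hx y hy
    exact ((DifferentiableOn.mul (by fun_prop) (hdl hψd _ (hmin hx hy))).mul
      (DifferentiableOn.mul (by fun_prop) (hdl hχd _ (hmax hx hy)))).const_mul _
  have dw : ∀ x ∈ Icc (0 : ℝ) 1, ∀ y ∈ Icc (0 : ℝ) 1, DifferentiableOn ℂ (fun t => w t x y) G :=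
    fun x hx y hy => ((hdl hvd x hx).add (hdl hvd y hy)).sub_const _
  have bκ : ∀ t ∈ G, ∀ x ∈ Icc (0 : ℝ) 1, ∀ y ∈ Icc (0 : ℝ) 1, ‖κ t x y‖ ≤ 4 * μ * r ^ 2 := by
    intro t ht x hx y hy
    have h1 := hQ' _ (hline t ht _ (hmin hx hy)).1
    have h2 := hQ' _ (hGK _ (hline t ht _ (hmax hx hy))).1
    have h3 : ‖t - a‖ ≤ r := by have := ht.1; rw [mem_ball, Complex.dist_eq] at this; exact this.le
    have hr := (hGr t ht).le
    simp only [hκ, hψ', hχ', norm_mul, norm_neg, Complex.norm_real, Real.norm_of_nonneg hμ, Complex.norm_conj]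
    calc _ ≤ μ * (r * 2 * (r * 2)) := by gcongr
      _ = _ := by ring
  have bw : ∀ t ∈ G, ∀ x ∈ Icc (0 : ℝ) 1, ∀ y ∈ Icc (0 : ℝ) 1, ‖w t x y‖ ≤ 3 * A := by
    intro t ht x hx y hy
    have h1 := hA _ (hline t ht x hx).1 (hline t ht x hx).2
    have h2 := hA _ (hline t ht y hy).1 (hline t ht y hy).2
    have h3 := hA a (mem_ball_self (hGr t ht)) (by simpa using hδ)
    refine (norm_sub_le _ _).trans ?_
    have := norm_add_le (v (a + x * (t - a))) (v (a + y * (t - a)))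
    simp only [hv] at *
    linarith
  obtain ⟨hd, hb⟩ := exists_goursat_solution hGo cκ cw dκ dw bκ bw (by positivity)
  refine ⟨_, hd, ?_, fun t ht ht' => hb t ⟨ht, ht'⟩⟩
  intro t ht
  have htG : (t : ℂ) ∈ G := ⟨ht, by simpa using hδ⟩
  set b := t - a with hbdef
  have hR' := hR.comp_affine a b
  have htb : (t : ℂ) - a = (b : ℂ) := by simp [hbdef]
  have hin : ∀ x ∈ Icc (0 : ℝ) 1, ((a + b * x : ℝ) : ℂ) ∈ G := by
    intro x hx
    have := hline t htG x hx
    rwa [htb, mul_comm, ← Complex.ofReal_mul, ← Complex.ofReal_add] at this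
  set rw' := rW (fun x => Q ((a + b * x : ℝ) : ℂ)) (fun x => conj (Q ((a + b * x : ℝ) : ℂ)))
    (fun x => b * conj (deriv Q ((a + b * x : ℝ) : ℂ))) (fun x => u (a + b * x))
    (fun x => b * pr (a + b * x)) μ with hrw
  have hpol : ∀ x ∈ Icc (0 : ℝ) 1, rw' 0 x = v (a + x * (t - a)) := by
    intro x hx
    rw [htb, show (a : ℂ) + x * b = ((a + b * x : ℝ) : ℂ) by push_cast; ring]
    simp only [hv, pol, hrw, rW, Complex.conj_ofReal, rInt_eq]
    rw [hu _ (hin x hx).1]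
    congr 1
    have := intervalIntegral.smul_integral_comp_sub_mul (a := 0) (b := 1) (fun s =>
      bess 0 (μ * (Q ((a + b * s : ℝ) : ℂ) - Q ((a + b * 0 : ℝ) : ℂ)) *
        (conj (Q ((a + b * s : ℝ) : ℂ)) - conj (Q ((a + b * x : ℝ) : ℂ)))) * (b * pr (a + b * s)) -
      bess 1 (μ * (Q ((a + b * s : ℝ) : ℂ) - Q ((a + b * 0 : ℝ) : ℂ)) *
        (conj (Q ((a + b * s : ℝ) : ℂ)) - conj (Q ((a + b * x : ℝ) : ℂ)))) *
        (μ * (Q ((a + b * s : ℝ) : ℂ) - Q ((a + b * 0 : ℝ) : ℂ)) * (b * conj (deriv Q ((a + b * s : ℝ) : ℂ)))) * u (a + b * s)) x x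
    have e0 : x - x * 0 = x := by ring
    have e1 : x - x * 1 = 0 := by ring
    rw [e0, e1] at this
    rw [intervalIntegral.integral_symm, ← this, Complex.real_smul,
      ← intervalIntegral.integral_const_mul, ← intervalIntegral.integral_neg]
    apply intervalIntegral.integral_congr
    intro s hs
    rw [uIcc_of_le zero_le_one] at hs
    have hxs : x - x * s ∈ Icc (0 : ℝ) 1 := ⟨by nlinarith [hx.1, hx.2, hs.1, hs.2], by nlinarith [hx.1, hx.2, hs.1, hs.2, mul_nonneg hx.1 hs.1]⟩
    have hl : (AffineMap.lineMap ((a + b * x : ℝ) : ℂ) (a : ℂ) s : ℂ) = ((a + b * (x - x * s) : ℝ) : ℂ) := by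
      simp [AffineMap.lineMap_apply]; ring
    simp only [hl, rHol, rBar, rArg, hu _ (hin _ hxs).1, hp _ (hin _ hxs).1, mul_zero, add_zero]
    rw [← Complex.ofReal_sub, Complex.conj_ofReal]
    push_cast
    ring
  have h1 : (1 : ℝ) ∈ Icc (0 : ℝ) 1 := ⟨zero_le_one, le_rfl⟩
  have h0 : (0 : ℝ) ∈ Icc (0 : ℝ) 1 := ⟨le_rfl, zero_le_one⟩
  have hg := hasSum_goursatOp (κ := κ t) (w₀ := w t) (w := fun x y => rw' (min x y) (max x y)) ?_ ?_ ?_ ?_ h1 h1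
  · rw [hg]
    simp only [min_self, max_self, hrw, rW, intervalIntegral.integral_same, add_zero, mul_one]
    simp [hbdef]
  · exact cκ.comp (f := fun z : ℝ × ℝ => ((t : ℂ), z)) (by fun_prop) fun z hz => ⟨htG, hz⟩
  · exact cw.comp (f := fun z : ℝ × ℝ => ((t : ℂ), z)) (by fun_prop) fun z hz => ⟨htG, hz⟩
  · exact ((hR'.continuous_rW μ).comp (f := fun z : ℝ × ℝ => (min z.1 z.2, max z.1 z.2)) (by fun_prop)).continuousOn
  · intro x hx y hy
    have := hR'.goursat μ hx.1 hy.1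
    rw [← hrw] at this
    rw [this, goursatOp_eq_integral _ (κ t) (fun x y => rw' (min x y) (max x y)), hpol x hx, hpol y hy, hpol 0 h0]
    · simp [hw]
    · intro r s
      simp only [hκ, hψ', hχ', htb, map_add, map_mul, Complex.conj_ofReal]
      push_cast
      ring_nf

end Nodal

namespace Nodal
open Set Filter Topology Metric ComplexConjugate

/-- The horizontal strip of half-width `ε`. -/
def strip (ε : ℝ) : Set ℂ := {t : ℂ | |t.im| < ε}

lemma isOpen_strip (ε : ℝ) : IsOpen (strip ε) :=
  isOpen_lt (continuous_abs.comp Complex.continuous_im) continuous_const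

lemma convex_strip (ε : ℝ) : Convex ℝ (strip ε) := by
  have : strip ε = Complex.imLm ⁻¹' (Ioo (-ε) ε) := by
    ext z; simp [strip, abs_lt]
  rw [this]
  exact (convex_Ioo _ _).linear_preimage _

lemma ball_subset_strip (a : ℝ) {r ε : ℝ} (h : r ≤ ε) : ball (a : ℂ) r ⊆ strip ε := by
  intro z hz
  rw [mem_ball, Complex.dist_eq] at hz
  have := Complex.abs_im_le_norm (z - a)
  simp at this
  exact this.trans_lt (hz.trans_le h)

lemma mem_ball_re {t : ℂ} {ε : ℝ} (ht : t ∈ strip ε) : t ∈ ball ((t.re : ℝ) : ℂ) ε := by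
  rw [mem_ball, Complex.dist_eq]
  have : t - (t.re : ℂ) = (t.im : ℂ) * Complex.I := by
    apply Complex.ext <;> simp
  rw [this]
  simpa using! ht

lemma ofReal_mem_strip {ε : ℝ} (hε : 0 < ε) (s : ℝ) : (s : ℂ) ∈ strip ε := by simpa [strip] using hε

lemma strip_mono {ε ε' : ℝ} (h : ε ≤ ε') : strip ε ⊆ strip ε' := fun _ hz => lt_of_lt_of_le hz h

/-- Identity theorem: holomorphic functions agreeing at the real points are equal. -/
lemma eqOn_of_real {D : Set ℂ} (hD : IsOpen D) (hDc : IsPreconnected D) {f g : ℂ → ℂ}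
    (hf : DifferentiableOn ℂ f D) (hg : DifferentiableOn ℂ g D) {x₀ : ℝ} (hx₀ : (x₀ : ℂ) ∈ D)
    (h : ∀ s : ℝ, (s : ℂ) ∈ D → f s = g s) : EqOn f g D := by
  refine (hf.analyticOnNhd hD).eqOn_of_preconnected_of_frequently_eq (hg.analyticOnNhd hD) hDc hx₀ ?_
  have h1 : Tendsto (fun s : ℝ => (s : ℂ)) (𝓝[≠] x₀) (𝓝[≠] (x₀ : ℂ)) := by
    refine tendsto_nhdsWithin_iff.2 ⟨(Complex.continuous_ofReal.tendsto x₀).mono_left nhdsWithin_le_nhds, ?_⟩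
    filter_upwards [self_mem_nhdsWithin] with s hs
    simpa using hs
  have h2 : ∀ᶠ s : ℝ in 𝓝[≠] x₀, f s = g s := by
    have : ∀ᶠ s : ℝ in 𝓝 x₀, (s : ℂ) ∈ D :=
      Complex.continuous_ofReal.tendsto x₀ (hD.mem_nhds hx₀)
    exact (this.filter_mono nhdsWithin_le_nhds).mono fun s hs => h s hs
  exact h1.frequently h2.frequently

lemma exists_strip_extension {ε : ℝ} {f : ℝ → ℂ}
    (h : ∀ a : ℝ, ∃ F : ℂ → ℂ, DifferentiableOn ℂ F (ball (a : ℂ) ε) ∧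
      ∀ s : ℝ, (s : ℂ) ∈ ball (a : ℂ) ε → F s = f s) :
    ∃ F : ℂ → ℂ, DifferentiableOn ℂ F (strip ε) ∧ ∀ s : ℝ, 0 < ε → F s = f s := by
  choose F hF hFr using h
  refine ⟨fun t => F t.re t, ?_, fun s hs => hFr _ _ (by simpa using hs)⟩
  intro t₀ ht₀
  have hb := mem_ball_re ht₀
  have hd := (hF t₀.re).differentiableAt (isOpen_ball.mem_nhds hb)
  refine (hd.congr_of_eventuallyEq ?_).differentiableWithinAt
  filter_upwards [isOpen_ball.mem_nhds hb, (isOpen_strip ε).mem_nhds ht₀] with t ht ht'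
  have hre : (t.re : ℂ) ∈ ball (t₀.re : ℂ) ε := by
    rw [mem_ball, Complex.dist_eq, ← Complex.ofReal_sub, Complex.norm_real, Real.norm_eq_abs]
    rw [mem_ball, Complex.dist_eq] at ht
    have := Complex.abs_re_le_norm (t - t₀.re)
    simp at this
    exact this.trans_lt ht
  refine eqOn_of_real (D := ball (t.re : ℂ) ε ∩ ball (t₀.re : ℂ) ε) (isOpen_ball.inter isOpen_ball)
    ((convex_ball _ _).inter (convex_ball _ _)).isPreconnected
    ((hF _).mono inter_subset_left) ((hF _).mono inter_subset_right) (x₀ := t.re)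
    ⟨mem_ball_self ?_, hre⟩ (fun s hs => (hFr _ s hs.1).trans (hFr _ s hs.2).symm) ⟨mem_ball_re ht', ht⟩
  exact dist_nonneg.trans_lt ht

lemma periodic_of_real {ε : ℝ} (hε : 0 < ε) {F : ℂ → ℂ} (hF : DifferentiableOn ℂ F (strip ε)) {ℓ : ℝ}
    (h : ∀ s : ℝ, F ((s + ℓ : ℝ)) = F s) : ∀ t ∈ strip ε, F (t + ℓ) = F t := by
  refine eqOn_of_real (isOpen_strip ε) (convex_strip ε).isPreconnected (f := fun t => F (t + ℓ)) ?_ hF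
    (ofReal_mem_strip hε 0) fun s _ => by simpa using h s
  exact hF.comp (by fun_prop) fun z hz => by simpa [strip] using! hz

lemma conj_ball_ofReal (a r : ℝ) : conj ⁻¹' (ball (a : ℂ) r) = ball (a : ℂ) r := by
  ext z
  simp only [mem_preimage, mem_ball, Complex.dist_eq]
  rw [← Complex.norm_conj (z - a)]
  simp

/-- Schwarz reflection for functions defined slightly beyond the real axis. -/
lemma exists_reflection {a r δ B : ℝ} (hδ : 0 < δ) {F : ℂ → ℂ}
    (hF : DifferentiableOn ℂ F (ball (a : ℂ) r ∩ {z | z.im < δ})) {u : ℝ → ℝ}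
    (hu : ∀ s : ℝ, (s : ℂ) ∈ ball (a : ℂ) r → F s = u s)
    (hB : ∀ t ∈ ball (a : ℂ) r, t.im < δ → ‖F t‖ ≤ B) :
    ∃ G : ℂ → ℂ, DifferentiableOn ℂ G (ball (a : ℂ) r) ∧
      (∀ s : ℝ, (s : ℂ) ∈ ball (a : ℂ) r → G s = u s) ∧ ∀ t ∈ ball (a : ℂ) r, ‖G t‖ ≤ B := by
  have hc := conj_ball_ofReal a r
  have hlow : IsOpen {z : ℂ | z.im < δ} := isOpen_lt Complex.continuous_im continuous_const
  have hup : IsOpen {z : ℂ | -δ < z.im} := isOpen_lt continuous_const Complex.continuous_im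
  have hF' : DifferentiableOn ℂ (fun z => conj (F (conj z))) (ball (a : ℂ) r ∩ {z | -δ < z.im}) := by
    refine (differentiableOn_conj_conj (isOpen_ball.inter hlow) hF).mono ?_
    intro z hz
    refine ⟨by rw [← mem_preimage, hc]; exact hz.1, ?_⟩
    have := hz.2
    simp at this ⊢; linarith
  have heq : EqOn F (fun z => conj (F (conj z))) ((ball (a : ℂ) r ∩ {z | z.im < δ}) ∩ {z | -δ < z.im}) := by
    rcases le_or_gt r 0 with hr | hr
    · simp [ball_eq_empty.2 hr]
    refine eqOn_of_real ((isOpen_ball.inter hlow).inter hup) (Convex.isPreconnected ?_) (hF.mono inter_subset_left)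
      (hF'.mono fun z hz => ⟨hz.1.1, hz.2⟩) (x₀ := a) ⟨⟨mem_ball_self hr, by simpa using hδ⟩, by simpa using hδ⟩ ?_
    · exact ((convex_ball _ _).inter (convex_halfSpace_im_lt δ)).inter (convex_halfSpace_im_gt (-δ))
    · intro s hs
      simp [hu s hs.1.1]
  classical
  refine ⟨fun z => if z.im < δ then F z else conj (F (conj z)), ?_, ?_, ?_⟩
  · intro z hz
    refine DifferentiableAt.differentiableWithinAt ?_
    rcases lt_or_ge z.im δ with h | h
    · refine (hF.differentiableAt ((isOpen_ball.inter hlow).mem_nhds ⟨hz, h⟩)).congr_of_eventuallyEq ?_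
      filter_upwards [hlow.mem_nhds h] with w hw
      exact if_pos hw
    · have hz' : z ∈ ball (a : ℂ) r ∩ {z | -δ < z.im} := ⟨hz, by simp; linarith⟩
      have ho : IsOpen (ball (a : ℂ) r ∩ {z | -δ < z.im}) := isOpen_ball.inter hup
      refine (hF'.differentiableAt (ho.mem_nhds hz')).congr_of_eventuallyEq ?_
      filter_upwards [ho.mem_nhds hz'] with w hw
      split_ifs with h1
      · exact heq ⟨⟨hw.1, h1⟩, hw.2⟩
      · rfl
  · intro s hs
    simp [hδ, hu s hs]
  · intro t ht
    dsimp only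
    split_ifs with h
    · exact hB t ht h
    · rw [Complex.norm_conj]
      refine hB _ (by rw [← mem_preimage, hc]; exact ht) ?_
      simp at h ⊢; linarith

end Nodal

namespace Nodal
open Set Filter Topology Metric ComplexConjugate

lemma exists_factor {D : Set ℂ} (hD : IsOpen D) (Z : Finset ℂ) : ∀ {G : ℂ → ℂ}, DifferentiableOn ℂ G D →
    (∀ z ∈ Z, z ∈ D ∧ G z = 0) →
    ∃ g : ℂ → ℂ, DifferentiableOn ℂ g D ∧ ∀ z, G z = (∏ a ∈ Z, (z - a)) * g z := by
  classical
  induction Z using Finset.induction_on with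
  | empty => intro G hG _; exact ⟨G, hG, by simp⟩
  | insert a Z ha ih =>
    intro G hG hZ
    obtain ⟨haD, hGa⟩ := hZ a (Finset.mem_insert_self _ _)
    have hsl : ∀ z, G z = (z - a) * dslope G a z := by
      intro z
      have := sub_smul_dslope G a z
      rw [hGa, sub_zero] at this
      exact this.symm
    obtain ⟨g, hg, hgz⟩ := ih (G := dslope G a)
      ((Complex.differentiableOn_dslope (hD.mem_nhds haD)).2 hG) (by
        intro z hz
        obtain ⟨hzD, hGz⟩ := hZ z (Finset.mem_insert_of_mem hz)
        refine ⟨hzD, ?_⟩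
        rw [hsl] at hGz
        refine (mul_eq_zero.1 hGz).resolve_left fun h => ha ?_
        rwa [← sub_eq_zero.1 h])
    refine ⟨g, hg, fun z => ?_⟩
    rw [hsl, hgz, Finset.prod_insert ha, mul_assoc]

lemma norm_blaschke_identity (R : ℝ) (a w : ℂ) :
    ‖(R : ℂ) ^ 2 - conj a * w‖ ^ 2 - (R * ‖w - a‖) ^ 2 = (R ^ 2 - ‖w‖ ^ 2) * (R ^ 2 - ‖a‖ ^ 2) := by
  rw [mul_pow]
  simp only [← Complex.normSq_eq_norm_sq, Complex.normSq_apply, ← Complex.ofReal_pow, Complex.sub_re,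
    Complex.sub_im, Complex.mul_re, Complex.mul_im, Complex.conj_re, Complex.conj_im, Complex.ofReal_re,
    Complex.ofReal_im]
  ring

lemma exists_blaschke_bound {ρ : ℝ} (hρ : ρ < 1) : ∃ κ : ℝ, 0 < κ ∧ κ < 1 ∧ ∀ {G : ℂ → ℂ} {A : ℝ},
    DifferentiableOn ℂ G (ball 0 1) → (∀ z ∈ ball (0 : ℂ) 1, ‖G z‖ ≤ A) → ∀ Z : Finset ℂ,
    (∀ z ∈ Z, ‖z‖ ≤ ρ ∧ G z = 0) → ∀ w : ℂ, ‖w‖ ≤ ρ → ‖G w‖ ≤ A * κ ^ Z.card := by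
  rcases lt_or_ge ρ 0 with h0 | h0
  · exact ⟨1 / 2, by norm_num, by norm_num, fun _ _ _ _ w hw => absurd (norm_nonneg w) (by linarith)⟩
  set R : ℝ := (1 + ρ) / 2 with hR
  have hρR : ρ < R := by rw [hR]; linarith
  have hR1 : R < 1 := by rw [hR]; linarith
  have hR0 : 0 < R := by linarith
  set c : ℝ := ((R ^ 2 - ρ ^ 2) / (2 * R ^ 2)) ^ 2 with hc
  have hq : 0 < R ^ 2 - ρ ^ 2 := by nlinarith
  have hc0 : 0 < c := by positivity
  have hc1 : c < 1 := by
    rw [hc, sq_lt_one_iff₀ (by positivity), div_lt_one (by positivity)]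
    nlinarith
  have hden : ∀ a w : ℂ, ‖a‖ ≤ ρ → ‖w‖ ≤ R → 0 < ‖(R : ℂ) ^ 2 - conj a * w‖ := by
    intro a w ha hw
    have h1 : ‖(R : ℂ) ^ 2‖ = R ^ 2 := by simp
    have h2 := norm_sub_norm_le ((R : ℂ) ^ 2) (conj a * w)
    rw [h1, norm_mul, Complex.norm_conj] at h2
    nlinarith [mul_le_mul ha hw (norm_nonneg _) h0]
  have hfac : ∀ a w : ℂ, ‖a‖ ≤ ρ → ‖w‖ ≤ ρ → R * ‖w - a‖ ≤ √(1 - c) * ‖(R : ℂ) ^ 2 - conj a * w‖ := by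
    intro a w ha hw
    have hid := norm_blaschke_identity R a w
    set N := ‖(R : ℂ) ^ 2 - conj a * w‖ with hN
    have hN2 : N ≤ 2 * R ^ 2 := by
      refine (norm_sub_le _ _).trans ?_
      simp only [norm_pow, norm_mul, Complex.norm_conj, Complex.norm_real, Real.norm_of_nonneg hR0.le]
      nlinarith [mul_le_mul ha hw (norm_nonneg _) h0]
    have h3 : (R ^ 2 - ρ ^ 2) ^ 2 ≤ (R ^ 2 - ‖w‖ ^ 2) * (R ^ 2 - ‖a‖ ^ 2) := by
      rw [sq (R ^ 2 - ρ ^ 2)]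
      have e1 := pow_le_pow_left₀ (norm_nonneg w) hw 2
      have e2 := pow_le_pow_left₀ (norm_nonneg a) ha 2
      exact mul_le_mul (by linarith) (by linarith) hq.le (by linarith)
    have h4 : c * N ^ 2 ≤ (R ^ 2 - ρ ^ 2) ^ 2 := by
      have : c * (2 * R ^ 2) ^ 2 = (R ^ 2 - ρ ^ 2) ^ 2 := by rw [hc]; field_simp
      rw [← this]
      gcongr
    refine abs_le_of_sq_le_sq' ?_ (by positivity) |>.2
    rw [mul_pow (√(1 - c)), Real.sq_sqrt (by linarith)]
    linarith
  refine ⟨√(1 - c), Real.sqrt_pos.2 (by linarith), by rw [Real.sqrt_lt' one_pos]; linarith, ?_⟩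
  intro G A hG hA Z hZ w hw
  obtain ⟨g, hg, hGg⟩ := exists_factor isOpen_ball Z hG fun z hz =>
    ⟨by simpa using (hZ z hz).1.trans_lt hρ, (hZ z hz).2⟩
  set h : ℂ → ℂ := fun z => g z * ∏ a ∈ Z, (((R : ℂ) ^ 2 - conj a * z) / R) with hh
  have hcb : closedBall (0 : ℂ) R ⊆ ball 0 1 := closedBall_subset_ball hR1
  have hd : DifferentiableOn ℂ h (ball 0 1) := hg.mul (DifferentiableOn.fun_finsetProd fun a _ => by fun_prop)
  have hwh : ‖h w‖ ≤ A := by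
    refine Complex.norm_le_of_forall_mem_frontier_norm_le (U := ball 0 R) isBounded_ball ?_ ?_
      (subset_closure (by simpa using hw.trans_lt hρR))
    · exact (hd.mono (by rw [closure_ball _ hR0.ne']; exact hcb)).diffContOnCl
    · intro z hz
      rw [frontier_ball _ hR0.ne', mem_sphere_zero_iff_norm] at hz
      have hz1 : z ∈ ball (0 : ℂ) 1 := by simpa [hz] using hR1
      refine le_trans (le_of_eq ?_) (hA z hz1)
      rw [hGg, hh, norm_mul, norm_mul, mul_comm, norm_prod, norm_prod]
      congr 1
      refine Finset.prod_congr rfl fun a _ => ?_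
      have := norm_blaschke_identity R a z
      rw [hz, sub_self, zero_mul, sub_eq_zero] at this
      have h5 := (pow_left_inj₀ (norm_nonneg _) (by positivity) two_ne_zero).1 this
      rw [norm_div, h5, Complex.norm_real, Real.norm_of_nonneg hR0.le]
      field_simp
  have hprod : ∏ a ∈ Z, ‖w - a‖ ≤ √(1 - c) ^ Z.card * ∏ a ∈ Z, ‖((R : ℂ) ^ 2 - conj a * w) / R‖ := by
    rw [← Finset.prod_const, ← Finset.prod_mul_distrib]
    refine Finset.prod_le_prod (fun _ _ => norm_nonneg _) fun a ha => ?_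
    have := hfac a w (hZ a ha).1 hw
    rw [norm_div, Complex.norm_real, Real.norm_of_nonneg hR0.le, ← mul_div_assoc, le_div_iff₀ hR0]
    linarith
  rw [hGg, norm_mul, norm_prod]
  calc (∏ a ∈ Z, ‖w - a‖) * ‖g w‖ ≤ (√(1 - c) ^ Z.card * ∏ a ∈ Z, ‖((R : ℂ) ^ 2 - conj a * w) / R‖) * ‖g w‖ := by
        gcongr
    _ = ‖h w‖ * √(1 - c) ^ Z.card := by rw [hh, norm_mul, norm_prod]; ring
    _ ≤ _ := by gcongr

lemma exists_strip_chart {ε : ℝ} (hε : 0 < ε) {K : Set ℂ} (hK : IsCompact K) (hKs : K ⊆ strip ε) :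
    ∃ (ρ : ℝ) (Ψ Θ : ℂ → ℂ), ρ < 1 ∧ DifferentiableOn ℂ Ψ (ball 0 1) ∧ MapsTo Ψ (ball 0 1) (strip ε) ∧
      (∀ t ∈ K, ‖Θ t‖ ≤ ρ ∧ Ψ (Θ t) = t) := by
  have hsl : ∀ w ∈ ball (0 : ℂ) 1, 0 < ((1 + w) / (1 - w)).re := by
    intro w hw
    rw [mem_ball_zero_iff, ← sq_lt_one_iff₀ (norm_nonneg _), ← Complex.normSq_eq_norm_sq,
      Complex.normSq_apply] at hw
    have hne : 1 - w ≠ 0 := fun h => by rw [← sub_eq_zero.1 h] at hw; simp at hw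
    rw [Complex.div_re, ← add_div]
    refine div_pos ?_ (Complex.normSq_pos.2 hne)
    simp
    nlinarith
  have hne : ∀ w ∈ ball (0 : ℂ) 1, 1 - w ≠ 0 := by
    intro w hw h
    have := hsl w hw
    rw [h] at this; simp at this
  have hexp : ∀ t ∈ strip ε, 0 < (Complex.exp ((π / (2 * ε) : ℝ) * t)).re := by
    intro t ht
    rw [Complex.exp_re]
    refine mul_pos (Real.exp_pos _) (Real.cos_pos_of_mem_Ioo ?_)
    simp only [Complex.im_ofReal_mul]
    obtain ⟨h1, h2⟩ := abs_lt.1 (show |t.im| < ε from ht)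
    have e : π / (2 * ε) * ε = π / 2 := by field_simp
    have hp : 0 < π / (2 * ε) := by positivity
    exact ⟨by nlinarith, by nlinarith⟩
  set Θ : ℂ → ℂ := fun t => (Complex.exp ((π / (2 * ε) : ℝ) * t) - 1) / (Complex.exp ((π / (2 * ε) : ℝ) * t) + 1)
  have hne' : ∀ t ∈ strip ε, Complex.exp ((π / (2 * ε) : ℝ) * t) + 1 ≠ 0 := by
    intro t ht h
    have := hexp t ht
    rw [eq_neg_of_add_eq_zero_left h] at this
    simp at this; linarith
  have hΘ1 : ∀ t ∈ strip ε, ‖Θ t‖ < 1 := by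
    intro t ht
    have h1 := hexp t ht
    have h2 := norm_pos_iff.2 (hne' t ht)
    simp only [Θ, norm_div]
    rw [div_lt_one h2, ← sq_lt_sq₀ (norm_nonneg _) (norm_nonneg _), ← Complex.normSq_eq_norm_sq,
      ← Complex.normSq_eq_norm_sq, Complex.normSq_apply, Complex.normSq_apply]
    simp only [Complex.sub_re, Complex.add_re, Complex.sub_im, Complex.add_im, Complex.one_re, Complex.one_im]
    nlinarith
  have hΘc : ContinuousOn Θ K := by
    refine ContinuousOn.div (by fun_prop) (by fun_prop) fun t ht => hne' t (hKs ht)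
  obtain ⟨ρ, hρ, hρK⟩ : ∃ ρ < (1 : ℝ), ∀ t ∈ K, ‖Θ t‖ ≤ ρ := by
    rcases K.eq_empty_or_nonempty with rfl | hne
    · exact ⟨0, by norm_num, by simp⟩
    · obtain ⟨t, ht, hm⟩ := hK.exists_isMaxOn hne hΘc.norm
      exact ⟨‖Θ t‖, hΘ1 t (hKs ht), fun s hs => hm hs⟩
  refine ⟨ρ, fun w => (2 * ε / π : ℝ) * Complex.log ((1 + w) / (1 - w)), Θ, hρ, ?_, ?_, fun t ht => ⟨hρK t ht, ?_⟩⟩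
  · refine DifferentiableOn.const_mul (DifferentiableOn.clog ?_ fun w hw => Or.inl (hsl w hw)) _
    exact DifferentiableOn.div (by fun_prop) (by fun_prop) hne
  · intro w hw
    have := Complex.abs_arg_lt_pi_div_two_iff.2 (Or.inl (hsl w hw))
    simp only [strip, mem_ofPred_eq, Complex.im_ofReal_mul, Complex.log_im, abs_mul]
    rw [abs_of_pos (by positivity)]
    calc _ < 2 * ε / π * (π / 2) := by gcongr
      _ = ε := by field_simp
  · have hs := hKs ht
    have h1 := hne' t hs
    have e : (1 + Θ t) / (1 - Θ t) = Complex.exp ((π / (2 * ε) : ℝ) * t) := by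
      simp only [Θ]
      have : Complex.exp ((π / (2 * ε) : ℝ) * t) + 1 - (Complex.exp ((π / (2 * ε) : ℝ) * t) - 1) ≠ 0 := by
        ring_nf; norm_num
      rw [one_add_div h1, one_sub_div h1, div_div_div_cancel_right₀ h1]
      ring
    obtain ⟨h3, h4⟩ := abs_lt.1 (show |t.im| < ε from hs)
    have e1 : π / (2 * ε) * ε = π / 2 := by field_simp
    have hp : 0 < π / (2 * ε) := by positivity
    simp only
    rw [e, Complex.log_exp, ← mul_assoc, ← Complex.ofReal_mul]
    · have : 2 * ε / π * (π / (2 * ε)) = 1 := by field_simp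
      rw [this]; simp
    · rw [Complex.im_ofReal_mul]; nlinarith [Real.pi_pos]
    · rw [Complex.im_ofReal_mul]; nlinarith [Real.pi_pos]

/-- Counting zeros of a holomorphic function on a strip in terms of its growth. -/
lemma exists_zero_count {ε : ℝ} (hε : 0 < ε) {K : Set ℂ} (hK : IsCompact K) (hKs : K ⊆ strip ε) :
    ∃ C : ℝ, 0 < C ∧ ∀ {F : ℂ → ℂ} {A b : ℝ}, DifferentiableOn ℂ F (strip ε) → 0 < A →
      (∀ t ∈ strip ε, ‖F t‖ ≤ A) → (∃ t₀ ∈ K, A * Real.exp (-b) ≤ ‖F t₀‖) →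
      {t ∈ K | F t = 0}.Finite ∧ ({t ∈ K | F t = 0}.ncard : ℝ) ≤ C * b := by
  obtain ⟨ρ, Ψ, Θ, hρ, hΨd, hΨm, hΘ⟩ := exists_strip_chart hε hK hKs
  obtain ⟨κ, hκ0, hκ1, hκ⟩ := exists_blaschke_bound hρ
  have hlog : 0 < -Real.log κ := by linarith [Real.log_neg hκ0 hκ1]
  refine ⟨1 / -Real.log κ, by positivity, ?_⟩
  intro F A b hF hA hFA ⟨t₀, ht₀, hb⟩
  have hcard : ∀ Z : Finset ℂ, (↑Z ⊆ {t ∈ K | F t = 0}) → (Z.card : ℝ) ≤ 1 / -Real.log κ * b := by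
    classical
    intro Z hZ
    have hinj : Set.InjOn Θ Z := fun x hx y hy h => by
      rw [← (hΘ x (hZ hx).1).2, h, (hΘ y (hZ hy).1).2]
    have := hκ (G := F ∘ Ψ) (A := A) (hF.comp hΨd hΨm) (fun z hz => hFA _ (hΨm hz)) (Z.image Θ) (by
      intro z hz
      obtain ⟨t, ht, rfl⟩ := Finset.mem_image.1 hz
      refine ⟨(hΘ t (hZ ht).1).1, ?_⟩
      rw [Function.comp_apply, (hΘ t (hZ ht).1).2]
      exact (hZ ht).2) (Θ t₀) (hΘ t₀ ht₀).1
    rw [Function.comp_apply, (hΘ t₀ ht₀).2, Finset.card_image_of_injOn hinj] at this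
    have h1 : Real.exp (-b) ≤ κ ^ Z.card := le_of_mul_le_mul_left (hb.trans this) hA
    have h2 := Real.log_le_log (Real.exp_pos _) h1
    rw [Real.log_exp, Real.log_pow] at h2
    rw [div_mul_eq_mul_div, one_mul, le_div_iff₀ hlog]
    linarith
  have hfin : {t ∈ K | F t = 0}.Finite := by
    by_contra hinf
    obtain ⟨n, hn⟩ := exists_nat_gt (1 / -Real.log κ * b)
    obtain ⟨Z, hZ, hZc⟩ := Set.Infinite.exists_subset_card_eq hinf n
    have := hcard Z hZ
    rw [hZc] at this
    linarith
  refine ⟨hfin, ?_⟩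
  rw [Set.ncard_eq_toFinset_card _ hfin]
  exact hcard _ (by simp)

end Nodal

namespace Nodal
open Set Filter Topology Metric ComplexConjugate

lemma norm_cosh_le (z : ℂ) : ‖Complex.cosh z‖ ≤ Real.cosh z.re := by
  rw [Complex.cosh, Real.cosh_eq, norm_div]
  have := norm_add_le (Complex.exp z) (Complex.exp (-z))
  rw [Complex.norm_exp, Complex.norm_exp, Complex.neg_re] at this
  simpa using! div_le_div_of_nonneg_right this zero_le_two

lemma exists_cosh_eq (w : ℂ) : ∃ ξ : ℂ, Complex.cosh ξ = w ∧ 0 ≤ ξ.re ∧ Real.sinh ξ.re ≤ ‖w‖ := by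
  obtain ⟨η, hη⟩ := Complex.cos_surjective w
  have h1 : ∃ ξ : ℂ, Complex.cosh ξ = w ∧ 0 ≤ ξ.re := by
    have h2 : Complex.cosh (η * Complex.I) = w := by rw [Complex.cosh_mul_I, hη]
    rcases le_total 0 (η * Complex.I).re with h | h
    · exact ⟨_, h2, h⟩
    · exact ⟨-(η * Complex.I), by rw [Complex.cosh_neg, h2], by rw [Complex.neg_re]; linarith⟩
  obtain ⟨ξ, h2, h3⟩ := h1
  refine ⟨ξ, h2, h3, ?_⟩
  rw [← h2, Complex.cosh, norm_div, Real.sinh_eq]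
  have := norm_sub_norm_le (Complex.exp ξ) (-Complex.exp (-ξ))
  rw [norm_neg, sub_neg_eq_add, Complex.norm_exp, Complex.norm_exp, Complex.neg_re] at this
  simpa using! div_le_div_of_nonneg_right this zero_le_two

/-- Propagation of smallness from a segment for holomorphic functions (two constants theorem). -/
lemma exists_propagation {s₀ : ℝ} (h0 : 0 < s₀) (h1 : s₀ ≤ 1) : ∃ α : ℝ, 0 < α ∧ α < 1 ∧
    ∀ {g : ℂ → ℂ} {A b : ℝ}, 0 < A → 0 ≤ b → DifferentiableOn ℂ g (ball 0 3) →
      (∀ z ∈ ball (0 : ℂ) 3, ‖g z‖ ≤ A) → (∀ s ∈ Icc (0 : ℝ) s₀, ‖g s‖ ≤ A * Real.exp (-b)) →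
      ∀ z : ℂ, ‖z‖ ≤ 1 → ‖g z‖ ≤ A * Real.exp (-(α * b)) := by
  set h : ℝ := s₀ / 2 with hh
  have hh0 : 0 < h := by positivity
  set L := arsinh ((6 / 5 + h) / h) with hL
  set L' := arsinh ((1 + h) / h) with hL'
  have hL'0 : 0 < L' := arsinh_pos_iff.2 (by positivity)
  have hLL : L' < L := by
    refine arsinh_lt_arsinh.2 ?_
    gcongr; linarith
  have hL0 : 0 < L := hL'0.trans hLL
  have hα1 : L' / L < 1 := by rwa [div_lt_one hL0]
  have hα0 : 0 < L' / L := by positivity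
  refine ⟨1 - L' / L, by linarith, by linarith, ?_⟩
  intro g A b hA hb hg hgA hgs z hz
  set f : ℂ → ℂ := fun ξ => g (h + h * Complex.cosh ξ) with hf
  have hm : ∀ ξ : ℂ, ξ.re ∈ Icc 0 L → (h + h * Complex.cosh ξ : ℂ) ∈ ball (0 : ℂ) 3 := by
    intro ξ hξ
    rw [mem_ball_zero_iff]
    have e1 : Real.cosh ξ.re ≤ Real.cosh L := by
      rw [Real.cosh_le_cosh, abs_of_nonneg hξ.1, abs_of_pos hL0]; exact hξ.2
    have e2 : Real.cosh L ≤ 1 + Real.sinh L := by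
      have := Real.cosh_sq L
      have hs := Real.sinh_pos_iff.2 hL0
      nlinarith [Real.cosh_pos L]
    have e3 : h * Real.sinh L = 6 / 5 + h := by rw [hL, sinh_arsinh]; field_simp
    calc _ ≤ h + h * ‖Complex.cosh ξ‖ := by
          refine (norm_add_le _ _).trans ?_
          rw [norm_mul, Complex.norm_real, Real.norm_of_nonneg hh0.le]
      _ ≤ h + h * Real.cosh ξ.re := by gcongr; exact norm_cosh_le ξ
      _ < 3 := by nlinarith
  have hfd : DiffContOnCl ℂ f (Complex.HadamardThreeLines.verticalStrip 0 L) := by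
    refine DifferentiableOn.diffContOnCl ?_
    have hcl : closure (Complex.HadamardThreeLines.verticalStrip 0 L) ⊆ Complex.re ⁻¹' Icc 0 L :=
      closure_minimal (preimage_mono Ioo_subset_Icc_self) (isClosed_Icc.preimage Complex.continuous_re)
    exact (hg.comp (t := ball 0 3) (f := fun ξ : ℂ => (h + h * Complex.cosh ξ : ℂ)) (by fun_prop)
      fun ξ hξ => hm ξ (hcl hξ))
  obtain ⟨ξ, hξw, hξ0, hξs⟩ := exists_cosh_eq ((z - h) / h)
  have hξL : ξ.re ≤ L' := by
    rw [← arsinh_sinh ξ.re, hL']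
    refine arsinh_le_arsinh.2 (hξs.trans ?_)
    rw [norm_div, Complex.norm_real, Real.norm_of_nonneg hh0.le]
    gcongr
    refine (norm_sub_le _ _).trans ?_
    rw [Complex.norm_real, Real.norm_of_nonneg hh0.le]
    linarith
  have hfx : f ξ = g z := by
    simp only [hf]
    rw [hξw]
    congr 1
    have : (h : ℂ) ≠ 0 := by exact_mod_cast hh0.ne'
    field_simp; ring
  have key := Complex.HadamardThreeLines.norm_le_interp_of_mem_verticalClosedStrip' (f := f) (z := ξ)
    (a := A * Real.exp (-b)) (b := A) hL0 ⟨hξ0, hξL.trans hLL.le⟩ hfd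
    ⟨A, by rintro _ ⟨ξ, hξ, rfl⟩; exact hgA _ (hm ξ hξ)⟩ ?_ ?_
  · rw [hfx] at key
    refine key.trans ?_
    simp only [sub_zero]
    rw [Real.mul_rpow hA.le (Real.exp_pos _).le, mul_right_comm, ← Real.rpow_add hA, sub_add_cancel,
      Real.rpow_one, ← Real.exp_mul]
    gcongr
    have : ξ.re / L ≤ L' / L := by gcongr
    nlinarith
  · intro ξ hξ
    have hre : ξ.re = 0 := hξ
    have : (h + h * Complex.cosh ξ : ℂ) = ((h + h * Real.cos ξ.im : ℝ) : ℂ) := by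
      have : ξ = (ξ.im : ℂ) * Complex.I := by apply Complex.ext <;> simp [hre]
      rw [this, Complex.cosh_mul_I]; simp
    simp only [hf, this]
    refine hgs _ ⟨?_, ?_⟩ <;> nlinarith [Real.cos_le_one ξ.im, Real.neg_one_le_cos ξ.im]
  · intro ξ hξ
    have hre : ξ.re = L := hξ
    exact hgA _ (hm ξ ⟨by linarith, hre.le⟩)

/-- Harnack inequality for the real part of a holomorphic function. -/
lemma harnack {w : ℂ → ℂ} {c : ℂ} {R : ℝ} (hw : DifferentiableOn ℂ w (ball c R))
    (h0 : ∀ z ∈ ball c R, 0 ≤ (w z).re) {t z : ℂ} (ht : t ∈ ball c (R / 4)) (hz : z ∈ ball c (R / 4)) :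
    (w z).re ≤ 9 * (w t).re := by
  have hR : 0 < R := by linarith [dist_nonneg.trans_lt ht]
  have hsub : ∀ ζ ∈ ball (0 : ℂ) (3 * R / 4), t + ζ ∈ ball c R := by
    intro ζ hζ
    rw [mem_ball_zero_iff] at hζ
    rw [mem_ball, Complex.dist_eq] at ht ⊢
    calc ‖t + ζ - c‖ = ‖(t - c) + ζ‖ := by ring_nf
      _ ≤ _ := norm_add_le _ _
      _ < R := by linarith
  have hzt : ‖z - t‖ < R / 2 := by
    rw [← Complex.dist_eq]
    calc dist z t ≤ dist z c + dist t c := dist_triangle_right _ _ _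
      _ < R / 2 := by rw [mem_ball] at ht hz; linarith
  refine le_of_forall_pos_le_add fun η hη => ?_
  have hmt : 0 ≤ (w t).re := by simpa using h0 _ (hsub 0 (by simpa using hR))
  have := Complex.borelCaratheodory_zero (f := fun ζ => w t - w (t + ζ)) (M := (w t).re + η / 8)
    (R := 3 * R / 4) (z := z - t) (by linarith)
    ((differentiableOn_const _).sub (hw.comp (by fun_prop) hsub)) (fun ζ hζ => by
      have := h0 _ (hsub ζ hζ)
      simp; linarith) (by linarith) (by rw [mem_ball_zero_iff]; linarith) (by simp)
  simp only [add_sub_cancel] at this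
  have h2 : 2 * ((w t).re + η / 8) * ‖z - t‖ / (3 * R / 4 - ‖z - t‖) ≤ 8 * ((w t).re + η / 8) := by
    rw [div_le_iff₀ (by linarith)]
    nlinarith [norm_nonneg (z - t)]
  have h3 := (Complex.abs_re_le_norm (w t - w z)).trans (this.trans h2)
  rw [abs_le, Complex.sub_re] at h3
  linarith [h3.1]

end Nodal

namespace Nodal
open Set Filter Topology Metric ComplexConjugate

/-- A real-analytic function on the line extends holomorphically near each real point. -/
lemma exists_local_complexification {q : ℝ → ℂ} {a : ℝ} (h : AnalyticAt ℝ q a) :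
    ∃ r > 0, ∃ F : ℂ → ℂ, DifferentiableOn ℂ F (ball (a : ℂ) r) ∧
      ∀ s : ℝ, (s : ℂ) ∈ ball (a : ℂ) r → F s = q s := by
  obtain ⟨p, R, hp⟩ := h
  obtain ⟨r, hr0, hrR⟩ := ENNReal.lt_iff_exists_nnreal_btwn.1 hp.r_pos
  have hr0' : 0 < (r : ℝ) := by exact_mod_cast hr0
  have hsum := p.summable_norm_mul_pow (hrR.trans_le hp.r_le)
  refine ⟨r, hr0', fun z => ∑' n, (z - a) ^ n * p.coeff n, ?_, ?_⟩
  · refine Complex.differentiableOn_tsum_of_summable_norm hsum (fun n => by fun_prop) isOpen_ball ?_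
    intro n z hz
    rw [norm_mul, norm_pow, mul_comm, ← p.norm_apply_eq_norm_coef]
    rw [mem_ball, Complex.dist_eq] at hz
    gcongr
  · intro s hs
    have hy : s - a ∈ eball (0 : ℝ) R := by
      rw [mem_ball, Complex.dist_eq, ← Complex.ofReal_sub, Complex.norm_real] at hs
      rw [mem_eball, edist_zero_right]
      refine lt_trans ?_ hrR
      rw [enorm_eq_nnnorm]
      exact_mod_cast hs
    have := (hp.hasSum hy).tsum_eq
    rw [add_sub_cancel] at this
    rw [← this]
    refine tsum_congr fun n => ?_
    rw [p.apply_eq_pow_smul_coeff, Complex.real_smul]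
    push_cast; rfl

/-- An open periodic neighbourhood of the real axis contains a strip. -/
lemma exists_strip_subset {W : Set ℂ} {ℓ : ℝ} (hℓ : 0 < ℓ) (hW : IsOpen W) (hr : ∀ s : ℝ, (s : ℂ) ∈ W)
    (hper : ∀ t, t ∈ W → ∀ k : ℤ, t + (k * ℓ : ℝ) ∈ W) : ∃ ε > 0, strip ε ⊆ W := by
  have hK : IsCompact ((fun s : ℝ => (s : ℂ)) '' Icc 0 ℓ) := isCompact_Icc.image Complex.continuous_ofReal
  obtain ⟨ε, hε, hsub⟩ := hK.exists_thickening_subset_open hW (by rintro _ ⟨s, -, rfl⟩; exact hr s)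
  refine ⟨ε, hε, fun t ht => ?_⟩
  obtain ⟨k, hk, -⟩ := existsUnique_add_zsmul_mem_Ico hℓ t.re 0
  rw [zero_add, zsmul_eq_mul] at hk
  have h1 : t + (k * ℓ : ℝ) ∈ W := by
    refine hsub (mem_thickening_iff.2 ⟨_, ⟨t.re + k * ℓ, Ico_subset_Icc_self hk, rfl⟩, ?_⟩)
    have := mem_ball_re ht
    rw [mem_ball] at this
    push_cast at this ⊢
    rwa [dist_add_right]
  have := hper _ h1 (-k)
  push_cast at this
  rwa [neg_mul, add_neg_cancel_right] at this

/-- A bounded planar domain with real-analytic boundary curve. -/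
structure Bdry (Ω : Set ℂ) (ℓ : ℝ) (q : ℝ → ℂ) : Prop where
  isOpen : IsOpen Ω
  bounded : Bornology.IsBounded Ω
  connected : IsConnected Ω
  ℓ_pos : 0 < ℓ
  analytic : ∀ s, AnalyticAt ℝ q s
  periodic : Function.Periodic q ℓ
  inj : InjOn q (Ico 0 ℓ)
  unit : ∀ s, ‖deriv q s‖ = 1
  range_eq : range q = frontier Ω

namespace Bdry

variable {Ω : Set ℂ} {ℓ : ℝ} {q : ℝ → ℂ} (h : Bdry Ω ℓ q)
include h

lemma continuous : Continuous q := continuous_iff_continuousAt.2 fun s => (h.analytic s).continuousAt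

lemma exists_complexification : ∃ ε > 0, ∃ Q : ℂ → ℂ, DifferentiableOn ℂ Q (strip ε) ∧
    (∀ s : ℝ, Q s = q s) ∧ ∀ t ∈ strip ε, Q (t + ℓ) = Q t := by
  choose r hr F hF hFq using fun a => exists_local_complexification (h.analytic a)
  set K := (fun s : ℝ => (s : ℂ)) '' Icc 0 ℓ with hKdef
  have hK : IsCompact K := isCompact_Icc.image Complex.continuous_ofReal
  obtain ⟨ε, hε, hL⟩ := lebesgue_number_lemma_of_metric (c := fun a : ℝ => ball (a : ℂ) (r a)) hK
    (fun _ => isOpen_ball) (by rintro _ ⟨s, -, rfl⟩; exact mem_iUnion.2 ⟨s, mem_ball_self (hr s)⟩)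
  have hloc : ∀ a : ℝ, ∃ G : ℂ → ℂ, DifferentiableOn ℂ G (ball (a : ℂ) ε) ∧
      ∀ s : ℝ, (s : ℂ) ∈ ball (a : ℂ) ε → G s = q s := by
    intro a
    obtain ⟨k, hk, -⟩ := existsUnique_add_zsmul_mem_Ico h.ℓ_pos a 0
    rw [zero_add, zsmul_eq_mul] at hk
    obtain ⟨b, hb⟩ := hL ((a + k * ℓ : ℝ) : ℂ) ⟨_, Ico_subset_Icc_self hk, rfl⟩
    have hm : MapsTo (fun t : ℂ => t + (k * ℓ : ℝ)) (ball (a : ℂ) ε) (ball (b : ℂ) (r b)) := by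
      intro t ht
      apply hb
      rw [mem_ball] at ht ⊢
      push_cast
      rwa [dist_add_right]
    refine ⟨fun t => F b (t + (k * ℓ : ℝ)), (hF b).comp (by fun_prop) hm, fun s hs => ?_⟩
    have := hm hs
    simp only at this ⊢
    rw [← Complex.ofReal_add] at this ⊢
    rw [hFq b _ this, h.periodic.int_mul k s]
  obtain ⟨Q, hQ, hQq⟩ := exists_strip_extension hloc
  refine ⟨ε, hε, Q, hQ, fun s => hQq s hε, periodic_of_real hε hQ fun s => ?_⟩
  rw [hQq _ hε, hQq _ hε, h.periodic]

end Bdry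

end Nodal

namespace Nodal
open Set Filter Topology Metric ComplexConjugate

lemma periodic_int {ε ℓ : ℝ} {Q : ℂ → ℂ} (h : ∀ t ∈ strip ε, Q (t + ℓ) = Q t) {t : ℂ} (ht : t ∈ strip ε)
    (k : ℤ) : Q (t + (k * ℓ : ℝ)) = Q t := by
  classical
  have hmem : ∀ (t : ℂ) (c : ℝ), t + c ∈ strip ε ↔ t ∈ strip ε := by
    intro t c; simp [strip]
  have hp : Function.Periodic (fun t => if t ∈ strip ε then Q t else 0) (ℓ : ℂ) := by
    intro t
    by_cases ht : t ∈ strip ε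
    · simp only [hmem, ht, if_true, h t ht]
    · simp only [hmem, ht, if_false]
  have := hp.int_mul k t
  rw [← Complex.ofReal_intCast, ← Complex.ofReal_mul] at this
  simpa only [hmem, ht, if_true] using this

lemma add_mem_strip {ε : ℝ} {t : ℂ} (c : ℝ) (ht : t ∈ strip ε) : t + c ∈ strip ε := by
  simpa [strip] using ht

lemma deriv_periodic_int {ε ℓ : ℝ} {Q : ℂ → ℂ} (h : ∀ t ∈ strip ε, Q (t + ℓ) = Q t) {t : ℂ} (ht : t ∈ strip ε)
    (k : ℤ) : deriv Q (t + (k * ℓ : ℝ)) = deriv Q t := by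
  rw [← deriv_comp_add_const]
  refine Filter.EventuallyEq.deriv_eq ?_
  filter_upwards [(isOpen_strip ε).mem_nhds ht] with z hz
  exact periodic_int h hz k

/-- A conformal collar of the boundary of a planar domain. -/
structure Collar (Ω : Set ℂ) (ε ℓ : ℝ) (Q : ℂ → ℂ) : Prop where
  isOpen : IsOpen Ω
  bounded : Bornology.IsBounded Ω
  connected : IsConnected Ω
  ε_pos : 0 < ε
  ε_le_one : ε ≤ 1
  ℓ_pos : 0 < ℓ
  holo : DifferentiableOn ℂ Q (strip ε)
  periodic : ∀ t ∈ strip ε, Q (t + ℓ) = Q t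
  deriv_le : ∀ t ∈ strip ε, ‖deriv Q t‖ ≤ 2
  le_deriv : ∀ t ∈ strip ε, 1 / 2 ≤ ‖deriv Q t‖
  frontier : ∀ x ∈ frontier Ω, ∃ s : ℝ, Q s = x
  real_mem : ∀ s : ℝ, Q s ∈ _root_.frontier Ω
  im_eq_zero : ∀ t ∈ strip ε, Q t ∈ _root_.frontier Ω → t.im = 0

/-- A conformal collar whose upper half is mapped into the domain. -/
structure Geo (Ω : Set ℂ) (ε ℓ : ℝ) (Q : ℂ → ℂ) : Prop extends Collar Ω ε ℓ Q where
  inside : ∀ t ∈ strip ε, 0 < t.im → Q t ∈ Ω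
  exists_chart : ∀ (a r : ℝ), 0 < r → r ≤ ε → ∃ N, IsOpen N ∧ Q a ∈ N ∧
    N ∩ closure Ω ⊆ Q '' (ball (a : ℂ) r ∩ {t | 0 ≤ t.im})

namespace Collar

variable {Ω : Set ℂ} {ε ℓ : ℝ} {Q : ℂ → ℂ} (h : Collar Ω ε ℓ Q)
include h

lemma deriv_ne_zero {t : ℂ} (ht : t ∈ strip ε) : deriv Q t ≠ 0 := by
  intro h0
  have := h.le_deriv t ht
  rw [h0, norm_zero] at this
  norm_num at this

lemma hasStrictDerivAt {t : ℂ} (ht : t ∈ strip ε) : HasStrictDerivAt Q (deriv Q t) t :=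
  ((h.holo.analyticOnNhd (isOpen_strip ε)) t ht).hasStrictDerivAt

lemma image_mem_nhds {t : ℂ} (ht : t ∈ strip ε) {S : Set ℂ} (hS : S ∈ 𝓝 t) : Q '' S ∈ 𝓝 (Q t) := by
  rw [← (h.hasStrictDerivAt ht).map_nhds_eq (h.deriv_ne_zero ht)]
  exact image_mem_map hS

lemma neg : Collar Ω ε ℓ (fun t => Q (-t)) := by
  have hm : ∀ t ∈ strip ε, -t ∈ strip ε := fun t ht => by simpa [strip] using ht
  refine ⟨h.isOpen, h.bounded, h.connected, h.ε_pos, h.ε_le_one, h.ℓ_pos, h.holo.comp (by fun_prop) hm,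
    fun t ht => ?_, fun t ht => ?_, fun t ht => ?_, fun x hx => ?_, fun s => ?_, fun t ht hq => ?_⟩
  · have := periodic_int h.periodic (hm t ht) (-1)
    rw [← this]; push_cast; ring_nf
  · rw [deriv_comp_neg, norm_neg]; exact h.deriv_le _ (hm t ht)
  · rw [deriv_comp_neg, norm_neg]; exact h.le_deriv _ (hm t ht)
  · obtain ⟨s, hs⟩ := h.frontier x hx
    exact ⟨-s, by simpa using hs⟩
  · simpa using h.real_mem (-s)
  · simpa using h.im_eq_zero _ (hm t ht) hq

lemma upper : (∀ t ∈ strip ε, 0 < t.im → Q t ∈ Ω) ∨ (∀ t ∈ strip ε, 0 < t.im → Q t ∉ closure Ω) := by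
  have hc : Convex ℝ (strip ε ∩ {t : ℂ | 0 < t.im}) := (convex_strip ε).inter (convex_halfSpace_im_gt 0)
  have hp : IsPreconnected (Q '' (strip ε ∩ {t : ℂ | 0 < t.im})) :=
    hc.isPreconnected.image _ (h.holo.continuousOn.mono inter_subset_left)
  have hd : Disjoint Ω (closure Ω)ᶜ := disjoint_compl_right.mono_left subset_closure
  have hsub : Q '' (strip ε ∩ {t : ℂ | 0 < t.im}) ⊆ Ω ∪ (closure Ω)ᶜ := by
    rintro _ ⟨t, ⟨ht, ht0⟩, rfl⟩
    by_contra hcon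
    simp only [mem_union, mem_compl_iff, not_or, not_not] at hcon
    have : Q t ∈ _root_.frontier Ω := by rw [h.isOpen.frontier_eq]; exact ⟨hcon.2, hcon.1⟩
    exact (ne_of_gt ht0) (h.im_eq_zero t ht this)
  rcases hp.subset_or_subset h.isOpen isClosed_closure.isOpen_compl hd hsub with h1 | h1
  · exact Or.inl fun t ht h0 => h1 ⟨t, ⟨ht, h0⟩, rfl⟩
  · exact Or.inr fun t ht h0 => h1 ⟨t, ⟨ht, h0⟩, rfl⟩

lemma lower : (∀ t ∈ strip ε, t.im < 0 → Q t ∈ Ω) ∨ (∀ t ∈ strip ε, t.im < 0 → Q t ∉ closure Ω) := by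
  have hm : ∀ t ∈ strip ε, -t ∈ strip ε := fun t ht => by simpa [strip] using ht
  rcases h.neg.upper with h1 | h1
  · exact Or.inl fun t ht h0 => by simpa using h1 (-t) (hm t ht) (by simpa using h0)
  · exact Or.inr fun t ht h0 => by simpa using h1 (-t) (hm t ht) (by simpa using h0)

lemma real_of_im {t : ℂ} (ht : t.im = 0) : Q t ∈ _root_.frontier Ω := by
  have : t = (t.re : ℂ) := Complex.ext (by simp) (by simpa using ht)
  rw [this]; exact h.real_mem _

lemma not_both_inside (h1 : ∀ t ∈ strip ε, 0 < t.im → Q t ∈ Ω) (h2 : ∀ t ∈ strip ε, t.im < 0 → Q t ∈ Ω) :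
    False := by
  have hsub : Q '' strip ε ⊆ closure Ω := by
    rintro _ ⟨t, ht, rfl⟩
    rcases lt_trichotomy t.im 0 with h0 | h0 | h0
    · exact subset_closure (h2 t ht h0)
    · exact frontier_subset_closure (h.real_of_im h0)
    · exact subset_closure (h1 t ht h0)
  have ho : IsOpen (closure Ω) := by
    rw [isOpen_iff_mem_nhds]
    intro x hx
    by_cases hxΩ : x ∈ Ω
    · exact mem_of_superset (h.isOpen.mem_nhds hxΩ) subset_closure
    · obtain ⟨s, rfl⟩ := h.frontier x (by rw [h.isOpen.frontier_eq]; exact ⟨hx, hxΩ⟩)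
      exact mem_of_superset (h.image_mem_nhds (ofReal_mem_strip h.ε_pos s)
        ((isOpen_strip ε).mem_nhds (ofReal_mem_strip h.ε_pos s))) hsub
  have := IsClopen.eq_univ ⟨isClosed_closure, ho⟩ h.connected.nonempty.closure
  have hb := h.bounded.closure
  rw [this] at hb
  exact NormedSpace.unbounded_univ ℝ ℂ hb

lemma not_both_outside (h1 : ∀ t ∈ strip ε, 0 < t.im → Q t ∉ closure Ω)
    (h2 : ∀ t ∈ strip ε, t.im < 0 → Q t ∉ closure Ω) : False := by
  have h0 := ofReal_mem_strip h.ε_pos 0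
  have hn := h.image_mem_nhds h0 ((isOpen_strip ε).mem_nhds h0)
  obtain ⟨_, ⟨t, ht, rfl⟩, hΩ⟩ := mem_closure_iff_nhds.1 (frontier_subset_closure (h.real_mem 0)) _ hn
  rcases lt_trichotomy t.im 0 with h0 | h0 | h0
  · exact h2 t ht h0 (subset_closure hΩ)
  · have := h.real_of_im h0
    rw [h.isOpen.frontier_eq] at this
    exact this.2 hΩ
  · exact h1 t ht h0 (subset_closure hΩ)

lemma geo (h1 : ∀ t ∈ strip ε, 0 < t.im → Q t ∈ Ω) : Geo Ω ε ℓ Q := by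
  have h2 : ∀ t ∈ strip ε, t.im < 0 → Q t ∉ closure Ω := by
    rcases h.lower with h2 | h2
    · exact (h.not_both_inside h1 h2).elim
    · exact h2
  refine ⟨h, h1, fun a r hr hre => ⟨interior (Q '' ball (a : ℂ) r), isOpen_interior, ?_, ?_⟩⟩
  · rw [mem_interior_iff_mem_nhds]
    exact h.image_mem_nhds (ofReal_mem_strip h.ε_pos a) (ball_mem_nhds _ hr)
  · rintro x ⟨hx, hxc⟩
    obtain ⟨t, ht, rfl⟩ := interior_subset hx
    refine ⟨t, ⟨ht, ?_⟩, rfl⟩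
    by_contra hneg
    exact h2 t (ball_subset_strip a hre ht) (not_le.1 hneg) hxc

lemma exists_geo : Geo Ω ε ℓ Q ∨ Geo Ω ε ℓ (fun t => Q (-t)) := by
  rcases h.upper with h1 | h1
  · exact Or.inl (h.geo h1)
  · right
    rcases h.lower with h2 | h2
    · refine h.neg.geo fun t ht h0 => h2 _ (by simpa [strip] using ht) (by simpa using h0)
    · exact (h.not_both_outside h1 h2).elim

end Collar

namespace Bdry

variable {Ω : Set ℂ} {ℓ : ℝ} {q : ℝ → ℂ} (h : Bdry Ω ℓ q)
include h

lemma exists_reduce (s a : ℝ) : ∃ k : ℤ, s + k * ℓ ∈ Ico (a - ℓ / 2) (a + ℓ / 2) := by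
  obtain ⟨k, hk, -⟩ := existsUnique_add_zsmul_mem_Ico h.ℓ_pos s (a - ℓ / 2)
  rw [zsmul_eq_mul] at hk
  exact ⟨k, by rwa [show a + ℓ / 2 = a - ℓ / 2 + ℓ by ring]⟩

lemma eq_of_abs_lt {x y : ℝ} (hxy : q x = q y) (hlt : |x - y| < ℓ) : x = y := by
  obtain ⟨k, hk, -⟩ := existsUnique_add_zsmul_mem_Ico h.ℓ_pos x 0
  obtain ⟨m, hm, -⟩ := existsUnique_add_zsmul_mem_Ico h.ℓ_pos y 0
  rw [zero_add, zsmul_eq_mul] at hk hm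
  have := h.inj hk hm (by rw [h.periodic.int_mul k, h.periodic.int_mul m, hxy])
  have h1 : x - y = ((m - k : ℤ) : ℝ) * ℓ := by push_cast; linarith
  rw [h1, abs_mul, abs_of_pos h.ℓ_pos] at hlt
  have h2 : |((m - k : ℤ) : ℝ)| < 1 := by
    by_contra hcon
    nlinarith [h.ℓ_pos]
  have h3 : |m - k| < 1 := by exact_mod_cast h2
  rw [Int.abs_lt_one_iff] at h3
  rw [h3] at h1
  simp at h1; linarith

lemma exists_collar : ∃ ε Q, Collar Ω ε ℓ Q ∧ ∀ s : ℝ, Q s = q s := by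
  obtain ⟨ε₀, hε₀, Q, hQ, hQq, hper⟩ := h.exists_complexification
  have hder : ∀ s : ℝ, deriv Q s = deriv q s := by
    intro s
    have h1 := ((hQ.differentiableAt ((isOpen_strip ε₀).mem_nhds (ofReal_mem_strip hε₀ s))).hasDerivAt).comp_ofReal
    rw [show (fun y : ℝ => Q y) = q from funext hQq] at h1
    exact h1.deriv.symm
  have hstrict : ∀ s : ℝ, HasStrictDerivAt Q (deriv Q s) s := fun s =>
    ((hQ.analyticOnNhd (isOpen_strip ε₀)) s (ofReal_mem_strip hε₀ s)).hasStrictDerivAt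
  have hne : ∀ s : ℝ, deriv Q s ≠ 0 := by
    intro s h0
    have := h.unit s
    rw [← hder, h0] at this
    simp at this
  -- non-degeneracy
  have hdc : ContinuousOn (deriv Q) (strip ε₀) := (hQ.deriv (isOpen_strip ε₀)).continuousOn
  have hW1o : IsOpen (strip ε₀ ∩ deriv Q ⁻¹' {z | 1 / 2 < ‖z‖ ∧ ‖z‖ < 2}) := by
    refine hdc.isOpen_inter_preimage (isOpen_strip ε₀) ?_
    exact (isOpen_lt continuous_const continuous_norm).inter (isOpen_lt continuous_norm continuous_const)
  obtain ⟨ε₁, hε₁, hsub₁⟩ := exists_strip_subset h.ℓ_pos hW1o (fun s => ⟨ofReal_mem_strip hε₀ s, by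
    rw [mem_preimage, hder]
    simp only [mem_ofPred_eq, h.unit]
    norm_num⟩) (fun t ht k => ⟨add_mem_strip _ ht.1, by
    rw [mem_preimage, deriv_periodic_int hper ht.1 k]; exact ht.2⟩)
  -- only real points reach the frontier
  set S : Set ℂ := {t | t ∈ strip ε₀ ∧ (Q t ∈ _root_.frontier Ω → t.im = 0)} with hS
  have hloc : ∀ a : ℝ, (a : ℂ) ∈ interior S := by
    intro a
    have hinj : ∀ᶠ t in 𝓝 (a : ℂ), (hstrict a).localInverse Q (deriv Q a) a (hne a) (Q t) = t :=
      ((hstrict a).hasStrictFDerivAt_equiv (hne a)).eventually_left_inverse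
    obtain ⟨ρ, hρ, hball⟩ := Metric.eventually_nhds_iff_ball.1 hinj
    have hKc : IsCompact (q '' (Icc (a - ℓ / 2) (a + ℓ / 2) ∩ {s | ρ ≤ |s - a|})) := by
      refine (isCompact_Icc.inter_right ?_).image h.continuous
      exact isClosed_le continuous_const (by fun_prop)
    have hnot : Q a ∉ q '' (Icc (a - ℓ / 2) (a + ℓ / 2) ∩ {s | ρ ≤ |s - a|}) := by
      rintro ⟨s, ⟨hs, hs'⟩, hsq⟩
      rw [hQq] at hsq
      have hab : |s - a| < ℓ := by
        rw [abs_lt]; constructor <;> linarith [hs.1, hs.2, h.ℓ_pos]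
      have := h.eq_of_abs_lt hsq hab
      simp only [mem_ofPred_eq, this, sub_self, abs_zero] at hs'
      linarith
    have hev : ∀ᶠ t in 𝓝 (a : ℂ), Q t ∉ q '' (Icc (a - ℓ / 2) (a + ℓ / 2) ∩ {s | ρ ≤ |s - a|}) :=
      (hstrict a).hasDerivAt.continuousAt.eventually (hKc.isClosed.isOpen_compl.mem_nhds hnot)
    rw [mem_interior_iff_mem_nhds]
    filter_upwards [hev, ball_mem_nhds (a : ℂ) hρ, (isOpen_strip ε₀).mem_nhds (ofReal_mem_strip hε₀ a)]
      with t ht1 ht2 ht3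
    refine ⟨ht3, fun hf => ?_⟩
    rw [← h.range_eq] at hf
    obtain ⟨s, hs⟩ := hf
    obtain ⟨k, hk⟩ := h.exists_reduce s a
    have hs' : q (s + k * ℓ) = Q t := by rw [h.periodic.int_mul k, hs]
    have hlt : |s + k * ℓ - a| < ρ := by
      by_contra hcon
      exact ht1 ⟨_, ⟨Ico_subset_Icc_self hk, not_lt.1 hcon⟩, hs'⟩
    have hmem : ((s + k * ℓ : ℝ) : ℂ) ∈ ball (a : ℂ) ρ := by
      rw [mem_ball, Complex.dist_eq, ← Complex.ofReal_sub, Complex.norm_real]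
      exact hlt
    have e1 := hball _ hmem
    rw [hQq, hs', hball t ht2] at e1
    rw [e1, Complex.ofReal_im]
  obtain ⟨ε₂, hε₂, hsub₂⟩ := exists_strip_subset h.ℓ_pos (isOpen_interior (s := S)) hloc (fun t ht k => by
    have hSS : S ⊆ (Homeomorph.addRight ((k * ℓ : ℝ) : ℂ)) ⁻¹' S := by
      rintro z ⟨hz, hz'⟩
      refine ⟨add_mem_strip _ hz, fun hf => ?_⟩
      simp only [Homeomorph.coe_addRight] at hf ⊢
      rw [periodic_int hper hz k] at hf
      simpa using hz' hf
    have := interior_mono hSS ht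
    rw [← Homeomorph.preimage_interior] at this
    exact this)
  refine ⟨min (min ε₁ ε₂) 1, Q, ⟨h.isOpen, h.bounded, h.connected, lt_min (lt_min hε₁ hε₂) one_pos,
    min_le_right _ _, h.ℓ_pos, ?_, ?_, ?_, ?_, ?_, ?_, ?_⟩, hQq⟩
  · exact hQ.mono fun t ht => (hsub₁ (strip_mono ((min_le_left _ _).trans (min_le_left _ _)) ht)).1
  · exact fun t ht => hper t (hsub₁ (strip_mono ((min_le_left _ _).trans (min_le_left _ _)) ht)).1
  · exact fun t ht => (hsub₁ (strip_mono ((min_le_left _ _).trans (min_le_left _ _)) ht)).2.2.le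
  · exact fun t ht => (hsub₁ (strip_mono ((min_le_left _ _).trans (min_le_left _ _)) ht)).2.1.le
  · intro x hx
    rw [← h.range_eq] at hx
    obtain ⟨s, hs⟩ := hx
    exact ⟨s, by rw [hQq, hs]⟩
  · intro s
    rw [hQq, ← h.range_eq]
    exact mem_range_self s
  · exact fun t ht => (interior_subset (hsub₂ (strip_mono ((min_le_left _ _).trans (min_le_right _ _)) ht))).2

lemma exists_geo : ∃ ε Q, Geo Ω ε ℓ Q ∧ ((∀ s : ℝ, Q s = q s) ∨ ∀ s : ℝ, Q s = q (-s)) := by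
  obtain ⟨ε, Q, hc, hq⟩ := h.exists_collar
  rcases hc.exists_geo with hg | hg
  · exact ⟨ε, Q, hg, Or.inl hq⟩
  · exact ⟨ε, _, hg, Or.inr fun s => by simpa using hq (-s)⟩

end Bdry

end Nodal

namespace Nodal
open Set Filter Topology Metric ComplexConjugate

/-- The integrand in `rhs`. -/
def rhsKer (Q : ℂ → ℂ) (μ : ℝ) (t τ z : ℂ) : ℂ :=
  bess 1 (μ * (Q z - Q t) * (conj (Q (conj z)) - conj (Q (conj τ)))) *
    (μ * ((t - τ) * deriv Q z * (conj (Q (conj z)) - conj (Q (conj τ))) -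
      (Q z - Q t) * ((t - τ) * conj (deriv Q (conj z)))))

/-- The representation of the polarization of a Neumann solution in terms of its boundary values. -/
def rhs (Q F : ℂ → ℂ) (μ : ℝ) (t τ : ℂ) : ℂ :=
  (F t + F τ) / 2 + (1 / 2) * ∫ x : ℝ in (0 : ℝ)..1, rhsKer Q μ t τ (τ + x * (t - τ)) * F (τ + x * (t - τ))

lemma conj_mem_strip {ε : ℝ} {t : ℂ} (ht : t ∈ strip ε) : conj t ∈ strip ε := by
  simpa [strip] using ht

lemma conj_preimage_strip (ε : ℝ) : conj ⁻¹' (strip ε) = strip ε := by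
  ext t; simp [strip]

lemma segment_mem_strip {ε : ℝ} {t τ : ℂ} (ht : t ∈ strip ε) (hτ : τ ∈ strip ε) {x : ℝ} (hx : x ∈ Icc (0 : ℝ) 1) :
    τ + x * (t - τ) ∈ strip ε := by
  have := (convex_strip ε).add_smul_sub_mem hτ ht hx
  simpa using this

section

variable {ε : ℝ} {Q F : ℂ → ℂ} (hQ : DifferentiableOn ℂ Q (strip ε))
include hQ

lemma differentiableOn_bar : DifferentiableOn ℂ (fun z => conj (Q (conj z))) (strip ε) := by
  have := differentiableOn_conj_conj (isOpen_strip ε) hQ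
  rwa [conj_preimage_strip] at this

lemma differentiableOn_rhs (hF : DifferentiableOn ℂ F (strip ε)) (μ : ℝ) {U : Set ℂ} (hU : IsOpen U)
    {l m : ℂ → ℂ} (hl : DifferentiableOn ℂ l U) (hm : DifferentiableOn ℂ m U)
    (hlU : MapsTo l U (strip ε)) (hmU : MapsTo m U (strip ε)) :
    DifferentiableOn ℂ (fun s => rhs Q F μ (l s) (m s)) U := by
  have hQ' := hQ.deriv (isOpen_strip ε)
  have hQb := differentiableOn_bar hQ
  have hQb' := differentiableOn_bar hQ'
  have hseg : MapsTo (fun z : ℂ × ℝ => m z.1 + z.2 * (l z.1 - m z.1)) (U ×ˢ Icc (0 : ℝ) 1) (strip ε) :=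
    fun z hz => segment_mem_strip (hlU hz.1) (hmU hz.1) hz.2
  have hseg' : ∀ x ∈ Icc (0 : ℝ) 1, MapsTo (fun z : ℂ => m z + x * (l z - m z)) U (strip ε) :=
    fun x hx z hz => segment_mem_strip (hlU hz) (hmU hz) hx
  have cl : ContinuousOn (fun z : ℂ × ℝ => l z.1) (U ×ˢ Icc (0 : ℝ) 1) :=
    hl.continuousOn.comp continuousOn_fst fun z hz => hz.1
  have cm : ContinuousOn (fun z : ℂ × ℝ => m z.1) (U ×ˢ Icc (0 : ℝ) 1) :=
    hm.continuousOn.comp continuousOn_fst fun z hz => hz.1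
  have cseg : ContinuousOn (fun z : ℂ × ℝ => m z.1 + z.2 * (l z.1 - m z.1)) (U ×ˢ Icc (0 : ℝ) 1) :=
    cm.add (ContinuousOn.mul (Continuous.continuousOn (by fun_prop)) (cl.sub cm))
  have c1 := hQ.continuousOn.comp cseg hseg
  have c2 := hQ'.continuousOn.comp cseg hseg
  have c3 := hQb.continuousOn.comp cseg hseg
  have c4 := hQb'.continuousOn.comp cseg hseg
  have c5 := hF.continuousOn.comp cseg hseg
  have c6 := hQ.continuousOn.comp cl fun z hz => hlU hz.1
  have c7 := hQb.continuousOn.comp cm fun z hz => hmU hz.1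
  have d5 : DifferentiableOn ℂ (fun z => F (l z)) U := hF.comp hl hlU
  have d6 : DifferentiableOn ℂ (fun z => F (m z)) U := hF.comp hm hmU
  have d7 : DifferentiableOn ℂ (fun z => Q (l z)) U := hQ.comp hl hlU
  have d8 : DifferentiableOn ℂ (fun z => conj (Q (conj (m z)))) U := hQb.comp hm hmU
  unfold rhs rhsKer
  refine ((d5.add d6).div_const 2).add ((differentiableOn_integral_param zero_le_one hU ?_ ?_).const_mul _)
  · exact ((((continuous_bess 1).comp_continuousOn ((continuousOn_const.mul (c1.sub c6)).mul (c3.sub c7))).mul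
      (continuousOn_const.mul ((((cl.sub cm).mul c2).mul (c3.sub c7)).sub
      ((c1.sub c6).mul ((cl.sub cm).mul c4)))))).mul c5
  · intro x hx
    have dseg : DifferentiableOn ℂ (fun z : ℂ => m z + x * (l z - m z)) U := by fun_prop
    have d1 := hQ.comp dseg (hseg' x hx)
    have d2 := hQ'.comp dseg (hseg' x hx)
    have d3 := hQb.comp dseg (hseg' x hx)
    have d4 := hQb'.comp dseg (hseg' x hx)
    have d5 := hF.comp dseg (hseg' x hx)
    exact ((((differentiable_bess 1).comp_differentiableOn (((differentiableOn_const _).mul (d1.sub d7)).mul (d3.sub d8))).mul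
      ((differentiableOn_const _).mul ((((hl.sub hm).mul d2).mul (d3.sub d8)).sub
      ((d1.sub d7).mul ((hl.sub hm).mul d4)))))).mul d5

lemma norm_sub_le_strip (hQ' : ∀ t ∈ strip ε, ‖deriv Q t‖ ≤ 2) {z w : ℂ} (hz : z ∈ strip ε) (hw : w ∈ strip ε) :
    ‖Q z - Q w‖ ≤ 2 * ‖z - w‖ :=
  (convex_strip ε).norm_image_sub_le_of_norm_deriv_le
    (fun _ hx => hQ.differentiableAt ((isOpen_strip ε).mem_nhds hx)) hQ' hw hz

lemma norm_rhsKer_le (hQ' : ∀ t ∈ strip ε, ‖deriv Q t‖ ≤ 2) {μ : ℝ} (hμ : 0 ≤ μ) {t τ : ℂ} {d : ℝ}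
    (ht : t ∈ strip ε) (hτ : τ ∈ strip ε) (hd : ‖t - τ‖ ≤ d) {x : ℝ} (hx : x ∈ Icc (0 : ℝ) 1) :
    ‖rhsKer Q μ t τ (τ + x * (t - τ))‖ ≤ 8 * μ * d ^ 2 * Real.exp (4 * √μ * d) := by
  set z := τ + x * (t - τ) with hz
  have hzs : z ∈ strip ε := segment_mem_strip ht hτ hx
  have hd0 : 0 ≤ d := (norm_nonneg _).trans hd
  have e1 : ‖z - t‖ ≤ d := by
    have : z - t = ((x - 1 : ℝ) : ℂ) * (t - τ) := by rw [hz]; push_cast; ring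
    rw [this, norm_mul, Complex.norm_real, Real.norm_eq_abs, abs_of_nonpos (by linarith [hx.2])]
    nlinarith [norm_nonneg (t - τ), hx.1, hx.2]
  have e2 : ‖z - τ‖ ≤ d := by
    have : z - τ = (x : ℂ) * (t - τ) := by rw [hz]; ring
    rw [this, norm_mul, Complex.norm_real, Real.norm_of_nonneg hx.1]
    nlinarith [norm_nonneg (t - τ), hx.1, hx.2]
  have h1 : ‖Q z - Q t‖ ≤ 2 * d := (norm_sub_le_strip hQ hQ' hzs ht).trans (by linarith)
  have h2 : ‖conj (Q (conj z)) - conj (Q (conj τ))‖ ≤ 2 * d := by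
    rw [← map_sub, Complex.norm_conj]
    refine (norm_sub_le_strip hQ hQ' (conj_mem_strip hzs) (conj_mem_strip hτ)).trans ?_
    rw [← map_sub, Complex.norm_conj]
    linarith
  have h3 := hQ' z hzs
  have h4 : ‖conj (deriv Q (conj z))‖ ≤ 2 := by
    rw [Complex.norm_conj]; exact hQ' _ (conj_mem_strip hzs)
  have hb : ‖bess 1 (μ * (Q z - Q t) * (conj (Q (conj z)) - conj (Q (conj τ))))‖ ≤ Real.exp (4 * √μ * d) := by
    refine (norm_bess_le _ _).trans (Real.exp_le_exp.2 ?_)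
    have : ‖(μ : ℂ) * (Q z - Q t) * (conj (Q (conj z)) - conj (Q (conj τ)))‖ ≤ (√μ * (2 * d)) ^ 2 := by
      rw [norm_mul, norm_mul, Complex.norm_real, Real.norm_of_nonneg hμ, mul_pow, Real.sq_sqrt hμ, sq, ← mul_assoc]
      gcongr
    calc 2 * √‖(μ : ℂ) * (Q z - Q t) * (conj (Q (conj z)) - conj (Q (conj τ)))‖
        ≤ 2 * √((√μ * (2 * d)) ^ 2) := by gcongr
      _ = 2 * (√μ * (2 * d)) := by rw [Real.sqrt_sq (by positivity)]
      _ = 4 * √μ * d := by ring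
  have hB : ‖(μ : ℂ) * ((t - τ) * deriv Q z * (conj (Q (conj z)) - conj (Q (conj τ))) -
      (Q z - Q t) * ((t - τ) * conj (deriv Q (conj z))))‖ ≤ μ * (d * 2 * (2 * d) + 2 * d * (d * 2)) := by
    rw [norm_mul, Complex.norm_real, Real.norm_of_nonneg hμ]
    refine mul_le_mul_of_nonneg_left ((norm_sub_le _ _).trans ?_) hμ
    rw [norm_mul, norm_mul, norm_mul, norm_mul]
    gcongr
  rw [rhsKer, norm_mul]
  calc _ ≤ Real.exp (4 * √μ * d) * (μ * (d * 2 * (2 * d) + 2 * d * (d * 2))) := by gcongr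
    _ = 8 * μ * d ^ 2 * Real.exp (4 * √μ * d) := by ring

lemma norm_rhs_sub_le (hQ' : ∀ t ∈ strip ε, ‖deriv Q t‖ ≤ 2) {μ : ℝ} (hμ : 0 ≤ μ) {t τ : ℂ} {d A : ℝ}
    (ht : t ∈ strip ε) (hτ : τ ∈ strip ε) (hd : ‖t - τ‖ ≤ d) (hF : ∀ t ∈ strip ε, ‖F t‖ ≤ A) :
    ‖rhs Q F μ t τ - (F t + F τ) / 2‖ ≤ 4 * μ * d ^ 2 * Real.exp (4 * √μ * d) * A := by
  rw [rhs, add_sub_cancel_left, norm_mul]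
  have : ‖∫ x : ℝ in (0 : ℝ)..1, rhsKer Q μ t τ (τ + x * (t - τ)) * F (τ + x * (t - τ))‖ ≤
      8 * μ * d ^ 2 * Real.exp (4 * √μ * d) * A * |1 - 0| := by
    apply intervalIntegral.norm_integral_le_of_norm_le_const
    intro x hx
    rw [uIoc_of_le zero_le_one] at hx
    have hx' := Ioc_subset_Icc_self hx
    rw [norm_mul]
    exact mul_le_mul (norm_rhsKer_le hQ hQ' hμ ht hτ hd hx') (hF _ (segment_mem_strip ht hτ hx')) (norm_nonneg _)
      (by positivity)
  norm_num at this ⊢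
  linarith

end

/-- The polarization is determined by the boundary values. -/
lemma PolData.eqOn_rhs {ε δ μ : ℝ} {Q V p F : ℂ → ℂ} (hε : 0 < ε) (hδ : 0 < δ)
    (h : PolData (strip ε ∩ {z | -δ < z.im}) Q V p μ) (hQ : DifferentiableOn ℂ Q (strip ε))
    {u pr : ℝ → ℂ}
    (hR : RData (fun s => Q s) (fun s => deriv Q s) (fun s => conj (Q s)) (fun s => conj (deriv Q s)) u pr)
    (hu : ∀ s : ℝ, V s = u s) (hp : ∀ s : ℝ, p s = pr s)
    (hF : DifferentiableOn ℂ F (strip ε)) (hFu : ∀ s : ℝ, F s = u s) {t τ : ℂ}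
    (ht : t ∈ strip ε ∩ {z | -δ < z.im}) (hτ : conj τ ∈ strip ε ∩ {z | -δ < z.im}) :
    pol Q V p μ t τ = rhs Q F μ t τ := by
  set K := strip ε ∩ {z : ℂ | -δ < z.im} with hK
  have hKr : ∀ s : ℝ, (s : ℂ) ∈ K := fun s => ⟨ofReal_mem_strip hε s, by simpa using hδ⟩
  have hKc : IsOpen (conj ⁻¹' K) := h.isOpen.preimage Complex.continuous_conj
  have hcs : conj ⁻¹' K ⊆ strip ε := fun z hz => by simpa using conj_mem_strip hz.1
  have hrr : ∀ a b : ℝ, pol Q V p μ b a = rhs Q F μ b a := by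
    intro a b
    have hR' := hR.comp_affine a (b - a)
    have key := hR'.rW_eq_half (μ := (μ : ℂ)) 1 0
    have e1 : pol Q V p μ b a = rW (fun x => Q ((a + (b - a) * x : ℝ) : ℂ))
        (fun x => conj (Q ((a + (b - a) * x : ℝ) : ℂ)))
        (fun x => ((b - a : ℝ) : ℂ) * conj (deriv Q ((a + (b - a) * x : ℝ) : ℂ))) (fun x => u (a + (b - a) * x))
        (fun x => ((b - a : ℝ) : ℂ) * pr (a + (b - a) * x)) μ 1 0 := by
      simp only [pol, rW, Complex.conj_ofReal, rInt_eq, hu, mul_zero, add_zero]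
      congr 1
      refine intervalIntegral.integral_congr fun s _ => ?_
      have hl : (AffineMap.lineMap (a : ℂ) (b : ℂ) s : ℂ) = ((a + (b - a) * s : ℝ) : ℂ) := by
        simp [AffineMap.lineMap_apply]; ring
      simp only [hl, rHol, rBar, rArg, hu, hp, mul_one, add_sub_cancel]
      rw [← Complex.ofReal_sub, Complex.conj_ofReal]
      ring
    rw [e1, key, rhs]
    simp only [mul_one, add_sub_cancel, mul_zero, add_zero, hFu]
    congr 2
    refine intervalIntegral.integral_congr fun s _ => ?_
    have hl : (a : ℂ) + s * (b - a) = ((a + (b - a) * s : ℝ) : ℂ) := by push_cast; ring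
    simp only [hl, rhsKer, Complex.conj_ofReal, hFu]
    push_cast
    rfl
  have h1 : ∀ a : ℝ, ∀ t ∈ K, pol Q V p μ t a = rhs Q F μ t a := by
    intro a
    refine eqOn_of_real h.isOpen h.convex.isPreconnected ?_ ?_ (hKr 0) fun s _ => hrr a s
    · exact fun t ht => (h.hasDerivAt_pol_left ht (by simpa using hKr a)).differentiableWithinAt
    · exact differentiableOn_rhs hQ hF μ h.isOpen differentiableOn_id (differentiableOn_const _)
        (fun t ht => ht.1) (fun t _ => ofReal_mem_strip hε a)
  refine eqOn_of_real (D := conj ⁻¹' K) (f := fun τ => pol Q V p μ t τ) (g := fun τ => rhs Q F μ t τ) hKc ?_ ?_ ?_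
    (x₀ := 0) (by simpa using hKr 0) (fun s _ => h1 s t ht) hτ
  · exact (h.convex.linear_preimage Complex.conjLIE.toLinearMap).isPreconnected
  · exact fun τ hτ => (h.hasDerivAt_pol_right ht hτ).differentiableWithinAt
  · exact differentiableOn_rhs hQ hF μ hKc (differentiableOn_const _) differentiableOn_id
        (fun _ _ => ht.1) hcs

end Nodal

namespace Nodal
open Set Filter Topology Metric ComplexConjugate

/-- A Neumann eigenfunction in complex notation: `g = ∂Φ`, and `M` is the maximum of `|Φ|` and
`|∂Φ|` over the closed domain. -/
structure Eig (Ω : Set ℂ) (Q : ℂ → ℂ) (lam M : ℝ) (Φ : ℂ → ℝ) (g : ℂ → ℂ) : Prop where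
  lam_pos : 0 < lam
  M_pos : 0 < M
  exists_nhd : ∃ U, IsOpen U ∧ closure Ω ⊆ U ∧ ∀ z ∈ U, HasWD (fun z => (Φ z : ℂ)) (g z) (conj (g z)) z ∧
    ∃ m, HasWD g m (-((lam ^ 2 / 4 : ℝ) : ℂ) * Φ z) z
  neumann : ∀ s : ℝ, (g (Q s) * deriv Q s).im = 0
  abs_le : ∀ x ∈ closure Ω, |Φ x| ≤ M
  norm_le : ∀ x ∈ closure Ω, ‖g x‖ ≤ M
  attained : ∃ x ∈ closure Ω, |Φ x| = M ∨ ‖g x‖ = M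

lemma exp_bound {lam : ℝ} (h : 0 ≤ lam) :
    12 * (1 + Real.exp (2 * lam) * (1 + lam ^ 2)) * Real.exp (2 * lam) ≤ Real.exp (5 * (1 + lam)) := by
  have h1 := Real.quadratic_le_exp_of_nonneg h
  have h2 : 1 + lam ^ 2 ≤ 2 * Real.exp lam := by nlinarith
  have e1 : Real.exp (2 * lam) = Real.exp lam ^ 2 := by rw [← Real.exp_nat_mul]; norm_num
  have e2 : Real.exp (5 * (1 + lam)) = Real.exp 1 ^ 5 * Real.exp lam ^ 5 := by
    rw [← Real.exp_nat_mul, ← Real.exp_nat_mul, ← Real.exp_add]; congr 1; push_cast; ring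
  have h3 : (36 : ℝ) ≤ Real.exp 1 ^ 5 := by
    have : (2.1 : ℝ) ≤ Real.exp 1 := by have := Real.exp_one_gt_d9; linarith
    calc (36 : ℝ) ≤ 2.1 ^ 5 := by norm_num
      _ ≤ _ := by gcongr
  have h4 : 1 ≤ Real.exp lam := Real.one_le_exp h
  rw [e1, e2]
  set y := Real.exp lam
  calc 12 * (1 + y ^ 2 * (1 + lam ^ 2)) * y ^ 2 ≤ 12 * (y ^ 3 + y ^ 2 * (2 * y)) * y ^ 2 := by
        gcongr
        exact one_le_pow₀ h4
    _ = 36 * y ^ 5 := by ring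
    _ ≤ _ := by gcongr

namespace Geo

variable {Ω : Set ℂ} {ε ℓ : ℝ} {Q : ℂ → ℂ} (h : Geo Ω ε ℓ Q)
include h

lemma mem_closure {t : ℂ} (ht : t ∈ strip ε) (h0 : 0 ≤ t.im) : Q t ∈ closure Ω := by
  rcases h0.eq_or_lt with h0 | h0
  · exact frontier_subset_closure (h.real_of_im h0.symm)
  · exact subset_closure (h.inside t ht h0)

lemma hasDerivAt {t : ℂ} (ht : t ∈ strip ε) : HasDerivAt Q (deriv Q t) t :=
  (h.hasStrictDerivAt ht).hasDerivAt

end Geo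

namespace Eig

variable {Ω : Set ℂ} {ε ℓ lam M : ℝ} {Q g : ℂ → ℂ} {Φ : ℂ → ℝ} (e : Eig Ω Q lam M Φ g)
include e

lemma exists_polData (h : Geo Ω ε ℓ Q) : ∃ δ > 0,
    PolData (strip ε ∩ {z | -δ < z.im}) Q (fun ζ => (Φ (Q ζ) : ℂ)) (fun ζ => g (Q ζ) * deriv Q ζ) (lam ^ 2 / 4) ∧
    ∀ ζ ∈ strip ε ∩ {z | -δ < z.im}, ‖(Φ (Q ζ) : ℂ)‖ ≤ 4 * M ∧ ‖g (Q ζ) * deriv Q ζ‖ ≤ 4 * M := by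
  obtain ⟨U, hU, hΩU, hPDE⟩ := e.exists_nhd
  have hM := e.M_pos
  have c1 : ContinuousOn (fun z => (Φ z : ℂ)) U := fun z hz => (hPDE z hz).1.continuousAt.continuousWithinAt
  have c2 : ContinuousOn g U := fun z hz => by
    obtain ⟨m, hm⟩ := (hPDE z hz).2
    exact hm.continuousAt.continuousWithinAt
  set U' := (U ∩ (fun z => (Φ z : ℂ)) ⁻¹' ball 0 (2 * M)) ∩ (U ∩ g ⁻¹' ball 0 (2 * M)) with hU'
  have hU'o : IsOpen U' := (c1.isOpen_inter_preimage hU isOpen_ball).inter (c2.isOpen_inter_preimage hU isOpen_ball)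
  have hΩU' : closure Ω ⊆ U' := by
    intro x hx
    refine ⟨⟨hΩU hx, ?_⟩, hΩU hx, ?_⟩
    · rw [mem_preimage, mem_ball_zero_iff, Complex.norm_real]
      have := e.abs_le x hx
      rw [Real.norm_eq_abs]; linarith
    · rw [mem_preimage, mem_ball_zero_iff]
      have := e.norm_le x hx
      linarith
  have hWo : IsOpen (strip ε ∩ Q ⁻¹' U') := h.holo.continuousOn.isOpen_inter_preimage (isOpen_strip ε) hU'o
  obtain ⟨δ, hδ, hsub⟩ := exists_strip_subset h.ℓ_pos hWo
    (fun s => ⟨ofReal_mem_strip h.ε_pos s, hΩU' (frontier_subset_closure (h.real_mem s))⟩)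
    (fun t ht k => ⟨add_mem_strip _ ht.1, by rw [mem_preimage, periodic_int h.periodic ht.1 k]; exact ht.2⟩)
  have hK : ∀ ζ ∈ strip ε ∩ {z | -δ < z.im}, Q ζ ∈ U' := by
    rintro ζ ⟨h1, h2⟩
    rcases le_or_gt 0 ζ.im with h0 | h0
    · exact hΩU' (h.mem_closure h1 h0)
    · refine (hsub (show |ζ.im| < δ from ?_)).2
      rw [abs_of_neg h0]
      simp only [mem_ofPred_eq] at h2
      linarith
  refine ⟨δ, hδ, ⟨?_, ?_, by positivity, h.holo.mono inter_subset_left, ?_, ?_⟩, ?_⟩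
  · exact (isOpen_strip ε).inter (isOpen_lt continuous_const Complex.continuous_im)
  · exact (convex_strip ε).inter (convex_halfSpace_im_gt (-δ))
  · intro ζ hζ
    refine ((hPDE _ (hK ζ hζ).1.1).1.comp_inner (h.hasDerivAt hζ.1)).congr_deriv rfl ?_
    rw [map_mul]
  · intro ζ hζ
    obtain ⟨m, hm⟩ := (hPDE _ (hK ζ hζ).1.1).2
    have hQ'' : HasDerivAt (deriv Q) (deriv (deriv Q) ζ) ζ :=
      ((h.holo.deriv (isOpen_strip ε)).differentiableAt ((isOpen_strip ε).mem_nhds hζ.1)).hasDerivAt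
    exact ⟨_, ((hm.comp_inner (h.hasDerivAt hζ.1)).mul (HasDerivAt.hasWD hQ'')).congr_deriv rfl (by ring)⟩
  · intro ζ hζ
    have h1 := (hK ζ hζ).1.2
    have h2 := (hK ζ hζ).2.2
    rw [mem_preimage, mem_ball_zero_iff] at h1 h2
    refine ⟨by linarith, ?_⟩
    rw [norm_mul]
    have := h.deriv_le ζ hζ.1
    have h3 : ‖g (Q ζ)‖ * ‖deriv Q ζ‖ ≤ (2 * M) * 2 := by gcongr
    linarith

lemma rData (h : Geo Ω ε ℓ Q) : RData (fun s => Q s) (fun s => deriv Q s) (fun s => conj (Q s))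
    (fun s => conj (deriv Q s)) (fun s : ℝ => (Φ (Q s) : ℂ)) (fun s : ℝ => g (Q s) * deriv Q s) := by
  obtain ⟨U, hU, hΩU, hPDE⟩ := e.exists_nhd
  have hr : ∀ s : ℝ, Q s ∈ U := fun s => hΩU (frontier_subset_closure (h.real_mem s))
  have hQs : ∀ s : ℝ, HasDerivAt (fun s : ℝ => Q s) (deriv Q s) s := fun s =>
    (h.hasDerivAt (ofReal_mem_strip h.ε_pos s)).comp_ofReal
  have hc : Continuous (fun s : ℝ => deriv Q s) :=
    (h.holo.deriv (isOpen_strip ε)).continuousOn.comp_continuous Complex.continuous_ofReal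
      (ofReal_mem_strip h.ε_pos)
  refine ⟨hQs, fun s => ?_, fun s => ?_, hc, Complex.continuous_conj.comp hc, ?_⟩
  · exact Complex.conjCLE.toContinuousLinearMap.hasFDerivAt.comp_hasDerivAt s (hQs s)
  · refine ((hPDE _ (hr s)).1.comp_curve (hQs s)).congr_deriv ?_
    have h1 : conj (g (Q s) * deriv Q s) = g (Q s) * deriv Q s := Complex.conj_eq_iff_im.2 (e.neumann s)
    rw [← map_mul, h1]; ring
  · refine Continuous.mul (continuous_iff_continuousAt.2 fun s => ?_) hc
    obtain ⟨m, hm⟩ := (hPDE _ (hr s)).2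
    exact ContinuousAt.comp (f := fun s : ℝ => Q s) hm.continuousAt (hQs s).continuousAt

/-- Complexification of the boundary values, with a bound that is uniform in the eigenfunction. -/
lemma exists_boundary (h : Geo Ω ε ℓ Q) : ∃ F : ℂ → ℂ, DifferentiableOn ℂ F (strip ε) ∧
    (∀ s : ℝ, F s = Φ (Q s)) ∧ (∀ t ∈ strip ε, ‖F t‖ ≤ M * Real.exp (5 * (1 + lam))) ∧
    (∀ t ∈ strip ε, F (conj t) = conj (F t)) ∧
    ∀ t ∈ strip ε, 0 ≤ t.im → (Φ (Q t) : ℂ) = rhs Q F (lam ^ 2 / 4) t (conj t) := by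
  obtain ⟨δ, hδ, hP, hb⟩ := e.exists_polData h
  have hlam := e.lam_pos
  have hM := e.M_pos
  have hε := h.ε_pos
  have hR := e.rData h
  set μ := lam ^ 2 / 4 with hμ
  have hsμ : √μ = lam / 2 := by
    rw [hμ, show lam ^ 2 / 4 = (lam / 2) ^ 2 by ring, Real.sqrt_sq (by positivity)]
  set B := M * Real.exp (5 * (1 + lam)) with hB
  have hloc : ∀ a : ℝ, ∃ G : ℂ → ℂ, DifferentiableOn ℂ G (ball (a : ℂ) ε) ∧
      (∀ s : ℝ, (s : ℂ) ∈ ball (a : ℂ) ε → G s = (Φ (Q s) : ℝ)) ∧ ∀ t ∈ ball (a : ℂ) ε, ‖G t‖ ≤ B := by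
    intro a
    have hbs := ball_subset_strip a (le_refl ε)
    have hsub : ball (a : ℂ) ε ∩ {z : ℂ | -δ < z.im} ⊆ strip ε ∩ {z | -δ < z.im} :=
      inter_subset_inter_left _ hbs
    have hconv : Convex ℝ (ball (a : ℂ) ε ∩ {z : ℂ | -δ < z.im}) :=
      (convex_ball _ _).inter (convex_halfSpace_im_gt (-δ))
    have hP' : PolData (ball (a : ℂ) ε ∩ {z : ℂ | -δ < z.im}) Q (fun ζ => (Φ (Q ζ) : ℂ))
        (fun ζ => g (Q ζ) * deriv Q ζ) μ :=
      ⟨isOpen_ball.inter (isOpen_lt continuous_const Complex.continuous_im), hconv, hP.mu_nonneg,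
        hP.holo.mono hsub, fun ζ hζ => hP.hasWD_V ζ (hsub hζ), fun ζ hζ => hP.hasWD_p ζ (hsub hζ)⟩
    obtain ⟨F, hF, hFu, hFb⟩ := hP'.exists_extension (A := 4 * M * (1 + Real.exp (2 * lam) * (1 + lam ^ 2))) hδ
      (h.holo.mono hbs) (fun z hz => h.deriv_le z (hbs hz)) hR
      (fun s _ => rfl) (fun s _ => rfl) (by
        intro τ hτ hτδ
        have hcτ : conj τ ∈ ball (a : ℂ) ε ∩ {z : ℂ | -δ < z.im} := by
          refine ⟨?_, ?_⟩
          · rw [← mem_preimage, conj_ball_ofReal]; exact hτ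
          · simp; linarith
        have ha : (a : ℂ) ∈ ball (a : ℂ) ε ∩ {z : ℂ | -δ < z.im} := ⟨mem_ball_self hε, by simpa using hδ⟩
        have hseg := hconv.segment_subset hcτ ha
        have hd1 : ‖(a : ℂ) - conj τ‖ ≤ 1 := by
          rw [norm_sub_rev, ← Complex.dist_eq]
          exact (mem_ball.1 hcτ.1).le.trans h.ε_le_one
        have hd2 : ∀ ζ ∈ segment ℝ (conj τ) (a : ℂ), ‖ζ - a‖ ≤ 1 := fun ζ hζ => by
          rw [← Complex.dist_eq]
          exact (mem_ball.1 (hseg hζ).1).le.trans h.ε_le_one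
        have hd3 : ∀ ζ ∈ segment ℝ (conj τ) (a : ℂ), ‖ζ - conj τ‖ ≤ 1 := fun ζ hζ =>
          (norm_sub_le_of_mem_segment hζ).trans (by rw [norm_sub_rev] at hd1; rwa [norm_sub_rev] )
        have key := norm_pol_le (Q := Q) (V := fun ζ => (Φ (Q ζ) : ℂ)) (p := fun ζ => g (Q ζ) * deriv Q ζ)
          (μ := μ) (M := 4 * M) (R := 2) (d := 1) (t := a) (τ := τ) hP.mu_nonneg
          (by positivity) zero_le_two (fun ζ hζ => (hb ζ (hsub (hseg hζ))).1)
          (fun ζ hζ => (hb ζ (hsub (hseg hζ))).2)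
          (fun ζ hζ => (norm_sub_le_strip h.holo h.deriv_le (hbs (hseg hζ).1) (hbs ha.1)).trans
            (by linarith [hd2 ζ hζ]))
          (fun ζ hζ => (norm_sub_le_strip h.holo h.deriv_le (hbs (hseg hζ).1) (hbs hcτ.1)).trans
            (by linarith [hd3 ζ hζ]))
          (fun ζ hζ => h.deriv_le _ (hbs (hseg hζ).1)) hd1
        refine key.trans (le_of_eq ?_)
        rw [hsμ, hμ]
        ring_nf)
    refine exists_reflection hδ hF (u := fun s => Φ (Q s)) hFu fun t ht htδ => (hFb t ht htδ).trans ?_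
    have e1 : √(4 * μ * ε ^ 2) ≤ lam := by
      rw [Real.sqrt_le_left hlam.le, hμ]
      have : ε ^ 2 ≤ 1 := pow_le_one₀ hε.le h.ε_le_one
      nlinarith [sq_nonneg lam]
    calc 3 * (4 * M * (1 + Real.exp (2 * lam) * (1 + lam ^ 2))) * Real.exp (2 * √(4 * μ * ε ^ 2))
        ≤ 3 * (4 * M * (1 + Real.exp (2 * lam) * (1 + lam ^ 2))) * Real.exp (2 * lam) := by gcongr
      _ = M * (12 * (1 + Real.exp (2 * lam) * (1 + lam ^ 2)) * Real.exp (2 * lam)) := by ring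
      _ ≤ B := by
        rw [hB]
        exact mul_le_mul_of_nonneg_left (exp_bound hlam.le) hM.le
  obtain ⟨F, hF, hFu⟩ := exists_strip_extension (ε := ε) (f := fun s => (Φ (Q s) : ℂ)) fun a => by
    obtain ⟨G, hG, hGu, -⟩ := hloc a
    exact ⟨G, hG, hGu⟩
  have hFu' : ∀ s : ℝ, F s = Φ (Q s) := fun s => hFu s hε
  have hcc : ∀ t ∈ strip ε, conj (F (conj t)) = F t := by
    refine eqOn_of_real (isOpen_strip ε) (convex_strip ε).isPreconnected (differentiableOn_bar hF) hF
      (ofReal_mem_strip hε 0) fun s _ => ?_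
    rw [Complex.conj_ofReal, hFu', Complex.conj_ofReal]
  refine ⟨F, hF, hFu', fun t ht => ?_, fun t ht => ?_, fun t ht h0 => ?_⟩
  · obtain ⟨G, hG, hGu, hGb⟩ := hloc t.re
    have hm := mem_ball_re ht
    have := eqOn_of_real isOpen_ball (convex_ball _ _).isPreconnected
      (hF.mono (ball_subset_strip t.re le_rfl)) hG (mem_ball_self hε) (fun s hs => by rw [hFu', hGu s hs]) hm
    rw [this]
    exact hGb t hm
  · rw [← hcc t ht, Complex.conj_conj]
  · have htK : t ∈ strip ε ∩ {z | -δ < z.im} := ⟨ht, by simp only [mem_ofPred_eq]; linarith⟩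
    have := hP.eqOn_rhs hε hδ h.holo hR (fun _ => rfl) (fun _ => rfl) hF hFu' (t := t) (τ := conj t) htK
      (by rwa [Complex.conj_conj])
    rw [← this]
    exact (PolData.pol_conj (V := fun ζ => (Φ (Q ζ) : ℂ)) t).symm

end Eig

end Nodal

namespace Nodal
open Set Filter Topology Metric ComplexConjugate

lemma norm_bess_le_three (m : ℕ) {X : ℂ} (hX : ‖X‖ ≤ 1 / 4) : ‖bess m X‖ ≤ 3 := by
  refine (norm_bess_le m X).trans ?_
  have h1 : √‖X‖ ≤ 1 / 2 := by
    rw [Real.sqrt_le_left (by norm_num)]; linarith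
  have h2 : Real.exp (2 * √‖X‖) ≤ Real.exp 1 := Real.exp_le_exp.2 (by linarith)
  linarith [Real.exp_one_lt_d9]

lemma norm_bess_zero_sub_one_le {X : ℂ} (hX : ‖X‖ ≤ 1 / 4) : ‖bess 0 X - 1‖ ≤ 3 * ‖X‖ := by
  have := (convex_closedBall (0 : ℂ) (1 / 4)).norm_image_sub_le_of_norm_deriv_le (f := bess 0) (C := 3)
    (fun x _ => (hasDerivAt_bess 0 x).differentiableAt)
    (fun x hx => by
      rw [(hasDerivAt_bess 0 x).deriv, norm_neg]
      exact norm_bess_le_three _ (mem_closedBall_zero_iff.1 hx))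
    (mem_closedBall_self (by norm_num)) (mem_closedBall_zero_iff.2 hX)
  simpa [bess_zero_zero] using this

/-- For small `μ`, solutions are close to real parts of holomorphic functions. -/
lemma PolData.abs_sub_re_le {K : Set ℂ} {Φ : ℂ → ℝ} {p : ℂ → ℂ} {μ M : ℝ}
    (h : PolData K (fun z => z) (fun z => (Φ z : ℂ)) p μ) (hμ : μ ≤ 1 / 4) (hM : 0 ≤ M)
    {c t : ℂ} (hc : c ∈ K) (ht : t ∈ K) (hct : ‖t - c‖ ≤ 1) (hV : ∀ ζ ∈ K, ‖(Φ ζ : ℂ)‖ ≤ M)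
    (hp : ∀ ζ ∈ K, ‖p ζ‖ ≤ M) :
    |Φ t - (2 * pol (fun z => z) (fun z => (Φ z : ℂ)) p μ t (conj c) - Φ c).re| ≤ 12 * μ * M := by
  have hμ0 := h.mu_nonneg
  set ζ : ℝ → ℂ := fun x => AffineMap.lineMap c t x with hζ
  have hζK : ∀ x ∈ Icc (0 : ℝ) 1, ζ x ∈ K := fun x hx => lineMap_mem h hc ht hx
  have hζd : ∀ x : ℝ, HasDerivAt ζ (t - c) x := fun x => AffineMap.hasDerivAt_lineMap
  have hζc : Continuous ζ := continuous_iff_continuousAt.2 fun x => (hζd x).continuousAt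
  have hpc : ContinuousOn (fun x => p (ζ x)) (Icc 0 1) := by
    intro x hx
    obtain ⟨m, hm⟩ := h.hasWD_p _ (hζK x hx)
    exact (hm.continuousAt.comp (hζc.continuousAt (x := x))).continuousWithinAt
  have hVc : ContinuousOn (fun x => (Φ (ζ x) : ℂ)) (Icc 0 1) := by
    intro x hx
    exact ((h.hasWD_V _ (hζK x hx)).continuousAt.comp (hζc.continuousAt (x := x))).continuousWithinAt
  have hI : IntervalIntegrable (fun x => p (ζ x) * (t - c)) volume 0 1 :=
    ContinuousOn.intervalIntegrable (by rw [uIcc_of_le zero_le_one]; exact hpc.mul continuousOn_const)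
  have hI' : IntervalIntegrable (fun x => conj (p (ζ x)) * conj (t - c)) volume 0 1 :=
    ContinuousOn.intervalIntegrable (by
      rw [uIcc_of_le zero_le_one]
      exact (Complex.continuous_conj.comp_continuousOn hpc).mul continuousOn_const)
  have hFTC : ∫ x in (0 : ℝ)..1, (p (ζ x) * (t - c) + conj (p (ζ x)) * conj (t - c)) = Φ t - Φ c := by
    have := intervalIntegral.integral_eq_sub_of_hasDerivAt (a := 0) (b := 1) (f := fun x => (Φ (ζ x) : ℂ))
      (f' := fun x => p (ζ x) * (t - c) + conj (p (ζ x)) * conj (t - c))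
      (fun x hx => by
        rw [uIcc_of_le zero_le_one] at hx
        exact (h.hasWD_V _ (hζK x hx)).comp_curve (hζd x)) (hI.add hI')
    rw [this]
    simp [hζ]
  set I := ∫ x in (0 : ℝ)..1, p (ζ x) * (t - c) with hIdef
  have hre : Φ t - Φ c = 2 * I.re := by
    rw [intervalIntegral.integral_add hI hI'] at hFTC
    have e : ∫ x in (0 : ℝ)..1, conj (p (ζ x)) * conj (t - c) = conj I := by
      rw [hIdef, ← intervalIntegral.intervalIntegral_conj]
      simp
    rw [e, Complex.add_conj] at hFTC
    exact_mod_cast hFTC.symm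
  set J := rInt (fun z => z) (fun z => (Φ z : ℂ)) p μ t (conj c) c t with hJ
  have hpol : pol (fun z => z) (fun z => (Φ z : ℂ)) p μ t (conj c) = Φ c + J := by
    simp [pol, hJ]
  have hX : ∀ x ∈ Icc (0 : ℝ) 1, ‖rArg (fun z => z) μ t (conj c) (ζ x)‖ ≤ μ ∧ ‖ζ x - t‖ ≤ 1 := by
    intro x hx
    have e1 : ‖ζ x - t‖ ≤ 1 := by
      have : ζ x - t = ((x - 1 : ℝ) : ℂ) * (t - c) := by
        simp [hζ, AffineMap.lineMap_apply]; ring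
      rw [this, norm_mul, Complex.norm_real, Real.norm_eq_abs, abs_of_nonpos (by linarith [hx.2])]
      nlinarith [norm_nonneg (t - c), hx.1, hx.2]
    have e2 : ‖ζ x - c‖ ≤ 1 := by
      have : ζ x - c = (x : ℂ) * (t - c) := by
        simp [hζ, AffineMap.lineMap_apply]
      rw [this, norm_mul, Complex.norm_real, Real.norm_of_nonneg hx.1]
      nlinarith [norm_nonneg (t - c), hx.1, hx.2]
    refine ⟨?_, e1⟩
    rw [rArg, norm_mul, norm_mul, ← map_sub, Complex.norm_conj, Complex.norm_real, Real.norm_of_nonneg hμ0]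
    calc μ * ‖ζ x - t‖ * ‖ζ x - c‖ ≤ μ * 1 * 1 := by gcongr
      _ = μ := by ring
  have hrc : ContinuousOn (fun x => rArg (fun z => z) μ t (conj c) (ζ x)) (Icc 0 1) :=
    Continuous.continuousOn (by unfold rArg; fun_prop)
  have hJI : IntervalIntegrable (fun x => rHol (fun z => z) p μ t (conj c) (ζ x) * (t - c) +
      rBar (fun z => z) (fun z => (Φ z : ℂ)) μ t (conj c) (ζ x) * conj (t - c)) volume 0 1 := by
    refine ContinuousOn.intervalIntegrable ?_
    rw [uIcc_of_le zero_le_one]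
    have hd : deriv (fun z : ℂ => z) = fun _ => 1 := by ext z; exact deriv_id z
    unfold rHol rBar
    simp only [hd]
    refine ((((continuous_bess 0).comp_continuousOn hrc).mul hpc).mul continuousOn_const).add
      ((((((continuous_bess 1).comp_continuousOn hrc).mul
        (Continuous.continuousOn (by fun_prop))).neg).mul hVc).mul continuousOn_const)
  have hJI' : ‖J - I‖ ≤ 6 * μ * M * |1 - 0| := by
    rw [hJ, rInt_eq, hIdef, ← intervalIntegral.integral_sub hJI hI]
    apply intervalIntegral.norm_integral_le_of_norm_le_const
    intro x hx
    rw [uIoc_of_le zero_le_one] at hx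
    have hx' := Ioc_subset_Icc_self hx
    obtain ⟨h1, h2⟩ := hX x hx'
    have h3 := norm_bess_zero_sub_one_le (h1.trans hμ)
    have h4 := norm_bess_le_three 1 (h1.trans hμ)
    have h5 := hV _ (hζK x hx')
    have h6 := hp _ (hζK x hx')
    change ‖rHol (fun z => z) p μ t (conj c) (ζ x) * (t - c) +
      rBar (fun z => z) (fun z => (Φ z : ℂ)) μ t (conj c) (ζ x) * conj (t - c) - p (ζ x) * (t - c)‖ ≤ _
    have e : rHol (fun z => z) p μ t (conj c) (ζ x) * (t - c) +
        rBar (fun z => z) (fun z => (Φ z : ℂ)) μ t (conj c) (ζ x) * conj (t - c) - p (ζ x) * (t - c) =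
        (bess 0 (rArg (fun z => z) μ t (conj c) (ζ x)) - 1) * p (ζ x) * (t - c) -
        bess 1 (rArg (fun z => z) μ t (conj c) (ζ x)) * (μ * (ζ x - t)) * Φ (ζ x) * conj (t - c) := by
      rw [rHol, rBar, show deriv (fun z : ℂ => z) (ζ x) = 1 from deriv_id _]
      simp only [map_one]
      ring
    rw [e]
    refine (norm_sub_le _ _).trans ?_
    rw [norm_mul, norm_mul, norm_mul, norm_mul, norm_mul, norm_mul, Complex.norm_conj, Complex.norm_real,
      Real.norm_of_nonneg hμ0]
    calc _ ≤ 3 * μ * M * 1 + 3 * (μ * 1) * M * 1 := by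
          gcongr
          linarith
      _ = 6 * μ * M := by ring
  rw [hpol]
  have e2 : Φ t - (2 * ((Φ c : ℂ) + J) - Φ c).re = -(2 * (J - I).re) := by
    simp
    linarith
  rw [e2, abs_neg, abs_mul, abs_two]
  have := Complex.abs_re_le_norm (J - I)
  norm_num at hJI'
  linarith

end Nodal

namespace Nodal
open Set Filter Topology Metric ComplexConjugate

/-- A holomorphic chart of `closure Ω` near a point, in which restrictions of eigenfunctions to
segments have bounded holomorphic extensions. -/
structure Chart (Ω : Set ℂ) (Q : ℂ → ℂ) (N D D' : Set ℂ) (Θ : ℂ → ℂ) (ρ : ℝ) (c : ℂ) (R : ℝ) : Prop where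
  isOpen : IsOpen N
  subset_image : N ∩ closure Ω ⊆ Θ '' D'
  subset : D' ⊆ D
  mapsTo : MapsTo Θ D (closure Ω)
  convex : Convex ℝ D
  dist_le : ∀ t ∈ D, ∀ t' ∈ D, ‖t' - t‖ ≤ 1
  ρ_pos : 0 < ρ
  add_mem : ∀ t ∈ D', t + ρ ∈ D
  add_mem' : ∀ t ∈ D', t + ρ * Complex.I ∈ D
  hasDerivAt : ∀ t ∈ D, HasDerivAt Θ (deriv Θ t) t
  le_deriv : ∀ t ∈ D, 1 / 2 ≤ ‖deriv Θ t‖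
  subset_ball : D' ⊆ ball c (R / 4)
  ext : ∀ {lam M : ℝ} {Φ : ℂ → ℝ} {g : ℂ → ℂ}, Eig Ω Q lam M Φ g → ∀ t ∈ D, ∀ t' ∈ D,
    ∃ G : ℂ → ℂ, DifferentiableOn ℂ G (ball 0 3) ∧
      (∀ s ∈ ball (0 : ℂ) 3, ‖G s‖ ≤ M * Real.exp (10 * (1 + lam))) ∧
      ∀ s ∈ Icc (0 : ℝ) 1, G s = Φ (Θ (t + s * (t' - t)))
  harm : ∀ {lam M : ℝ} {Φ : ℂ → ℝ} {g : ℂ → ℂ}, Eig Ω Q lam M Φ g → lam ≤ 1 →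
    ∃ H : ℂ → ℂ, DifferentiableOn ℂ H (ball c R) ∧
      (∀ z ∈ ball c R, ∃ y ∈ closure Ω, |Φ y - (H z).re| ≤ Real.exp 16 * lam ^ 2 * M) ∧
      ∀ t ∈ D', |Φ (Θ t) - (H t).re| ≤ Real.exp 16 * lam ^ 2 * M

lemma sq_le_two_exp {lam : ℝ} (h : 0 ≤ lam) : lam ^ 2 ≤ 2 * Real.exp lam := by
  linarith [Real.quadratic_le_exp_of_nonneg h]

lemma exp_bound_two {lam : ℝ} (h : 0 ≤ lam) :
    1 + 4 * lam ^ 2 * Real.exp (4 * lam) ≤ Real.exp (5 * (1 + lam)) := by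
  have h2 := sq_le_two_exp h
  have e1 : Real.exp (4 * lam) = Real.exp lam ^ 4 := by rw [← Real.exp_nat_mul]; norm_num
  have e2 : Real.exp (5 * (1 + lam)) = Real.exp 1 ^ 5 * Real.exp lam ^ 5 := by
    rw [← Real.exp_nat_mul, ← Real.exp_nat_mul, ← Real.exp_add]; congr 1; push_cast; ring
  have h3 : (9 : ℝ) ≤ Real.exp 1 ^ 5 := by
    have : (2 : ℝ) ≤ Real.exp 1 := by have := Real.exp_one_gt_d9; linarith
    calc (9 : ℝ) ≤ 2 ^ 5 := by norm_num
      _ ≤ _ := by gcongr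
  have h4 : 1 ≤ Real.exp lam := Real.one_le_exp h
  rw [e1, e2]
  set y := Real.exp lam
  calc 1 + 4 * lam ^ 2 * y ^ 4 ≤ y ^ 5 + 4 * (2 * y) * y ^ 4 := by
        gcongr
        exact one_le_pow₀ h4
    _ = 9 * y ^ 5 := by ring
    _ ≤ _ := by gcongr

lemma exp_bound_three {lam : ℝ} (h : 0 ≤ lam) :
    1 + Real.exp lam * (1 + lam ^ 2 / 2) ≤ Real.exp (10 * (1 + lam)) := by
  have h2 := sq_le_two_exp h
  have h4 : 1 ≤ Real.exp lam := Real.one_le_exp h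
  have e2 : Real.exp (10 * (1 + lam)) = Real.exp (10 + 8 * lam) * Real.exp lam ^ 2 := by
    rw [← Real.exp_nat_mul, ← Real.exp_add]; congr 1; push_cast; ring
  have h5 : 3 ≤ Real.exp (10 + 8 * lam) := by linarith [Real.add_one_le_exp (10 + 8 * lam)]
  rw [e2]
  set y := Real.exp lam
  calc 1 + y * (1 + lam ^ 2 / 2) ≤ y ^ 2 + y * (y + (2 * y) / 2) := by
        gcongr
        exact one_le_pow₀ h4
    _ = 3 * y ^ 2 := by ring
    _ ≤ _ := by gcongr

lemma sqrt_sq_div_four {lam : ℝ} (h : 0 ≤ lam) : √(lam ^ 2 / 4) = lam / 2 := by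
  rw [show lam ^ 2 / 4 = (lam / 2) ^ 2 by ring, Real.sqrt_sq (by positivity)]

section boundary

variable {Ω : Set ℂ} {ε ℓ lam M : ℝ} {Q g F : ℂ → ℂ} {Φ : ℂ → ℝ}

lemma norm_sub_conj_le {t : ℂ} (ht : t ∈ strip ε) (hε : ε ≤ 1) : ‖t - conj t‖ ≤ 2 := by
  rw [Complex.sub_conj, norm_mul, Complex.norm_I, mul_one, Complex.norm_real, Real.norm_eq_abs, abs_mul, abs_two]
  have : |t.im| < ε := ht
  linarith

lemma Eig.abs_sub_re_boundary (e : Eig Ω Q lam M Φ g) (h : Geo Ω ε ℓ Q) (hlam : lam ≤ 1)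
    (hFA : ∀ t ∈ strip ε, ‖F t‖ ≤ M * Real.exp (5 * (1 + lam))) (hFc : ∀ t ∈ strip ε, F (conj t) = conj (F t))
    (hFr : ∀ t ∈ strip ε, 0 ≤ t.im → (Φ (Q t) : ℂ) = rhs Q F (lam ^ 2 / 4) t (conj t)) {t : ℂ}
    (hts : t ∈ strip ε) (ht0 : 0 ≤ t.im) : |Φ (Q t) - (F t).re| ≤ Real.exp 16 * lam ^ 2 * M := by
  have hl0 := e.lam_pos
  have hM := e.M_pos
  have h3 := norm_rhs_sub_le h.holo h.deriv_le (μ := lam ^ 2 / 4) (by positivity) hts (conj_mem_strip hts) (d := 2)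
    (norm_sub_conj_le hts h.ε_le_one) hFA
  rw [← hFr t hts ht0, hFc t hts, Complex.add_conj] at h3
  have e2 : (Φ (Q t) : ℂ) - ((2 * (F t).re : ℝ) : ℂ) / 2 = ((Φ (Q t) - (F t).re : ℝ) : ℂ) := by
    push_cast; ring
  rw [e2, Complex.norm_real, Real.norm_eq_abs] at h3
  refine h3.trans ?_
  rw [sqrt_sq_div_four hl0.le]
  have h4 : (4 : ℝ) ≤ Real.exp 2 := by
    have e3 : Real.exp 2 = Real.exp 1 ^ 2 := by rw [← Real.exp_nat_mul]; norm_num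
    have := Real.exp_one_gt_d9
    rw [e3]; nlinarith
  calc _ = 4 * (Real.exp (4 * lam) * Real.exp (5 * (1 + lam))) * lam ^ 2 * M := by ring_nf
    _ ≤ Real.exp 2 * Real.exp 14 * lam ^ 2 * M := by
      rw [← Real.exp_add]
      gcongr
      linarith
    _ = _ := by rw [← Real.exp_add]; norm_num

lemma norm_rhs_le (h : Geo Ω ε ℓ Q) (hl0 : 0 ≤ lam) {ε' A : ℝ} (hε' : ε' ≤ ε)
    (hFA : ∀ t ∈ strip ε', ‖F t‖ ≤ A) {t τ : ℂ} (ht : t ∈ strip ε') (hτ : τ ∈ strip ε') (hd : ‖t - τ‖ ≤ 2) :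
    ‖rhs Q F (lam ^ 2 / 4) t τ‖ ≤ A * Real.exp (5 * (1 + lam)) := by
  have hs := strip_mono hε'
  have h3 := norm_rhs_sub_le (h.holo.mono hs) (fun t ht => h.deriv_le t (hs ht)) (μ := lam ^ 2 / 4) (by positivity)
    ht hτ hd hFA
  have hA : 0 ≤ A := (norm_nonneg _).trans (hFA t ht)
  have h4 : ‖(F t + F τ) / 2‖ ≤ A := by
    rw [norm_div]
    have := norm_add_le (F t) (F τ)
    have := hFA t ht
    have := hFA τ hτ
    norm_num
    linarith
  have := norm_le_norm_sub_add (rhs Q F (lam ^ 2 / 4) t τ) ((F t + F τ) / 2)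
  rw [sqrt_sq_div_four hl0] at h3
  calc _ ≤ 4 * (lam ^ 2 / 4) * 2 ^ 2 * Real.exp (4 * (lam / 2) * 2) * A + A := by linarith
    _ = A * (1 + 4 * lam ^ 2 * Real.exp (4 * lam)) := by ring_nf
    _ ≤ _ := by
      gcongr
      exact exp_bound_two hl0

end boundary

lemma norm_segment_param {a t t' s : ℂ} {r : ℝ} (ht : t ∈ ball a r) (ht' : t' ∈ ball a r)
    (hs : s ∈ ball (0 : ℂ) 3) : t + s * (t' - t) ∈ ball a (7 * r) := by
  rw [mem_ball_iff_norm] at *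
  rw [sub_zero] at hs
  have h1 : ‖t' - t‖ ≤ 2 * r := by
    have : t' - t = (t' - a) - (t - a) := by ring
    rw [this]
    exact (norm_sub_le _ _).trans (by linarith)
  have : t + s * (t' - t) - a = (t - a) + s * (t' - t) := by ring
  rw [this]
  refine (norm_add_le _ _).trans_lt ?_
  rw [norm_mul]
  have : ‖s‖ * ‖t' - t‖ ≤ 3 * (2 * r) := by gcongr
  linarith

section interior

variable {Ω : Set ℂ} {Q g : ℂ → ℂ} {lam M : ℝ} {Φ : ℂ → ℝ}

lemma Eig.polData_id (e : Eig Ω Q lam M Φ g) {x : ℂ} {r : ℝ} (hb : ball x r ⊆ closure Ω) :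
    PolData (ball x r) (fun z => z) (fun z => (Φ z : ℂ)) g (lam ^ 2 / 4) := by
  obtain ⟨U, hU, hΩU, hPDE⟩ := e.exists_nhd
  refine ⟨isOpen_ball, convex_ball _ _, by positivity, differentiableOn_id, ?_, ?_⟩
  · exact fun z hz => (hPDE z (hΩU (hb hz))).1
  · intro z hz
    obtain ⟨m, hm⟩ := (hPDE z (hΩU (hb hz))).2
    exact ⟨m, hm.congr_deriv rfl (by rw [show deriv (fun z : ℂ => z) z = 1 from deriv_id _]; simp)⟩

lemma exists_chart_interior (hΩ : IsOpen Ω) {x : ℂ} (hx : x ∈ Ω) :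
    ∃ N D D' Θ ρ c R, Chart Ω Q N D D' Θ ρ c R ∧ x ∈ N := by
  obtain ⟨r₁, hr₁, hb₁⟩ := Metric.isOpen_iff.1 hΩ x hx
  obtain ⟨r, hr, hr14, hr9⟩ : ∃ r > 0, r ≤ 1 / 14 ∧ 9 * r ≤ r₁ :=
    ⟨min (1 / 14) (r₁ / 9), by positivity, min_le_left _ _, by linarith [min_le_right (1 / 14) (r₁ / 9)]⟩
  have hb : ball x (9 * r) ⊆ closure Ω := ((ball_subset_ball hr9).trans hb₁).trans subset_closure
  have hKD : ∀ {r'}, r' ≤ 9 * r → ball x r' ⊆ ball x (9 * r) := fun h => ball_subset_ball h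
  refine ⟨ball x (r / 2), ball x r, ball x (r / 2), fun z => z, r / 4, x, 4 * r, ?_, mem_ball_self (by positivity)⟩
  have hρ : ∀ v : ℂ, ‖v‖ ≤ 1 → ∀ t ∈ ball x (r / 2), t + ((r / 4 : ℝ) : ℂ) * v ∈ ball x r := by
    intro v hv t ht
    rw [mem_ball_iff_norm] at *
    have : t + ((r / 4 : ℝ) : ℂ) * v - x = (t - x) + ((r / 4 : ℝ) : ℂ) * v := by ring
    rw [this]
    refine (norm_add_le _ _).trans_lt ?_
    rw [norm_mul, Complex.norm_real, Real.norm_of_nonneg (by positivity)]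
    nlinarith
  have hdist : ∀ {r' : ℝ}, 2 * r' ≤ 1 → ∀ t ∈ ball x r', ∀ t' ∈ ball x r', ‖t' - t‖ ≤ 1 := by
    intro r' hr' t ht t' ht'
    rw [mem_ball_iff_norm] at *
    have : t' - t = (t' - x) - (t - x) := by ring
    rw [this]
    exact (norm_sub_le _ _).trans (by linarith)
  refine ⟨isOpen_ball, fun y hy => ⟨y, hy.1, rfl⟩, ball_subset_ball (by linarith),
    fun t ht => hb (hKD (by linarith) ht), convex_ball _ _, hdist (by linarith), by positivity,
    fun t ht => by simpa using! hρ 1 (by simp) t ht,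
    fun t ht => hρ Complex.I (by simp) t ht,
    fun t _ => by rw [show deriv (fun z : ℂ => z) t = 1 from deriv_id _]; exact hasDerivAt_id t,
    fun t _ => by rw [show deriv (fun z : ℂ => z) t = 1 from deriv_id _]; norm_num,
    ball_subset_ball (by linarith), ?_, ?_⟩
  · intro lam M Φ g e t ht t' ht'
    have h := e.polData_id hb
    have hl0 := e.lam_pos
    have hM := e.M_pos
    have hlK : ∀ s ∈ ball (0 : ℂ) 3, t + s * (t' - t) ∈ ball x (7 * r) := fun s hs => norm_segment_param ht ht' hs
    have hmK : ∀ s ∈ ball (0 : ℂ) 3, conj (conj t + s * conj (t' - t)) ∈ ball x (7 * r) := by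
      intro s hs
      have := norm_segment_param ht ht' (s := conj s) (by simpa using! hs)
      simpa using! this
    refine ⟨fun s => pol (fun z => z) (fun z => (Φ z : ℂ)) g (lam ^ 2 / 4) (t + s * (t' - t)) (conj t + s * conj (t' - t)), ?_, ?_, ?_⟩
    · refine differentiableOn_diag (D := ball x (9 * r) ×ˢ (conj ⁻¹' ball x (9 * r)))
        (isOpen_ball.prod (isOpen_ball.preimage Complex.continuous_conj)) h.continuousOn_pol
        (fun t τ ht => h.hasDerivAt_pol_left ht.1 ht.2) (fun t τ ht => h.hasDerivAt_pol_right ht.1 ht.2) isOpen_ball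
        (by fun_prop) (by fun_prop) fun s hs => ⟨hKD (by linarith) (hlK s hs), hKD (by linarith) (hmK s hs)⟩
    · intro s hs
      have h1 := hlK s hs
      have h2 := hmK s hs
      set l := t + s * (t' - t)
      set m := conj t + s * conj (t' - t)
      have hseg : segment ℝ (conj m) l ⊆ ball x (7 * r) := (convex_ball _ _).segment_subset h2 h1
      have hsb : ∀ ζ ∈ segment ℝ (conj m) l, ζ ∈ closure Ω := fun ζ hζ => hb (hKD (by linarith) (hseg hζ))
      have hd := hdist (r' := 7 * r) (by linarith)
      have := norm_pol_le (Q := fun z => z) (V := fun z => (Φ z : ℂ)) (p := g) (μ := lam ^ 2 / 4) (M := M) (R := 1) (d := 1)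
        (t := l) (τ := m) (by positivity) hM.le zero_le_one
        (fun ζ hζ => by rw [Complex.norm_real]; exact e.abs_le ζ (hsb ζ hζ))
        (fun ζ hζ => e.norm_le ζ (hsb ζ hζ))
        (fun ζ hζ => hd _ h1 _ (hseg hζ)) (fun ζ hζ => hd _ h2 _ (hseg hζ))
        (fun ζ hζ => by rw [show deriv (fun z : ℂ => z) ζ = 1 from deriv_id _]; norm_num) (hd _ h2 _ h1)
      refine this.trans ?_
      rw [sqrt_sq_div_four hl0.le]
      gcongr
      refine le_trans (le_of_eq ?_) (exp_bound_three hl0.le)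
      ring_nf
    · intro s hs
      have : conj t + (s : ℂ) * conj (t' - t) = conj (t + s * (t' - t)) := by simp
      simp only [this]
      exact PolData.pol_conj (V := fun z => (Φ z : ℂ)) _
  · intro lam M Φ g e hlam
    have h := e.polData_id hb
    have hl0 := e.lam_pos
    have hM := e.M_pos
    have hxK : x ∈ ball x (9 * r) := mem_ball_self (by positivity)
    have key : ∀ t ∈ ball x (4 * r),
        |Φ t - (2 * pol (fun z => z) (fun z => (Φ z : ℂ)) g (lam ^ 2 / 4) t (conj x) - Φ x).re| ≤ Real.exp 16 * lam ^ 2 * M := by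
      intro t ht
      refine (h.abs_sub_re_le (by nlinarith) hM.le hxK (hKD (by linarith) ht) ?_
        (fun ζ hζ => by rw [Complex.norm_real]; exact e.abs_le ζ (hb hζ))
        (fun ζ hζ => e.norm_le ζ (hb hζ))).trans ?_
      · exact hdist (r' := 4 * r) (by linarith) x (mem_ball_self (by positivity)) t ht
      · have : (3 : ℝ) ≤ Real.exp 16 := by linarith [Real.add_one_le_exp 16]
        calc 12 * (lam ^ 2 / 4) * M = 3 * lam ^ 2 * M := by ring
          _ ≤ _ := by gcongr
    refine ⟨fun t => 2 * pol (fun z => z) (fun z => (Φ z : ℂ)) g (lam ^ 2 / 4) t (conj x) - Φ x, ?_, ?_, ?_⟩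
    · intro t ht
      exact (((h.hasDerivAt_pol_left (hKD (by linarith) ht) (by simpa using! hxK)).const_mul 2).sub_const _).differentiableWithinAt
    · exact fun z hz => ⟨z, hb (hKD (by linarith) hz), key z hz⟩
    · exact fun t ht => key t (ball_subset_ball (by linarith) ht)

end interior

lemma Geo.exists_chart_boundary {Ω : Set ℂ} {ε ℓ : ℝ} {Q : ℂ → ℂ} (h : Geo Ω ε ℓ Q) (a : ℝ) :
    ∃ N D D' Θ ρ c R, Chart Ω Q N D D' Θ ρ c R ∧ Q a ∈ N := by
  have hε := h.ε_pos
  have hε1 := h.ε_le_one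
  obtain ⟨N, hN, haN, hNs⟩ := h.exists_chart a (ε / 16) (by positivity) (by linarith)
  have hbs : ∀ {r : ℝ}, r ≤ ε → ball (a : ℂ) r ⊆ strip ε := fun hr => ball_subset_strip a hr
  refine ⟨N, ball a (ε / 8) ∩ {t | 0 ≤ t.im}, ball a (ε / 16) ∩ {t | 0 ≤ t.im}, Q, ε / 32, a, ε, ?_, haN⟩
  have hρ : ∀ v : ℂ, ‖v‖ ≤ 1 → 0 ≤ v.im → ∀ t ∈ ball (a : ℂ) (ε / 16) ∩ {t | 0 ≤ t.im},
      t + ((ε / 32 : ℝ) : ℂ) * v ∈ ball (a : ℂ) (ε / 8) ∩ {t | 0 ≤ t.im} := by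
    rintro v hv hv0 t ⟨ht, ht0⟩
    constructor
    · rw [mem_ball_iff_norm] at *
      have : t + ((ε / 32 : ℝ) : ℂ) * v - a = (t - a) + ((ε / 32 : ℝ) : ℂ) * v := by ring
      rw [this]
      refine (norm_add_le _ _).trans_lt ?_
      rw [norm_mul, Complex.norm_real, Real.norm_of_nonneg (by positivity)]
      nlinarith
    · have ht0 : 0 ≤ t.im := ht0
      change 0 ≤ (t + ((ε / 32 : ℝ) : ℂ) * v).im
      rw [Complex.add_im, Complex.im_ofReal_mul]
      positivity
  have hdist : ∀ {r' : ℝ}, r' ≤ 1 → ∀ t ∈ ball (a : ℂ) r', ∀ t' ∈ ball (a : ℂ) r', ‖t' - t‖ ≤ 2 * r' := by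
    intro r' hr' t ht t' ht'
    rw [mem_ball_iff_norm] at *
    have : t' - t = (t' - a) - (t - a) := by ring
    rw [this]
    exact (norm_sub_le _ _).trans (by linarith)
  have hconv : Convex ℝ (ball (a : ℂ) (ε / 8) ∩ {t | 0 ≤ t.im}) :=
    (convex_ball _ _).inter (convex_halfSpace_im_ge 0)
  refine ⟨hN, fun y hy => hNs hy, inter_subset_inter_left _ (ball_subset_ball (by linarith)),
    fun t ht => h.mem_closure (hbs (by linarith) ht.1) ht.2, hconv,
    fun t ht t' ht' => (hdist (by linarith) t ht.1 t' ht'.1).trans (by linarith), by positivity,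
    fun t ht => by simpa using! hρ 1 (by simp) (by simp) t ht,
    fun t ht => hρ Complex.I (by simp) (by simp) t ht,
    fun t ht => h.hasDerivAt (hbs (by linarith) ht.1), fun t ht => h.le_deriv t (hbs (by linarith) ht.1),
    fun t ht => ball_subset_ball (by linarith) ht.1, ?_, ?_⟩
  · intro lam M Φ g e t ht t' ht'
    have hl0 := e.lam_pos
    have hM := e.M_pos
    obtain ⟨F, hF, -, hFA, hFc, hFr⟩ := e.exists_boundary h
    have h78 : ball (a : ℂ) (7 * (ε / 8)) ⊆ strip ε := hbs (by linarith)
    have hlK : ∀ s ∈ ball (0 : ℂ) 3, t + s * (t' - t) ∈ ball (a : ℂ) (7 * (ε / 8)) :=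
      fun s hs => norm_segment_param ht.1 ht'.1 hs
    have hmK : ∀ s ∈ ball (0 : ℂ) 3, conj t + s * conj (t' - t) ∈ ball (a : ℂ) (7 * (ε / 8)) := by
      intro s hs
      have := norm_segment_param ht.1 ht'.1 (s := conj s) (by simpa using! hs)
      rw [← conj_ball_ofReal] at this
      simpa using! this
    refine ⟨fun s => rhs Q F (lam ^ 2 / 4) (t + s * (t' - t)) (conj t + s * conj (t' - t)), ?_, ?_, ?_⟩
    · exact differentiableOn_rhs h.holo hF _ isOpen_ball (by fun_prop) (by fun_prop)
        (fun s hs => h78 (hlK s hs)) (fun s hs => h78 (hmK s hs))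
    · intro s hs
      have h1 := hlK s hs
      have h2 := hmK s hs
      set l := t + s * (t' - t)
      set m := conj t + s * conj (t' - t)
      refine (norm_rhs_le h hl0.le le_rfl hFA (h78 h1) (h78 h2)
        ((hdist (r' := 7 * (ε / 8)) (by linarith) m h2 l h1).trans (by linarith))).trans (le_of_eq ?_)
      rw [mul_assoc, ← Real.exp_add]
      ring_nf
    · intro s hs
      have hin : t + s * (t' - t) ∈ ball (a : ℂ) (ε / 8) ∩ {t | 0 ≤ t.im} := by
        have := hconv.add_smul_sub_mem ht ht' hs
        simpa using! this
      have : conj t + (s : ℂ) * conj (t' - t) = conj (t + s * (t' - t)) := by simp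
      simp only [this]
      exact (hFr _ (hbs (by linarith) hin.1) hin.2).symm
  · intro lam M Φ g e hlam
    have hl0 := e.lam_pos
    have hM := e.M_pos
    obtain ⟨F, hF, -, hFA, hFc, hFr⟩ := e.exists_boundary h
    have key : ∀ t ∈ ball (a : ℂ) ε, 0 ≤ t.im → |Φ (Q t) - (F t).re| ≤ Real.exp 16 * lam ^ 2 * M :=
      fun t ht ht0 => e.abs_sub_re_boundary h hlam hFA hFc hFr (hbs le_rfl ht) ht0
    refine ⟨F, hF.mono (hbs le_rfl), ?_, fun t ht => key t (ball_subset_ball (by linarith) ht.1) ht.2⟩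
    intro z hz
    rcases le_total 0 z.im with h0 | h0
    · exact ⟨Q z, h.mem_closure (hbs le_rfl hz) h0, key z hz h0⟩
    · have hzc : conj z ∈ ball (a : ℂ) ε := by rw [← conj_ball_ofReal] at hz; exact hz
      have h0' : 0 ≤ (conj z).im := by simpa using h0
      refine ⟨Q (conj z), h.mem_closure (hbs le_rfl hzc) h0', ?_⟩
      have := key _ hzc h0'
      rwa [hFc z (hbs le_rfl hz), Complex.conj_re] at this

lemma Geo.exists_chart_at {Ω : Set ℂ} {ε ℓ : ℝ} {Q : ℂ → ℂ} (h : Geo Ω ε ℓ Q) {x : ℂ} (hx : x ∈ closure Ω) :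
    ∃ N D D' Θ ρ c R, Chart Ω Q N D D' Θ ρ c R ∧ x ∈ N := by
  by_cases hxΩ : x ∈ Ω
  · exact exists_chart_interior h.isOpen hxΩ
  · obtain ⟨s, rfl⟩ := h.frontier x ⟨hx, by rwa [h.isOpen.interior_eq]⟩
    exact h.exists_chart_boundary s

end Nodal

namespace Nodal
open Set Filter Topology Metric ComplexConjugate

variable {Ω : Set ℂ} {ε ℓ : ℝ} {Q : ℂ → ℂ}

lemma Chart.exists_propagation {N D D' : Set ℂ} {Θ : ℂ → ℂ} {ρ R : ℝ} {c : ℂ} (ch : Chart Ω Q N D D' Θ ρ c R)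
    {s₀ : ℝ} (h0 : 0 < s₀) (h1 : s₀ ≤ 1) : ∃ α : ℝ, 0 < α ∧ ∀ {lam M : ℝ} {Φ : ℂ → ℝ} {g : ℂ → ℂ},
      Eig Ω Q lam M Φ g → ∀ t ∈ D, ∀ t' ∈ D, ∀ {L : ℝ}, 0 ≤ L →
      (∀ s ∈ Icc (0 : ℝ) s₀, |Φ (Θ (t + s * (t' - t)))| ≤ M * Real.exp (-L)) →
      ∃ G : ℂ → ℂ, DifferentiableOn ℂ G (ball 0 3) ∧ (∀ s ∈ Icc (0 : ℝ) 1, G s = Φ (Θ (t + s * (t' - t)))) ∧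
        ∀ z : ℂ, ‖z‖ ≤ 1 → ‖G z‖ ≤ M * Real.exp (10 * (1 + lam) - α * L) := by
  obtain ⟨α, hα, hα1, hprop⟩ := Nodal.exists_propagation h0 h1
  refine ⟨α, hα, fun {lam M Φ g} e t ht t' ht' {L} hL hs => ?_⟩
  obtain ⟨G, hG, hGb, hGs⟩ := ch.ext e t ht t' ht'
  have hl := e.lam_pos
  have hM := e.M_pos
  refine ⟨G, hG, hGs, fun z hz => ?_⟩
  refine (hprop (b := L + 10 * (1 + lam)) (by positivity) (by positivity) hG hGb ?_ z hz).trans ?_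
  · intro s hsI
    rw [hGs s ⟨hsI.1, hsI.2.trans h1⟩, Complex.norm_real, Real.norm_eq_abs, mul_assoc, ← Real.exp_add]
    refine (hs s hsI).trans (le_of_eq ?_)
    ring_nf
  · rw [mul_assoc, ← Real.exp_add]
    gcongr
    nlinarith

lemma Chart.norm_le {N D D' : Set ℂ} {Θ : ℂ → ℂ} {ρ R : ℝ} {c : ℂ} (ch : Chart Ω Q N D D' Θ ρ c R) :
    ∃ C c : ℝ, 0 ≤ C ∧ 0 < c ∧ ∀ {lam M : ℝ} {Φ : ℂ → ℝ} {g : ℂ → ℂ}, Eig Ω Q lam M Φ g → ∀ {L : ℝ}, 0 ≤ L →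
      (∀ y ∈ closure Ω, |Φ y| ≤ M * Real.exp (-L)) →
      ∀ x ∈ N ∩ closure Ω, ‖g x‖ ≤ M * Real.exp (C * (1 + lam) - c * L) := by
  obtain ⟨α, hα, hprop⟩ := ch.exists_propagation one_pos le_rfl
  have hρ := ch.ρ_pos
  refine ⟨10 + 2 / ρ, α, by positivity, hα, fun {lam M Φ g} e {L} hL hΦ x hx => ?_⟩
  obtain ⟨t, htD', rfl⟩ := ch.subset_image hx
  have ht := ch.subset htD'
  have hl := e.lam_pos
  have hM := e.M_pos
  obtain ⟨U, hU, hΩU, hPDE⟩ := e.exists_nhd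
  set w := g (Θ t) * deriv Θ t with hw
  set B := M * Real.exp (10 * (1 + lam) - α * L) with hB
  have key : ∀ v : ℂ, t + ρ * v ∈ D → |2 * (w * (ρ * v)).re| ≤ B := by
    intro v hv
    obtain ⟨G, hG, hGs, hGb⟩ := hprop e t ht (t + ρ * v) hv hL fun s hs =>
      hΦ _ (ch.mapsTo (by simpa using! ch.convex.add_smul_sub_mem ht hv hs))
    have hG0 : HasDerivAt G (deriv G 0) 0 :=
      (hG.differentiableAt (isOpen_ball.mem_nhds (mem_ball_self (by norm_num)))).hasDerivAt
    have hb : ‖deriv G 0‖ ≤ B := by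
      have := Complex.norm_deriv_le_of_forall_mem_sphere_norm_le (c := 0) (R := 1) (C := B) (f := G) one_pos
        ((hG.mono (closedBall_subset_ball (by norm_num))).diffContOnCl_ball subset_rfl)
        (fun z hz => hGb z (by simpa using! hz.le))
      simpa using this
    have hc : HasDerivAt (fun s : ℝ => Θ (t + s * ((t + ρ * v) - t))) (deriv Θ t * (ρ * v)) 0 := by
      have h1 : HasDerivAt (fun s : ℝ => t + s * ((t + ρ * v) - t)) (ρ * v) 0 := by
        have := ((Complex.ofRealCLM.hasDerivAt (x := (0 : ℝ))).mul_const ((t + ρ * v) - t)).const_add t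
        simpa using! this
      have h2 : HasDerivAt Θ (deriv Θ t) (t + (0 : ℝ) * ((t + ρ * v) - t)) := by simpa using! ch.hasDerivAt t ht
      exact h2.comp (0 : ℝ) h1
    have hc2 : HasDerivAt (fun s : ℝ => (Φ (Θ (t + s * ((t + ρ * v) - t))) : ℂ))
        (g (Θ t) * (deriv Θ t * (ρ * v)) + conj (g (Θ t)) * conj (deriv Θ t * (ρ * v))) 0 := by
      have h1 := (hPDE _ (hΩU (ch.mapsTo ht))).1
      refine HasWD.comp_curve (f := fun z => (Φ z : ℂ)) ?_ hc
      simpa using! h1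
    have hd := uniqueDiffOn_Icc (zero_lt_one' ℝ) 0 (left_mem_Icc.2 zero_le_one)
    have heq : deriv G 0 = g (Θ t) * (deriv Θ t * (ρ * v)) + conj (g (Θ t)) * conj (deriv Θ t * (ρ * v)) := by
      refine hd.eq_deriv _ ?_ hc2.hasDerivWithinAt
      have h3 : HasDerivAt (fun s : ℝ => G s) (deriv G 0) 0 := by
        have h4 : HasDerivAt G (deriv G 0) ((0 : ℝ) : ℂ) := by rw [Complex.ofReal_zero]; exact hG0
        exact h4.comp_ofReal
      exact (h3.hasDerivWithinAt (s := Icc 0 1)).congr (fun s hs => (hGs s hs).symm)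
        (hGs 0 (left_mem_Icc.2 zero_le_one)).symm
    rw [← map_mul, Complex.add_conj, ← mul_assoc, ← hw] at heq
    rw [heq, Complex.norm_real, Real.norm_eq_abs] at hb
    exact hb
  have k1 := key 1 (by simpa using ch.add_mem t htD')
  have k2 := key Complex.I (ch.add_mem' t htD')
  have r1 : (w * (ρ * 1)).re = ρ * w.re := by simp; ring
  have r2 : (w * (ρ * Complex.I)).re = -(ρ * w.im) := by simp; ring
  rw [r1, abs_mul, abs_mul, abs_two, abs_of_pos hρ] at k1
  rw [r2, abs_mul, abs_neg, abs_mul, abs_two, abs_of_pos hρ] at k2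
  have hwB : ρ * ‖w‖ ≤ B := by
    have := Complex.norm_le_abs_re_add_abs_im w
    nlinarith
  have hgw : ‖g (Θ t)‖ ≤ 2 * ‖w‖ := by
    rw [hw, norm_mul]
    have := ch.le_deriv t ht
    nlinarith [norm_nonneg (g (Θ t))]
  have hBρ : ‖g (Θ t)‖ ≤ 2 / ρ * B := by
    rw [div_mul_eq_mul_div, le_div_iff₀ hρ]
    nlinarith
  refine hBρ.trans ?_
  have h5 : 2 / ρ ≤ Real.exp (2 / ρ * (1 + lam)) := by
    have h6 : 0 < 2 / ρ := by positivity
    have := Real.add_one_le_exp (2 / ρ * (1 + lam))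
    nlinarith
  calc 2 / ρ * B ≤ Real.exp (2 / ρ * (1 + lam)) * B := by gcongr
    _ = _ := by
      rw [hB, mul_left_comm, ← Real.exp_add]
      ring_nf

/-- Smallness of an eigenfunction on the whole domain forces smallness of its gradient. -/
lemma Geo.exists_norm_le (h : Geo Ω ε ℓ Q) : ∃ C c : ℝ, 0 ≤ C ∧ 0 < c ∧
    ∀ {lam M : ℝ} {Φ : ℂ → ℝ} {g : ℂ → ℂ}, Eig Ω Q lam M Φ g → ∀ {L : ℝ}, 0 ≤ L →
      (∀ y ∈ closure Ω, |Φ y| ≤ M * Real.exp (-L)) →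
      ∀ x ∈ closure Ω, ‖g x‖ ≤ M * Real.exp (C * (1 + lam) - c * L) := by
  have hc : IsCompact (closure Ω) := h.bounded.isCompact_closure
  have := hc.induction_on (p := fun s => ∃ C c : ℝ, 0 ≤ C ∧ 0 < c ∧
    ∀ {lam M : ℝ} {Φ : ℂ → ℝ} {g : ℂ → ℂ}, Eig Ω Q lam M Φ g → ∀ {L : ℝ}, 0 ≤ L →
      (∀ y ∈ closure Ω, |Φ y| ≤ M * Real.exp (-L)) →
      ∀ x ∈ s ∩ closure Ω, ‖g x‖ ≤ M * Real.exp (C * (1 + lam) - c * L))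
    ⟨0, 1, le_rfl, one_pos, fun e L hL _ x hx => absurd hx.1 (notMem_empty x)⟩
    (fun s t hst ⟨C, c, hC, hc, H⟩ => ⟨C, c, hC, hc, fun e L hL hy x hx => H e hL hy x ⟨hst hx.1, hx.2⟩⟩) ?_ ?_
  · obtain ⟨C, c, hC, hc, H⟩ := this
    exact ⟨C, c, hC, hc, fun e L hL hy x hx => H e hL hy x ⟨hx, hx⟩⟩
  · rintro s t ⟨C, c, hC, hc, H⟩ ⟨C', c', hC', hc', H'⟩
    refine ⟨max C C', min c c', by positivity, lt_min hc hc', fun {lam M Φ g} e {L} hL hy x hx => ?_⟩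
    have hl := e.lam_pos
    have hM := e.M_pos
    rcases hx with ⟨hx | hx, hxΩ⟩
    · refine (H e hL hy x ⟨hx, hxΩ⟩).trans ?_
      gcongr
      exacts [le_max_left _ _, min_le_left _ _]
    · refine (H' e hL hy x ⟨hx, hxΩ⟩).trans ?_
      gcongr
      exacts [le_max_right _ _, min_le_right _ _]
  · intro x hx
    obtain ⟨N, D, D', Θ, ρ, c, R, ch, hxN⟩ := h.exists_chart_at hx
    exact ⟨N, mem_nhdsWithin_of_mem_nhds (ch.isOpen.mem_nhds hxN), ch.norm_le⟩

lemma Geo.exists_large (h : Geo Ω ε ℓ Q) : ∃ C : ℝ, 0 ≤ C ∧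
    ∀ {lam M : ℝ} {Φ : ℂ → ℝ} {g : ℂ → ℂ}, Eig Ω Q lam M Φ g →
      ∃ x ∈ closure Ω, M * Real.exp (-(C * (1 + lam))) ≤ |Φ x| := by
  obtain ⟨C, c, hC, hc, H⟩ := h.exists_norm_le
  refine ⟨(C + 1) / c, by positivity, fun {lam M Φ g} e => ?_⟩
  have hl := e.lam_pos
  have hM := e.M_pos
  by_contra! hcon
  have hL : 0 < (C + 1) / c * (1 + lam) := by positivity
  obtain ⟨x, hx, hxM⟩ := e.attained
  have h1 : Real.exp (-((C + 1) / c * (1 + lam))) ≤ 1 := Real.exp_le_one_iff.2 (by linarith)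
  rcases hxM with hxM | hxM
  · have := hcon x hx
    rw [hxM] at this
    nlinarith
  · have := H e hL.le (fun y hy => (hcon y hy).le) x hx
    rw [hxM] at this
    have e2 : C * (1 + lam) - c * ((C + 1) / c * (1 + lam)) = -(1 + lam) := by
      field_simp
      ring
    rw [e2] at this
    have h3 : Real.exp (-(1 + lam)) < 1 := Real.exp_lt_one_iff.2 (by linarith)
    nlinarith

end Nodal

namespace Nodal
open Set Filter Topology Metric ComplexConjugate

/-- Propagation from a small open set to a compact connected set, by chaining local propagation. -/
lemma exists_transfer {E : Type*} [TopologicalSpace E] {X : Set E} (hX : IsCompact X) (hX' : IsPreconnected X)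
    {T : Set E → Set E → Prop}
    (hlocal : ∀ x ∈ X, ∃ N, IsOpen N ∧ x ∈ N ∧ ∀ O, IsOpen O → O ⊆ N → (O ∩ X).Nonempty → T O N)
    (hmono : ∀ {A B B'}, T A B → B' ⊆ B → T A B')
    (htrans : ∀ {A B C}, T A B → T B C → (B ∩ X).Nonempty → T A C)
    (hempty : ∀ A, T A ∅) (hunion : ∀ {A B C}, T A B → T A C → T A (B ∪ C)) :
    ∀ x ∈ X, ∃ N, IsOpen N ∧ x ∈ N ∧ ∀ O, IsOpen O → O ⊆ N → (O ∩ X).Nonempty → T O X := by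
  intro x hx
  obtain ⟨N, hN, hxN, hT⟩ := hlocal x hx
  refine ⟨N, hN, hxN, fun O hO hON hOX => ?_⟩
  have hT₀ := hT O hO hON hOX
  set u : Set E := ⋃₀ {B | IsOpen B ∧ T O B} with hu
  have huo : IsOpen u := isOpen_sUnion fun B hB => hB.1
  have hsub : X ⊆ u := by
    set v : Set E := ⋃₀ {N' | IsOpen N' ∧ ∀ B, IsOpen B → T O B → ¬ (N' ∩ B ∩ X).Nonempty} with hv
    have hcov : X ⊆ u ∪ v := by
      intro y hyX
      obtain ⟨N', hN', hyN', hT'⟩ := hlocal y hyX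
      by_cases hex : ∃ B, IsOpen B ∧ T O B ∧ (N' ∩ B ∩ X).Nonempty
      · obtain ⟨B, hB, hTB, hne⟩ := hex
        exact Or.inl (mem_sUnion.2 ⟨N', ⟨hN', htrans (hmono hTB inter_subset_right)
          (hT' _ (hN'.inter hB) inter_subset_left hne) hne⟩, hyN'⟩)
      · push Not at hex
        refine Or.inr (mem_sUnion.2 ⟨N', ⟨hN', fun B hB hTB => ?_⟩, hyN'⟩)
        rw [hex B hB hTB]
        exact not_nonempty_empty
    intro y hyX
    rcases hcov hyX with hy | hy
    · exact hy
    · obtain ⟨z, hzX, hzu, hzv⟩ := hX' u v huo (isOpen_sUnion fun B hB => hB.1) hcov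
        ⟨x, hx, mem_sUnion.2 ⟨N, ⟨hN, hT₀⟩, hxN⟩⟩ ⟨y, hyX, hy⟩
      obtain ⟨B, hB, hzB⟩ := mem_sUnion.1 hzu
      obtain ⟨N', hN', hzN'⟩ := mem_sUnion.1 hzv
      exact absurd ⟨z, ⟨hzN', hzB⟩, hzX⟩ (hN'.2 B hB.1 hB.2)
  refine hX.induction_on (p := T O) (hempty O) (fun s t hst ht => hmono ht hst) (fun s t => hunion) ?_
  intro y hy
  obtain ⟨B, hB, hyB⟩ := mem_sUnion.1 (hsub hy)
  exact ⟨B, mem_nhdsWithin_of_mem_nhds (hB.1.mem_nhds hyB), hB.2⟩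

variable {Ω : Set ℂ} {ε ℓ : ℝ} {Q : ℂ → ℂ}

lemma Chart.transfer {N D D' : Set ℂ} {Θ : ℂ → ℂ} {ρ R : ℝ} {c : ℂ} (ch : Chart Ω Q N D D' Θ ρ c R)
    {O : Set ℂ} (hO : IsOpen O) (hON : O ⊆ N) (hne : (O ∩ closure Ω).Nonempty) :
    ∃ C c : ℝ, 0 ≤ C ∧ 0 < c ∧ ∀ {lam M : ℝ} {Φ : ℂ → ℝ} {g : ℂ → ℂ}, Eig Ω Q lam M Φ g → ∀ {L : ℝ}, 0 ≤ L →
      (∀ y ∈ O ∩ closure Ω, |Φ y| ≤ M * Real.exp (-L)) →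
      ∀ y ∈ N ∩ closure Ω, |Φ y| ≤ M * Real.exp (C * (1 + lam) - c * L) := by
  obtain ⟨y, hyO, hyΩ⟩ := hne
  obtain ⟨t, htD', rfl⟩ := ch.subset_image ⟨hON hyO, hyΩ⟩
  have ht := ch.subset htD'
  obtain ⟨η, hη, hball⟩ := Metric.mem_nhds_iff.1 ((ch.hasDerivAt t ht).continuousAt (hO.mem_nhds hyO))
  obtain ⟨α, hα, hprop⟩ := ch.exists_propagation (s₀ := min 1 (η / 2)) (by positivity) (min_le_left _ _)
  refine ⟨10, α, by norm_num, hα, fun {lam M Φ g} e {L} hL hy => ?_⟩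
  rintro _ hx
  obtain ⟨t', ht'D, rfl⟩ := ch.subset_image hx
  have ht' := ch.subset ht'D
  have hsmall : ∀ s ∈ Icc (0 : ℝ) (min 1 (η / 2)), |Φ (Θ (t + s * (t' - t)))| ≤ M * Real.exp (-L) := by
    intro s hs
    have hs1 := hs.2.trans (min_le_left _ _)
    have hs2 := hs.2.trans (min_le_right _ _)
    refine hy _ ⟨hball ?_, ch.mapsTo (by simpa using! ch.convex.add_smul_sub_mem ht ht' ⟨hs.1, hs1⟩)⟩
    rw [mem_ball_iff_norm, add_sub_cancel_left, norm_mul, Complex.norm_real, Real.norm_of_nonneg hs.1]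
    have := ch.dist_le t ht t' ht'
    nlinarith [norm_nonneg (t' - t), hs.1]
  obtain ⟨G, -, hGs, hGb⟩ := hprop e t ht t' ht' hL hsmall
  have h1 := hGs 1 (right_mem_Icc.2 zero_le_one)
  have h2 := hGb 1 (by simp)
  have e1 : t + ((1 : ℝ) : ℂ) * (t' - t) = t' := by simp
  rw [e1, Complex.ofReal_one] at h1
  rwa [h1, Complex.norm_real, Real.norm_eq_abs] at h2

/-- Smallness of an eigenfunction near a point propagates to the whole domain. -/
lemma Geo.exists_transfer (h : Geo Ω ε ℓ Q) {x : ℂ} (hx : x ∈ closure Ω) : ∃ N, IsOpen N ∧ x ∈ N ∧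
    ∀ O, IsOpen O → O ⊆ N → (O ∩ closure Ω).Nonempty → ∃ C c : ℝ, 0 ≤ C ∧ 0 < c ∧
    ∀ {lam M : ℝ} {Φ : ℂ → ℝ} {g : ℂ → ℂ}, Eig Ω Q lam M Φ g → ∀ {L : ℝ}, 0 ≤ L →
      (∀ y ∈ O ∩ closure Ω, |Φ y| ≤ M * Real.exp (-L)) →
      ∀ y ∈ closure Ω, |Φ y| ≤ M * Real.exp (C * (1 + lam) - c * L) := by
  have hc : IsCompact (closure Ω) := h.bounded.isCompact_closure
  have key := Nodal.exists_transfer hc h.connected.isPreconnected.closure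
    (T := fun O N => ∃ C c : ℝ, 0 ≤ C ∧ 0 < c ∧
      ∀ {lam M : ℝ} {Φ : ℂ → ℝ} {g : ℂ → ℂ}, Eig Ω Q lam M Φ g → ∀ {L : ℝ}, 0 ≤ L →
      (∀ y ∈ O ∩ closure Ω, |Φ y| ≤ M * Real.exp (-L)) →
      ∀ y ∈ N ∩ closure Ω, |Φ y| ≤ M * Real.exp (C * (1 + lam) - c * L)) ?_ ?_ ?_ ?_ ?_ x hx
  · obtain ⟨N, hN, hxN, H⟩ := key
    refine ⟨N, hN, hxN, fun O hO hON hne => ?_⟩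
    obtain ⟨C, c, hC, hc, H⟩ := H O hO hON hne
    exact ⟨C, c, hC, hc, fun e L hL hy y hyΩ => H e hL hy y ⟨hyΩ, hyΩ⟩⟩
  · intro x hx
    obtain ⟨N, D, D', Θ, ρ, c, R, ch, hxN⟩ := h.exists_chart_at hx
    exact ⟨N, ch.isOpen, hxN, fun O hO hON hne => ch.transfer hO hON hne⟩
  · rintro A B B' ⟨C, c, hC, hc, H⟩ hB
    exact ⟨C, c, hC, hc, fun e L hL hy y hyB => H e hL hy y ⟨hB hyB.1, hyB.2⟩⟩
  · rintro A B B' ⟨C₁, c₁, hC₁, hc₁, H₁⟩ ⟨C₂, c₂, hC₂, hc₂, H₂⟩ -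
    refine ⟨C₂ + c₂ * C₁, c₂ * c₁, by positivity, by positivity, fun {lam M Φ g} e {L} hL hy y hyB => ?_⟩
    have hl := e.lam_pos
    have hM := e.M_pos
    have e1 : (C₂ + c₂ * C₁) * (1 + lam) - c₂ * c₁ * L = C₂ * (1 + lam) - c₂ * (c₁ * L - C₁ * (1 + lam)) := by ring
    rw [e1]
    rcases le_total 0 (c₁ * L - C₁ * (1 + lam)) with hL' | hL'
    · refine H₂ e hL' (fun z hz => ?_) y hyB
      rw [neg_sub]
      exact H₁ e hL hy z hz
    · refine (e.abs_le y hyB.2).trans (le_mul_of_one_le_right hM.le (Real.one_le_exp ?_))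
      have : 0 ≤ C₂ * (1 + lam) := by positivity
      nlinarith
  · exact fun A => ⟨0, 1, le_rfl, one_pos, fun e L hL _ x hx => absurd hx.1 (notMem_empty x)⟩
  · rintro A B B' ⟨C, c, hC, hc, H⟩ ⟨C', c', hC', hc', H'⟩
    refine ⟨max C C', min c c', by positivity, lt_min hc hc', fun {lam M Φ g} e {L} hL hy x hx => ?_⟩
    have hl := e.lam_pos
    have hM := e.M_pos
    rcases hx with ⟨hx | hx, hxΩ⟩
    · refine (H e hL hy x ⟨hx, hxΩ⟩).trans ?_
      gcongr
      exacts [le_max_left _ _, min_le_left _ _]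
    · refine (H' e hL hy x ⟨hx, hxΩ⟩).trans ?_
      gcongr
      exacts [le_max_right _ _, min_le_right _ _]

/-- The boundary values of an eigenfunction are not too small on a complex strip. -/
lemma Geo.exists_boundary_large (h : Geo Ω ε ℓ Q) : ∃ C : ℝ, 0 ≤ C ∧
    ∀ {lam M : ℝ} {Φ : ℂ → ℝ} {g F : ℂ → ℂ}, Eig Ω Q lam M Φ g →
      (∀ t ∈ strip ε, 0 ≤ t.im → (Φ (Q t) : ℂ) = rhs Q F (lam ^ 2 / 4) t (conj t)) →
      ∃ t ∈ strip (ε / 2), M * Real.exp (-(C * (1 + lam))) ≤ ‖F t‖ := by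
  have hε := h.ε_pos
  obtain ⟨C₁, hC₁, H₁⟩ := h.exists_large
  have hQ0 : Q ((0 : ℝ) : ℂ) ∈ closure Ω := h.mem_closure (ofReal_mem_strip hε 0) (by simp)
  obtain ⟨N, hN, hxN, H⟩ := h.exists_transfer hQ0
  obtain ⟨N', hN', hxN', hNs⟩ := h.exists_chart 0 (ε / 2) (by positivity) (by linarith)
  obtain ⟨C₂, c, hC₂, hc, H₂⟩ := H (N ∩ N') (hN.inter hN') inter_subset_left ⟨_, ⟨hxN, hxN'⟩, hQ0⟩
  refine ⟨5 + (C₁ + C₂ + 1) / c, by positivity, fun {lam M Φ g F} e hFr => ?_⟩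
  have hl := e.lam_pos
  have hM := e.M_pos
  by_contra! hcon
  have hL : 0 ≤ (C₁ + C₂ + 1) / c * (1 + lam) := by positivity
  obtain ⟨x, hx, hxM⟩ := H₁ e
  have key := H₂ e hL (fun y hy => ?_) x hx
  · have e1 : C₂ * (1 + lam) - c * ((C₁ + C₂ + 1) / c * (1 + lam)) = -(C₁ * (1 + lam)) - (1 + lam) := by
      field_simp
      ring
    rw [e1] at key
    have h2 : Real.exp (-(C₁ * (1 + lam)) - (1 + lam)) < Real.exp (-(C₁ * (1 + lam))) := Real.exp_lt_exp.2 (by linarith)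
    nlinarith
  · obtain ⟨t, ⟨htb, ht0⟩, rfl⟩ := hNs ⟨hy.1.2, hy.2⟩
    have hts := ball_subset_strip 0 le_rfl htb
    have hts' := strip_mono (show ε / 2 ≤ ε by linarith) hts
    have := norm_rhs_le h hl.le (by linarith) (fun t ht => (hcon t ht).le) hts (conj_mem_strip hts)
      (norm_sub_conj_le hts' h.ε_le_one)
    rw [← hFr t hts' ht0, Complex.norm_real, Real.norm_eq_abs, mul_assoc, ← Real.exp_add] at this
    refine this.trans (le_of_eq ?_)
    ring_nf

end Nodal

namespace Nodal
open Set Filter Topology Metric ComplexConjugate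

variable {Ω : Set ℂ} {ε ℓ : ℝ} {Q : ℂ → ℂ}

lemma Chart.sub_le {N D D' : Set ℂ} {Θ : ℂ → ℂ} {ρ R : ℝ} {c : ℂ} (ch : Chart Ω Q N D D' Θ ρ c R)
    {lam M S δ : ℝ} {Φ : ℂ → ℝ} {g : ℂ → ℂ} (e : Eig Ω Q lam M Φ g) (hlam : lam ≤ 1)
    (hS : ∀ y ∈ closure Ω, Φ y ≤ S) {x y : ℂ} (hx : x ∈ N ∩ closure Ω) (hxδ : S - Φ x ≤ δ)
    (hy : y ∈ N ∩ closure Ω) : S - Φ y ≤ 9 * δ + 18 * Real.exp 16 * lam ^ 2 * M := by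
  obtain ⟨H, hH, h1, h2⟩ := ch.harm e hlam
  obtain ⟨t, ht, rfl⟩ := ch.subset_image hx
  obtain ⟨t', ht', rfl⟩ := ch.subset_image hy
  have := harnack (w := fun z => ((S + Real.exp 16 * lam ^ 2 * M : ℝ) : ℂ) - H z)
    (hH.const_sub _) (fun z hz => ?_) (ch.subset_ball ht) (ch.subset_ball ht')
  · simp only [Complex.sub_re, Complex.ofReal_re] at this
    have h3 := abs_le.1 (h2 t ht)
    have h4 := abs_le.1 (h2 t' ht')
    linarith [h3.1, h3.2, h4.1, h4.2]
  · obtain ⟨y, hy, hyH⟩ := h1 z hz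
    have := abs_le.1 hyH
    have := hS y hy
    simp only [Complex.sub_re, Complex.ofReal_re]
    linarith

/-- For small frequencies, eigenfunctions are close to their maximum. -/
lemma Geo.exists_sub_le (h : Geo Ω ε ℓ Q) : ∃ C : ℝ, 0 ≤ C ∧
    ∀ {lam M S : ℝ} {Φ : ℂ → ℝ} {g : ℂ → ℂ}, Eig Ω Q lam M Φ g → lam ≤ 1 → (∀ y ∈ closure Ω, Φ y ≤ S) →
      (∃ x ∈ closure Ω, Φ x = S) → ∀ y ∈ closure Ω, S - Φ y ≤ C * lam ^ 2 * M := by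
  have hc : IsCompact (closure Ω) := h.bounded.isCompact_closure
  have key := Nodal.exists_transfer hc h.connected.isPreconnected.closure
    (T := fun O N => ∃ C : ℝ, 0 ≤ C ∧ ∀ {lam M S δ : ℝ} {Φ : ℂ → ℝ} {g : ℂ → ℂ}, Eig Ω Q lam M Φ g → lam ≤ 1 →
      0 ≤ δ → (∀ y ∈ closure Ω, Φ y ≤ S) → (∃ x ∈ O ∩ closure Ω, S - Φ x ≤ δ) →
      ∀ y ∈ N ∩ closure Ω, S - Φ y ≤ C * (δ + lam ^ 2 * M)) ?_ ?_ ?_ ?_ ?_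
  · have := hc.induction_on (p := fun s => ∃ C : ℝ, 0 ≤ C ∧ ∀ {lam M S : ℝ} {Φ : ℂ → ℝ} {g : ℂ → ℂ},
      Eig Ω Q lam M Φ g → lam ≤ 1 → (∀ y ∈ closure Ω, Φ y ≤ S) →
      (∃ x ∈ s ∩ closure Ω, Φ x = S) → ∀ y ∈ closure Ω, S - Φ y ≤ C * lam ^ 2 * M)
      ⟨0, le_rfl, fun e _ _ ⟨x, hx, _⟩ => absurd hx.1 (notMem_empty x)⟩
      (fun s t hst ⟨C, hC, H⟩ => ⟨C, hC, fun e hlam hS ⟨x, hx, hxS⟩ => H e hlam hS ⟨x, ⟨hst hx.1, hx.2⟩, hxS⟩⟩) ?_ ?_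
    · obtain ⟨C, hC, H⟩ := this
      exact ⟨C, hC, fun e hlam hS ⟨x, hx, hxS⟩ => H e hlam hS ⟨x, ⟨hx, hx⟩, hxS⟩⟩
    · rintro s t ⟨C, hC, H⟩ ⟨C', hC', H'⟩
      refine ⟨max C C', by positivity, fun {lam M S Φ g} e hlam hS ⟨x, hx, hxS⟩ y hy => ?_⟩
      have hl := e.lam_pos
      have hM := e.M_pos
      rcases hx with ⟨hx | hx, hxΩ⟩
      · refine (H e hlam hS ⟨x, ⟨hx, hxΩ⟩, hxS⟩ y hy).trans ?_
        gcongr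
        exact le_max_left _ _
      · refine (H' e hlam hS ⟨x, ⟨hx, hxΩ⟩, hxS⟩ y hy).trans ?_
        gcongr
        exact le_max_right _ _
    · intro x hx
      obtain ⟨N, hN, hxN, H⟩ := key x hx
      obtain ⟨C, hC, H⟩ := H N hN subset_rfl ⟨x, hxN, hx⟩
      refine ⟨N, mem_nhdsWithin_of_mem_nhds (hN.mem_nhds hxN), C, hC, fun e hlam hS ⟨z, hz, hzS⟩ y hy => ?_⟩
      have := H e hlam le_rfl hS ⟨z, hz, by rw [hzS, sub_self]⟩ y ⟨hy, hy⟩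
      rwa [zero_add, ← mul_assoc] at this
  · intro x hx
    obtain ⟨N, D, D', Θ, ρ, c, R, ch, hxN⟩ := h.exists_chart_at hx
    refine ⟨N, ch.isOpen, hxN, fun O hO hON _ => ⟨18 * Real.exp 16, by positivity, ?_⟩⟩
    rintro lam M S δ Φ g e hlam hδ hS ⟨x, hx, hxδ⟩ y hy
    refine (ch.sub_le e hlam hS ⟨hON hx.1, hx.2⟩ hxδ hy).trans ?_
    have : 1 ≤ Real.exp 16 := Real.one_le_exp (by norm_num)
    nlinarith
  · rintro A B B' ⟨C, hC, H⟩ hB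
    exact ⟨C, hC, fun e hlam hδ hS hx y hy => H e hlam hδ hS hx y ⟨hB hy.1, hy.2⟩⟩
  · rintro A B B' ⟨C₁, hC₁, H₁⟩ ⟨C₂, hC₂, H₂⟩ ⟨z, hz⟩
    refine ⟨C₂ * (C₁ + 1), by positivity, fun {lam M S δ Φ g} e hlam hδ hS hx y hy => ?_⟩
    have hl := e.lam_pos
    have hM := e.M_pos
    refine (H₂ e hlam (by positivity) hS ⟨z, hz, H₁ e hlam hδ hS hx z hz⟩ y hy).trans ?_
    rw [mul_assoc]
    gcongr
    linarith
  · exact fun A => ⟨0, le_rfl, fun e _ _ _ _ x hx => absurd hx.1 (notMem_empty x)⟩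
  · rintro A B B' ⟨C, hC, H⟩ ⟨C', hC', H'⟩
    refine ⟨max C C', by positivity, fun {lam M S δ Φ g} e hlam hδ hS hx y hy => ?_⟩
    have hl := e.lam_pos
    have hM := e.M_pos
    rcases hy with ⟨hy | hy, hyΩ⟩
    · refine (H e hlam hδ hS hx y ⟨hy, hyΩ⟩).trans ?_
      gcongr
      exact le_max_left _ _
    · refine (H' e hlam hδ hS hx y ⟨hy, hyΩ⟩).trans ?_
      gcongr
      exact le_max_right _ _

lemma Eig.neg {lam M : ℝ} {Φ : ℂ → ℝ} {g : ℂ → ℂ} (e : Eig Ω Q lam M Φ g) :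
    Eig Ω Q lam M (fun z => -Φ z) (fun z => -g z) := by
  obtain ⟨U, hU, hΩU, hPDE⟩ := e.exists_nhd
  refine ⟨e.lam_pos, e.M_pos, ⟨U, hU, hΩU, fun z hz => ⟨?_, ?_⟩⟩, fun s => ?_, fun x hx => ?_, fun x hx => ?_, ?_⟩
  · have := (hPDE z hz).1.neg
    simpa using! this
  · obtain ⟨m, hm⟩ := (hPDE z hz).2
    exact ⟨-m, hm.neg.congr_deriv rfl (by push_cast; ring)⟩
  · have := e.neumann s
    rw [neg_mul, Complex.neg_im, this, neg_zero]
  · rw [abs_neg]; exact e.abs_le x hx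
  · rw [norm_neg]; exact e.norm_le x hx
  · obtain ⟨x, hx, hxM⟩ := e.attained
    exact ⟨x, hx, by rwa [abs_neg, norm_neg]⟩

lemma Eig.continuousOn {lam M : ℝ} {Φ : ℂ → ℝ} {g : ℂ → ℂ} (e : Eig Ω Q lam M Φ g) :
    ContinuousOn Φ (closure Ω) := by
  obtain ⟨U, hU, hΩU, hPDE⟩ := e.exists_nhd
  intro z hz
  have := (hPDE z (hΩU hz)).1.continuousAt
  have h2 := Complex.continuous_re.continuousAt.comp this
  exact ContinuousAt.continuousWithinAt (by simpa [Function.comp_def] using h2)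

/-- For small frequencies, the boundary values of eigenfunctions have no zeros in the strip. -/
lemma Geo.exists_ne_zero (h : Geo Ω ε ℓ Q) : ∃ lam₀ : ℝ, 0 < lam₀ ∧
    ∀ {lam M : ℝ} {Φ : ℂ → ℝ} {g F : ℂ → ℂ}, Eig Ω Q lam M Φ g → lam ≤ lam₀ →
      (∀ t ∈ strip ε, ‖F t‖ ≤ M * Real.exp (5 * (1 + lam))) → (∀ t ∈ strip ε, F (conj t) = conj (F t)) →
      (∀ t ∈ strip ε, 0 ≤ t.im → (Φ (Q t) : ℂ) = rhs Q F (lam ^ 2 / 4) t (conj t)) →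
      ∀ t ∈ strip ε, F t ≠ 0 := by
  obtain ⟨C₁, hC₁, H₁⟩ := h.exists_large
  obtain ⟨C₂, hC₂, H₂⟩ := h.exists_sub_le
  have hc : IsCompact (closure Ω) := h.bounded.isCompact_closure
  set κ := Real.exp (-(C₁ * 2)) with hκ
  set B := C₂ + Real.exp 16 with hB
  have hκ0 : 0 < κ := Real.exp_pos _
  have hB0 : 0 < B := by positivity
  refine ⟨min 1 (κ / (2 * B)), by positivity, fun {lam M Φ g F} e hlam hFA hFc hFr => ?_⟩
  have hl := e.lam_pos
  have hM := e.M_pos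
  have hlam1 : lam ≤ 1 := hlam.trans (min_le_left _ _)
  have hlamκ : lam ^ 2 * B < κ := by
    have h1 : lam * (2 * B) ≤ κ := by
      rw [← le_div_iff₀ (by positivity)]
      exact hlam.trans (min_le_right _ _)
    nlinarith [mul_pos hl hB0]
  -- the pointwise lower bound when `Φ` has a large positive maximum
  have pos : ∀ {Φ : ℂ → ℝ} {g : ℂ → ℂ}, Eig Ω Q lam M Φ g → (∃ x ∈ closure Ω, M * κ ≤ Φ x) →
      ∀ y ∈ closure Ω, M * (Real.exp 16 * lam ^ 2) < Φ y := by
    rintro Φ g e ⟨x, hx, hxM⟩ y hy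
    obtain ⟨z, hz, hzmax⟩ := hc.exists_isMaxOn ⟨x, hx⟩ e.continuousOn
    have h1 := H₂ e hlam1 (fun y hy => hzmax hy) ⟨z, hz, rfl⟩ y hy
    have h2 : Φ x ≤ Φ z := hzmax hx
    have h3 : M * (lam ^ 2 * B) < M * κ := by gcongr
    rw [hB] at h3
    linarith
  have lower : ∀ y ∈ closure Ω, M * (Real.exp 16 * lam ^ 2) < |Φ y| := by
    obtain ⟨x, hx, hxM⟩ := H₁ e
    have hxM' : M * κ ≤ |Φ x| := by
      refine le_trans ?_ hxM
      rw [hκ]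
      gcongr
      linarith
    rcases le_total 0 (Φ x) with h0 | h0
    · rw [abs_of_nonneg h0] at hxM'
      exact fun y hy => (pos e ⟨x, hx, hxM'⟩ y hy).trans_le (le_abs_self _)
    · rw [abs_of_nonpos h0] at hxM'
      exact fun y hy => (pos e.neg ⟨x, hx, hxM'⟩ y hy).trans_le (neg_le_abs _)
  have upper : ∀ t ∈ strip ε, 0 ≤ t.im → F t ≠ 0 := by
    intro t ht ht0 hFt
    have h1 := e.abs_sub_re_boundary h hlam1 hFA hFc hFr ht ht0
    have h2 := lower _ (h.mem_closure ht ht0)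
    rw [hFt, Complex.zero_re, sub_zero] at h1
    linarith
  intro t ht
  rcases le_total 0 t.im with h0 | h0
  · exact upper t ht h0
  · intro hFt
    refine upper (conj t) (conj_mem_strip ht) (by simpa using h0) ?_
    rw [hFc t ht, hFt, map_zero]

end Nodal

namespace Nodal
open Set Filter Topology Metric ComplexConjugate

lemma isCompact_rectangle (a b : ℝ) : IsCompact {t : ℂ | |t.re| ≤ a ∧ |t.im| ≤ b} := by
  have : {t : ℂ | |t.re| ≤ a ∧ |t.im| ≤ b} = Icc (-a) a ×ℂ Icc (-b) b := by
    ext t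
    simp [Complex.mem_reProdIm, abs_le]
  rw [this]
  exact isCompact_Icc.reProdIm isCompact_Icc

/-- Complexified boundary values of eigenfunctions, with a linear bound on the number of zeros. -/
lemma Geo.exists_zero_count {Ω : Set ℂ} {ε ℓ : ℝ} {Q : ℂ → ℂ} (h : Geo Ω ε ℓ Q) : ∃ C : ℝ, 0 < C ∧
    ∀ {lam M : ℝ} {Φ : ℂ → ℝ} {g : ℂ → ℂ}, Eig Ω Q lam M Φ g → ∃ F : ℂ → ℂ, DifferentiableOn ℂ F (strip ε) ∧
      (∀ t ∈ strip ε, F (t + ℓ) = F t) ∧ (∀ s : ℝ, F s = Φ (Q s)) ∧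
      {t ∈ {t : ℂ | |t.re| ≤ ℓ ∧ |t.im| ≤ ε / 2} | F t = 0}.Finite ∧
      ({t ∈ {t : ℂ | |t.re| ≤ ℓ ∧ |t.im| ≤ ε / 2} | F t = 0}.ncard : ℝ) ≤ C * lam := by
  have hε := h.ε_pos
  have hℓ := h.ℓ_pos
  set K := {t : ℂ | |t.re| ≤ ℓ ∧ |t.im| ≤ ε / 2} with hK
  have hKs : K ⊆ strip ε := fun t ht => lt_of_le_of_lt ht.2 (by linarith)
  obtain ⟨C₁, hC₁, H₁⟩ := Nodal.exists_zero_count hε (isCompact_rectangle ℓ (ε / 2)) hKs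
  obtain ⟨C₂, hC₂, H₂⟩ := h.exists_boundary_large
  obtain ⟨lam₀, hlam₀, H₃⟩ := h.exists_ne_zero
  refine ⟨C₁ * (5 + C₂) * (1 / lam₀ + 1), by positivity, fun {lam M Φ g} e => ?_⟩
  have hl := e.lam_pos
  have hM := e.M_pos
  obtain ⟨F, hF, hFq, hFA, hFc, hFr⟩ := e.exists_boundary h
  have hper : ∀ t ∈ strip ε, F (t + ℓ) = F t := by
    refine periodic_of_real hε hF fun s => ?_
    rw [hFq, hFq, Complex.ofReal_add, h.periodic _ (ofReal_mem_strip hε s)]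
  refine ⟨F, hF, hper, hFq, ?_⟩
  rcases le_or_gt lam lam₀ with hle | hgt
  · have : {t ∈ K | F t = 0} = ∅ := by
      ext t
      simp only [mem_sep_iff, mem_empty_iff_false, iff_false, not_and]
      exact fun ht => H₃ e hle hFA hFc hFr t (hKs ht)
    rw [this]
    refine ⟨finite_empty, ?_⟩
    rw [ncard_empty, Nat.cast_zero]
    positivity
  · obtain ⟨t, ht, htF⟩ := H₂ e hFr
    obtain ⟨k, hk, -⟩ := existsUnique_add_zsmul_mem_Ico hℓ t.re 0
    rw [zero_add, zsmul_eq_mul] at hk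
    have htK : t + (k * ℓ : ℝ) ∈ K := by
      have ht' : |t.im| < ε / 2 := ht
      refine ⟨?_, ?_⟩
      · rw [Complex.add_re, Complex.ofReal_re, abs_of_nonneg hk.1]
        exact hk.2.le
      · rw [Complex.add_im, Complex.ofReal_im, add_zero]
        exact ht'.le
    obtain ⟨h1, h2⟩ := H₁ (b := (5 + C₂) * (1 + lam)) hF (by positivity) hFA ⟨_, htK, by
      rw [periodic_int hper (strip_mono (by linarith) ht) k]
      refine le_trans (le_of_eq ?_) htF
      rw [mul_assoc, ← Real.exp_add]
      ring_nf⟩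
    refine ⟨h1, h2.trans ?_⟩
    have h3 : 1 + lam ≤ (1 / lam₀ + 1) * lam := by
      have : 1 ≤ 1 / lam₀ * lam := by
        rw [one_div_mul_eq_div, one_le_div hlam₀]
        exact hgt.le
      linarith
    calc C₁ * ((5 + C₂) * (1 + lam)) ≤ C₁ * ((5 + C₂) * ((1 / lam₀ + 1) * lam)) := by gcongr
      _ = _ := by ring

end Nodal

namespace Nodal
open Set Filter Topology Metric ComplexConjugate

/-- The Wirtinger derivative `∂Φ` of a real function. -/
def wgrad (Φ : ℂ → ℝ) (z : ℂ) : ℂ :=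
  ((fderiv ℝ Φ z 1 : ℝ) - Complex.I * (fderiv ℝ Φ z Complex.I : ℝ)) / 2

lemma clm_eq_re_im {E : Type*} [NormedAddCommGroup E] [NormedSpace ℝ E] (L : ℂ →L[ℝ] E) (h : ℂ) :
    L h = h.re • L 1 + h.im • L Complex.I := by
  rw [← map_smul, ← map_smul, ← map_add]
  congr 1
  apply Complex.ext
  all_goals simp

lemma wgrad_mul_re (Φ : ℂ → ℝ) (z h : ℂ) : (wgrad Φ z * h).re = fderiv ℝ Φ z h / 2 := by
  rw [clm_eq_re_im (fderiv ℝ Φ z) h]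
  simp [wgrad]
  ring

lemma hasWD_ofReal {Φ : ℂ → ℝ} {z : ℂ} (h : DifferentiableAt ℝ Φ z) :
    HasWD (fun z => (Φ z : ℂ)) (wgrad Φ z) (conj (wgrad Φ z)) z := by
  refine (Complex.ofRealCLM.hasFDerivAt.comp z h.hasFDerivAt).congr_fderiv ?_
  refine ContinuousLinearMap.ext fun k => ?_
  have := wgrad_mul_re Φ z k
  rw [wd_apply, ← map_mul, Complex.add_conj, this]
  simp; ring

/-- The derivative of `∂Φ`, with `∂̄∂Φ` expressed by the Laplacian. -/
lemma exists_hasWD_wgrad {Φ : ℂ → ℝ} {z : ℂ} (h : AnalyticAt ℝ Φ z) :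
    ∃ m, HasWD (wgrad Φ) m (((fderiv ℝ (fderiv ℝ Φ) z 1 1 +
      fderiv ℝ (fderiv ℝ Φ) z Complex.I Complex.I) / 4 : ℝ) : ℂ) z := by
  have hs : IsSymmSndFDerivAt ℝ Φ z := h.contDiffAt.isSymmSndFDerivAt_of_omega
  have hS := h.fderiv.differentiableAt.hasFDerivAt
  set S := fderiv ℝ (fderiv ℝ Φ) z with hSdef
  have key (v : ℂ) : HasFDerivAt (fun z => ((fderiv ℝ Φ z v : ℝ) : ℂ))
      (Complex.ofRealCLM.comp (S.flip v)) z := by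
    refine (Complex.ofRealCLM.hasFDerivAt.comp z (hS.clm_apply (hasFDerivAt_const v z))).congr_fderiv ?_
    ext k
    all_goals simp
  have hd := ((key 1).sub ((key Complex.I).const_mul Complex.I)).mul_const (1 / 2 : ℂ)
  refine ⟨((S 1 1 : ℝ) - (S Complex.I Complex.I : ℝ) - 2 * Complex.I * (S 1 Complex.I : ℝ)) / 4, ?_⟩
  have h2 := hd.congr_of_eventuallyEq (f₁ := wgrad Φ) (Eventually.of_forall fun w => by
    simp only [wgrad, Pi.sub_apply]; ring)
  refine h2.congr_fderiv ?_
  have hsym : S Complex.I 1 = S 1 Complex.I := hs.eq _ _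
  refine ContinuousLinearMap.ext fun k => ?_
  rw [clm_eq_re_im (_ : ℂ →L[ℝ] ℂ) k, clm_eq_re_im (wd _ _) k]
  congr 2
  · simp; ring
  · simp [hsym]; linear_combination (S 1 Complex.I : ℂ) / 2 * Complex.I_sq

/-- The identification of the complex plane with the Euclidean plane. -/
def toE : ℂ ≃ₗᵢ[ℝ] E2 := Complex.orthonormalBasisOneI.repr

lemma toE_one : toE 1 = EuclideanSpace.single 0 1 := by
  ext i; fin_cases i <;> simp [toE]

lemma toE_I : toE Complex.I = EuclideanSpace.single 1 1 := by
  ext i; fin_cases i <;> simp [toE]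

lemma fderiv_comp_toE (f : E2 → ℝ) (z h : ℂ) :
    fderiv ℝ (fun z => f (toE z)) z h = fderiv ℝ f (toE z) (toE h) := by
  have := toE.toContinuousLinearEquiv.comp_right_fderiv (f := f) (x := z)
  exact DFunLike.congr_fun this h

lemma lap_toE {φ : E2 → ℝ} {z : ℂ} (h : AnalyticAt ℝ (fun z => φ (toE z)) z) :
    lap φ (toE z) = fderiv ℝ (fderiv ℝ fun z => φ (toE z)) z 1 1 +
      fderiv ℝ (fderiv ℝ fun z => φ (toE z)) z Complex.I Complex.I := by
  have key (v : ℂ) : fderiv ℝ (fun y => fderiv ℝ φ y (toE v)) (toE z) (toE v) =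
      fderiv ℝ (fderiv ℝ fun z => φ (toE z)) z v v := by
    rw [← fderiv_comp_toE (fun y => fderiv ℝ φ y (toE v))]
    simp only [← fderiv_comp_toE]
    have := (h.fderiv.differentiableAt.hasFDerivAt.clm_apply (hasFDerivAt_const v z)).fderiv
    rw [this]; simp
  rw [lap, Fin.sum_univ_two, ← toE_one, ← toE_I, key, key]

variable {Ω : Set E2}

lemma preimage_toE (s : Set E2) : toE ⁻¹' s = toE.symm '' s :=
  (toE.toEquiv.image_symm_eq_preimage s).symm

lemma closure_toE (s : Set E2) : closure (toE ⁻¹' s) = toE ⁻¹' closure s :=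
  (toE.toHomeomorph.preimage_closure s).symm

lemma hasDerivAt_toE_symm (B : BoundaryParam Ω) (s : ℝ) :
    HasDerivAt (fun s => toE.symm (B.q s)) (toE.symm (B.qd s)) s :=
  toE.symm.toContinuousLinearEquiv.toContinuousLinearMap.hasFDerivAt.comp_hasDerivAt s (B.hasDerivAt s)

lemma bdry_toE (hΩ : IsPlaneDomain Ω) (B : BoundaryParam Ω) (hB : B.IsAnalytic) :
    Bdry (toE ⁻¹' Ω) B.len (fun s => toE.symm (B.q s)) where
  isOpen := hΩ.isOpen.preimage toE.continuous
  bounded := by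
    rw [preimage_toE]
    exact toE.symm.lipschitz.isBounded_image hΩ.isBounded
  connected := by
    rw [preimage_toE]
    exact hΩ.isConnected.image _ toE.symm.continuous.continuousOn
  ℓ_pos := B.len_pos
  analytic s := (toE.symm.toContinuousLinearEquiv.toContinuousLinearMap.analyticAt _).comp
    (hB s (mem_univ s))
  periodic s := by simp only [B.periodic s]
  inj x hx y hy hxy := B.injOn hx hy (toE.symm.injective hxy)
  unit s := by
    rw [(hasDerivAt_toE_symm B s).deriv]
    exact (toE.symm.norm_map _).trans (B.unitSpeed s)
  range_eq := by
    have : toE ⁻¹' frontier Ω = frontier (toE ⁻¹' Ω) := toE.toHomeomorph.preimage_frontier Ω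
    rw [← this, ← B.range_eq, preimage_toE, ← range_comp]
    rfl

/-- A complex number orthogonal to a unit vector `n` is a real multiple of `i n`. -/
lemma im_mul_eq_zero {g n d : ℂ} (hn : ‖n‖ = 1) (hg : (g * n).re = 0) (hd : (conj n * d).re = 0) :
    (g * d).im = 0 := by
  have h1 : n * conj n = 1 := by rw [Complex.mul_conj']; simp [hn]
  have h2 : g * d = (g * n) * (conj n * d) := by linear_combination -(g * d) * h1
  rw [h2, Complex.mul_im, hg, hd]; ring

lemma neumann_toE (B : BoundaryParam Ω) {lam : ℝ} {φ : E2 → ℝ} (h : IsNeumannEigenfunction B lam φ) (s : ℝ) :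
    (wgrad (fun z => φ (toE z)) (toE.symm (B.q s)) * toE.symm (B.qd s)).im = 0 := by
  refine im_mul_eq_zero (n := toE.symm (B.ν s)) ((toE.symm.norm_map _).trans (B.ν_unit s)) ?_ ?_
  · rw [wgrad_mul_re, fderiv_comp_toE, toE.apply_symm_apply, toE.apply_symm_apply, ← inner_gradient_left,
      h.neumann, zero_div]
  · have := B.ν_orth s
    rw [← toE.symm.inner_map_map, Complex.inner, mul_comm] at this
    exact this

/-- The Helmholtz equation persists on a neighbourhood of the closed domain. -/
lemma exists_nhd_toE (hΩ : IsPlaneDomain Ω) (B : BoundaryParam Ω) {lam : ℝ} {φ : E2 → ℝ}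
    (h : IsNeumannEigenfunction B lam φ) :
    ∃ U, IsOpen U ∧ closure (toE ⁻¹' Ω) ⊆ U ∧ ∀ z ∈ U, AnalyticAt ℝ (fun z => φ (toE z)) z ∧
      fderiv ℝ (fderiv ℝ fun z => φ (toE z)) z 1 1 +
      fderiv ℝ (fderiv ℝ fun z => φ (toE z)) z Complex.I Complex.I = -lam ^ 2 * φ (toE z) := by
  obtain ⟨U, hU, hΩU, hφ⟩ := h.analytic
  set Φ : ℂ → ℝ := fun z => φ (toE z) with hΦdef
  have hΦ : AnalyticOnNhd ℝ Φ (toE ⁻¹' U) := fun z hz =>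
    AnalyticAt.comp (f := toE) (hφ _ hz)
      (toE.toContinuousLinearEquiv.toContinuousLinearMap.analyticAt z)
  have hconn : IsConnected (toE ⁻¹' Ω) := by
    rw [preimage_toE]
    exact hΩ.isConnected.image _ toE.symm.continuous.continuousOn
  obtain ⟨x, hx⟩ := hconn.nonempty
  have hU' : IsOpen (toE ⁻¹' U) := hU.preimage toE.continuous
  have hcl : closure (toE ⁻¹' Ω) ⊆ toE ⁻¹' U := by
    rw [closure_toE]; exact preimage_mono hΩU
  set V := connectedComponentIn (toE ⁻¹' U) x with hV
  have hVU : V ⊆ toE ⁻¹' U := connectedComponentIn_subset _ _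
  have hP : AnalyticOnNhd ℝ (fun z => fderiv ℝ (fderiv ℝ Φ) z 1 1 +
      fderiv ℝ (fderiv ℝ Φ) z Complex.I Complex.I + lam ^ 2 * Φ z) V := by
    intro z hz
    have h2 := (hΦ z (hVU hz)).fderiv.fderiv
    have key (v : ℂ) : AnalyticAt ℝ (fun z => fderiv ℝ (fderiv ℝ Φ) z v v) z := by
      have h3 := ((ContinuousLinearMap.apply ℝ (ℂ →L[ℝ] ℝ) v).analyticAt _).comp h2
      exact ((ContinuousLinearMap.apply ℝ ℝ v).analyticAt _).comp h3
    exact ((key 1).add (key Complex.I)).add (analyticAt_const.mul (hΦ z (hVU hz)))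
  have hzero : EqOn (fun z => fderiv ℝ (fderiv ℝ Φ) z 1 1 +
      fderiv ℝ (fderiv ℝ Φ) z Complex.I Complex.I + lam ^ 2 * Φ z) 0 V := by
    refine hP.eqOn_zero_of_preconnected_of_eventuallyEq_zero isPreconnected_connectedComponentIn
      (mem_connectedComponentIn (hcl (subset_closure hx))) ?_
    filter_upwards [(hΩ.isOpen.preimage toE.continuous).mem_nhds hx] with z hz
    have := lap_toE (hΦ z (hcl (subset_closure hz)))
    rw [h.eigen _ hz] at this
    simp only [Pi.zero_apply, hΦdef] at this ⊢
    linarith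
  refine ⟨V, hU'.connectedComponentIn, hconn.closure.isPreconnected.subset_connectedComponentIn
    (subset_closure hx) hcl, fun z hz => ⟨hΦ z (hVU hz), ?_⟩⟩
  have := hzero hz
  simp only [Pi.zero_apply, hΦdef] at this ⊢
  linarith

lemma exists_eig (hΩ : IsPlaneDomain Ω) (B : BoundaryParam Ω) {lam : ℝ} (hlam : 0 < lam) {φ : E2 → ℝ}
    (h : IsNeumannEigenfunction B lam φ) {Q : ℂ → ℂ}
    (hQ : ∀ s : ℝ, ∃ s', Q s = toE.symm (B.q s') ∧
      (deriv Q s = toE.symm (B.qd s') ∨ deriv Q s = -toE.symm (B.qd s'))) :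
    ∃ M, Eig (toE ⁻¹' Ω) Q lam M (fun z => φ (toE z)) (wgrad fun z => φ (toE z)) := by
  obtain ⟨U, hU, hcl, hz⟩ := exists_nhd_toE hΩ B h
  obtain ⟨x, hx, hφx⟩ := h.nontrivial
  have hbdd : Bornology.IsBounded (toE ⁻¹' Ω) := by
    rw [preimage_toE]
    exact toE.symm.lipschitz.isBounded_image hΩ.isBounded
  have hcont : ContinuousOn (fun z => max |φ (toE z)| ‖wgrad (fun z => φ (toE z)) z‖)
      (closure (toE ⁻¹' Ω)) := by
    intro z hzc
    obtain ⟨hzA, -⟩ := hz z (hcl hzc)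
    obtain ⟨m, hm⟩ := exists_hasWD_wgrad hzA
    exact (ContinuousAt.sup hzA.continuousAt.abs hm.continuousAt.norm).continuousWithinAt
  have hxc : toE.symm x ∈ closure (toE ⁻¹' Ω) := subset_closure (by simpa using hx)
  obtain ⟨y, hy, hmax⟩ := hbdd.isCompact_closure.exists_isMaxOn ⟨_, hxc⟩ hcont
  refine ⟨max |φ (toE y)| ‖wgrad (fun z => φ (toE z)) y‖, hlam, ?_, ⟨U, hU, hcl, fun z hzU => ?_⟩, fun s => ?_,
    fun w hw => (le_max_left _ _).trans (hmax hw), fun w hw => (le_max_right _ _).trans (hmax hw), y, hy, ?_⟩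
  · refine lt_of_lt_of_le ?_ ((le_max_left _ _).trans (hmax hxc))
    simpa using hφx
  · obtain ⟨hzA, hpde⟩ := hz z hzU
    obtain ⟨m, hm⟩ := exists_hasWD_wgrad hzA
    refine ⟨hasWD_ofReal hzA.differentiableAt, m, hm.congr_deriv rfl ?_⟩
    rw [hpde]; push_cast; ring
  · obtain ⟨s', hs, hd⟩ := hQ s
    have := neumann_toE B h s'
    rw [hs]
    rcases hd with hd | hd <;> rw [hd]
    · exact this
    · rw [mul_neg, Complex.neg_im, this, neg_zero]
  · rcases max_choice |φ (toE y)| ‖wgrad (fun z => φ (toE z)) y‖ with h | h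
    · exact Or.inl h.symm
    · exact Or.inr h.symm

end Nodal

/-- The boundary values of a Neumann eigenfunction extend holomorphically to a uniform
strip (independent of `λ`), and the number of complex boundary nodal points is at most
`C·λ`. -/
theorem neumann_complex_boundary_nodal_points
    (Ω : Set E2) (hΩ : IsPlaneDomain Ω) (B : BoundaryParam Ω) (hB : B.IsAnalytic) :
    ∃ ε > (0 : ℝ), ∃ C > (0 : ℝ), ∀ lam : ℝ, 0 < lam → ∀ φ : E2 → ℝ,
      IsNeumannEigenfunction B lam φ →
      ∃ F : ℂ → ℂ,
        DifferentiableOn ℂ F {t : ℂ | |t.im| < ε} ∧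
        (∀ t : ℂ, |t.im| < ε → F (t + B.len) = F t) ∧
        (∀ s : ℝ, F s = (φ (B.q s) : ℂ)) ∧
        ({t : ℂ | 0 ≤ t.re ∧ t.re < B.len ∧ |t.im| ≤ ε / 2 ∧ F t = 0}).Finite ∧
        (({t : ℂ | 0 ≤ t.re ∧ t.re < B.len ∧ |t.im| ≤ ε / 2 ∧ F t = 0}).ncard : ℝ) ≤
          C * lam := by
  obtain ⟨ε, Q, hgeo, hQ⟩ := (Nodal.bdry_toE hΩ B hB).exists_geo
  obtain ⟨C, hC, hcount⟩ := hgeo.exists_zero_count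
  have hreal (s : ℝ) : HasDerivAt (fun s : ℝ => Q s) (deriv Q s) s :=
    (hgeo.hasDerivAt (Nodal.ofReal_mem_strip hgeo.ε_pos s)).comp_ofReal
  refine ⟨ε, hgeo.ε_pos, C, hC, fun lam hlam φ hφ => ?_⟩
  rcases hQ with hQ | hQ
  · obtain ⟨M, hM⟩ := Nodal.exists_eig hΩ B hlam hφ (Q := Q) fun s => ⟨s, hQ s, Or.inl <|
      (hreal s).unique (by simpa only [hQ] using Nodal.hasDerivAt_toE_symm B s)⟩
    obtain ⟨F, hF, hper, hval, hfin, hcard⟩ := hcount hM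
    have hsub : {t : ℂ | 0 ≤ t.re ∧ t.re < B.len ∧ |t.im| ≤ ε / 2 ∧ F t = 0} ⊆
        {t ∈ {t : ℂ | |t.re| ≤ B.len ∧ |t.im| ≤ ε / 2} | F t = 0} := fun t ht =>
      ⟨⟨abs_le.2 ⟨by linarith [ht.1, B.len_pos], ht.2.1.le⟩, ht.2.2.1⟩, ht.2.2.2⟩
    refine ⟨F, hF, hper, fun s => by simp [hval, hQ], hfin.subset hsub, ?_⟩
    exact (Nat.cast_le.2 (Set.ncard_le_ncard hsub hfin)).trans hcard
  · obtain ⟨M, hM⟩ := Nodal.exists_eig hΩ B hlam hφ (Q := Q) fun s => ⟨-s, hQ s, Or.inr <|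
      (hreal s).unique (by
        simpa [Function.comp_def, hQ] using (Nodal.hasDerivAt_toE_symm B (-s)).scomp s (hasDerivAt_neg s))⟩
    obtain ⟨F, hF, hper, hval, hfin, hcard⟩ := hcount hM
    have hsub : {t : ℂ | 0 ≤ t.re ∧ t.re < B.len ∧ |t.im| ≤ ε / 2 ∧ F (-t) = 0} ⊆
        (fun t => -t) '' {t ∈ {t : ℂ | |t.re| ≤ B.len ∧ |t.im| ≤ ε / 2} | F t = 0} := fun t ht =>
      ⟨-t, ⟨⟨abs_le.2 ⟨by simpa using ht.2.1.le, by simp; linarith [ht.1, B.len_pos]⟩,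
        by simpa using ht.2.2.1⟩, ht.2.2.2⟩, neg_neg t⟩
    refine ⟨fun t => F (-t), ?_, fun t ht => ?_, fun s => ?_, (hfin.image _).subset hsub, ?_⟩
    · exact hF.comp differentiable_neg.differentiableOn fun t ht => by
        simpa [Nodal.strip] using ht
    · have := hper (-t - B.len) (by simpa [Nodal.strip] using ht)
      rw [sub_add_cancel] at this
      simp only [this, neg_add']
    · have := hval (-s)
      rw [hQ] at this
      simpa using this
    · refine le_trans ?_ hcard
      exact_mod_cast (Set.ncard_le_ncard hsub (hfin.image _)).trans (Set.ncard_image_le hfin)
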